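/- (Main theorem.) Let σ ∈ 𝔖_s and let 𝐈 ∈ Subsets(r,n,s)^σ be a σ-stable tuple. The following assertions are equivalent: (1) 𝐈 is intersecting; (2) edim 𝐈 ≥ 0 and for all d ∈ [r−1] and all 𝐉 ∈ Intersecting(d,r,s)^σ, edim(𝐈𝐉) ≥ edim 𝐉; (3) edim 𝐈 ≥ 0 and for all d ∈ [r−1] and all 𝐉 ∈ Intersecting^0(d,r,s)^σ, edim(𝐈𝐉) ≥ edim 𝐉. -/

import Mathlib

open Module

noncomputable section

/-- A complete flag on `ℂ^m`: an increasing family of subspaces with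
`dim (F i) = i + 1` (`0`-based indexing, so `F i` is the `i+1`-st step). -/
structure Flagg (m : ℕ) where
  F : Fin m → Submodule ℂ (Fin m → ℂ)
  mono : Monotone F
  rank_eq : ∀ i : Fin m, finrank ℂ (F i) = (i : ℕ) + 1

/-- An `s`-tuple `J` of (strictly increasing) maps `[d] → [r]` is *intersecting* if
for every `s`-tuple of complete flags on `ℂ^r` the corresponding intersection of
Schubert varieties in the Grassmannian `Gr(d, ℂ^r)` is nonempty. -/
def Intersecting {s d r : ℕ} (J : Fin s → Fin d → Fin r) : Prop :=
  ∀ F : Fin s → Flagg r, ∃ V : Submodule ℂ (Fin r → ℂ), finrank ℂ V = d ∧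
    ∀ (l : Fin s) (k : Fin d), (k : ℕ) + 1 ≤ finrank ℂ ↥(V ⊓ (F l).F (J l k))

/-- `dim I = ∑_j (I(j) - j)`. -/
def dimI {d r : ℕ} (J : Fin d → Fin r) : ℤ := ∑ k, ((J k : ℤ) - (k : ℤ))

/-- Expected dimension of a tuple `J ∈ Subsets(d,r,s)`. -/
def edim {s d r : ℕ} (J : Fin s → Fin d → Fin r) : ℤ :=
  (d : ℤ) * ((r : ℤ) - (d : ℤ)) - ∑ l, ((d : ℤ) * ((r : ℤ) - (d : ℤ)) - dimI (J l))

/-- `dim` for raw `ℕ`-valued increasing sequences. -/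
def dimN {d : ℕ} (f : Fin d → ℕ) : ℤ := ∑ k, ((f k : ℤ) - (k : ℤ))

/-- Expected dimension for raw `ℕ`-valued tuples, with ambient dimension `n` explicit. -/
def edimN {s d : ℕ} (n : ℕ) (f : Fin s → Fin d → ℕ) : ℤ :=
  (d : ℤ) * ((n : ℤ) - (d : ℤ)) - ∑ l, ((d : ℤ) * ((n : ℤ) - (d : ℤ)) - dimN (f l))

/-- `T(Λ) = ∑_l ∑_j Λ_l(j)`. -/
def TT {s r : ℕ} (Λ : Fin s → Fin r → ℝ) : ℝ := ∑ l, ∑ j, Λ l j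

/-- `T_J(Λ) = ∑_l ∑_{j ∈ J_l} Λ_l(j)`. -/
def TJ {s d r : ℕ} (J : Fin s → Fin d → Fin r) (Λ : Fin s → Fin r → ℝ) : ℝ :=
  ∑ l, ∑ k, Λ l (J l k)

/-- `Γ(J)_l(k) = k - J_l(k) + (r - d)`, a weakly decreasing real `d`-tuple. -/
def GammaT {s d r : ℕ} (J : Fin s → Fin d → Fin r) : Fin s → Fin d → ℝ :=
  fun l k => (k : ℝ) - (J l k : ℝ) + ((r : ℝ) - (d : ℝ))

/-- Membership of `(Λ, t)` in the Kirwan cone `𝒦(r,s)`: each `Λ_l` is weakly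
decreasing and there are Hermitian matrices `A_1, …, A_s` summing to `t·I_r`
whose decreasingly-ordered spectra are the `Λ_l`. -/
def KirwanMem {s r : ℕ} (Λ : Fin s → Fin r → ℝ) (t : ℝ) : Prop :=
  (∀ l, Antitone (Λ l)) ∧
  ∃ (A : Fin s → Matrix (Fin r) (Fin r) ℂ) (hA : ∀ l, (A l).IsHermitian),
    (∑ l, A l) = (t : ℂ) • (1 : Matrix (Fin r) (Fin r) ℂ) ∧
    ∀ l, ∃ e : Equiv.Perm (Fin r), ∀ i, Λ l i = (hA l).eigenvalues (e i)

/-- The subspace of a flag with `k` elements (so `flagAt G 0 = ⊥`). -/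
def flagAt {m : ℕ} (G : Flagg m) : ℕ → Submodule ℂ (Fin m → ℂ)
  | 0 => ⊥
  | (k + 1) => if h : k < m then G.F ⟨k, h⟩ else ⊤

/-- The space `ℒ_I(F,G)` of linear maps `φ : ℂ^r → ℂ^q` with
`φ(F_l(j)) ⊆ G_l(I_l(j) - j)` for all `l, j`. -/
def LSpace {s r q : ℕ} (I : Fin s → Fin r → ℕ) (F : Fin s → Flagg r) (G : Fin s → Flagg q) :
    Submodule ℂ ((Fin r → ℂ) →ₗ[ℂ] (Fin q → ℂ)) where
  carrier := {φ | ∀ (l : Fin s) (j : Fin r), ∀ v ∈ (F l).F j,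
    φ v ∈ flagAt (G l) (I l j - (j : ℕ))}
  add_mem' := by
    intro a b ha hb l j v hv
    simpa using add_mem (ha l j v hv) (hb l j v hv)
  zero_mem' := by
    intro l j v hv
    simp
  smul_mem' := by
    intro c a ha l j v hv
    simpa using Submodule.smul_mem _ c (ha l j v hv)

/-- The true dimension `tdim I`, for a raw tuple `I ∈ Subsets(r, r + q, s)`
(here `q = n - r`). -/
def tdim {s : ℕ} (r q : ℕ) (I : Fin s → Fin r → ℕ) : ℕ :=
  sInf {m : ℕ | ∃ (F : Fin s → Flagg r) (G : Fin s → Flagg q), finrank ℂ (LSpace I F G) = m}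

/-- The kernel dimension `kdim I`. -/
def kdim {s : ℕ} (r q : ℕ) (I : Fin s → Fin r → ℕ) : ℕ :=
  sInf {m : ℕ | ∃ (F : Fin s → Flagg r) (G : Fin s → Flagg q)
      (φ : (Fin r → ℂ) →ₗ[ℂ] (Fin q → ℂ)), φ ∈ LSpace I F G ∧
      finrank ℂ (LSpace I F G) = tdim r q I ∧ finrank ℂ (LinearMap.ker φ) = m}

/-- The (`0`-based) Schubert position of a subspace `W` w.r.t. a flag:
`posN Fl W k` is the least `j` with `dim (Fl(j) ⊓ W) = k + 1`. -/
def posN {m : ℕ} (Fl : Flagg m) (W : Submodule ℂ (Fin m → ℂ)) (k : ℕ) : ℕ :=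
  sInf {j : ℕ | ∃ h : j < m, finrank ℂ ↥(Fl.F ⟨j, h⟩ ⊓ W) = k + 1}

/-- The (`0`-based, `ℕ`-valued) kernel position `kPos(I)_l(k)`. -/
def kPosFun {s : ℕ} (r q : ℕ) (I : Fin s → Fin r → ℕ) (l : Fin s) (k : ℕ) : ℕ :=
  sInf {p : ℕ | ∃ (F : Fin s → Flagg r) (G : Fin s → Flagg q)
      (φ : (Fin r → ℂ) →ₗ[ℂ] (Fin q → ℂ)), φ ∈ LSpace I F G ∧
      finrank ℂ (LSpace I F G) = tdim r q I ∧
      finrank ℂ (LinearMap.ker φ) = kdim r q I ∧ posN (F l) (LinearMap.ker φ) k = p}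

/-- Apply an `r`-tuple of reals at a natural index (junk value `0` out of range). -/
def applyI {r : ℕ} (f : Fin r → ℝ) (j : ℕ) : ℝ := if h : j < r then f ⟨j, h⟩ else 0

/-- Apply an `r`-tuple of naturals at a natural index (junk value `0` out of range). -/
def applyN {r : ℕ} (f : Fin r → ℕ) (j : ℕ) : ℕ := if h : j < r then f ⟨j, h⟩ else 0

/-- The slope `slope_θ(J) = (1/d) ∑_l ∑_{j ∈ J_l} θ_l(j)` of a tuple. -/
def slopeT {s d r : ℕ} (θ : Fin s → Fin r → ℝ) (J : Fin s → Fin d → Fin r) : ℝ :=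
  ((d : ℝ))⁻¹ * ∑ l, ∑ k, θ l (J l k)

/-- The slope `slope_θ(W, F) = slope_θ(Pos(W, F))` of a (nonzero) subspace. -/
def slopeW {s r : ℕ} (θ : Fin s → Fin r → ℝ) (F : Fin s → Flagg r)
    (W : Submodule ℂ (Fin r → ℂ)) : ℝ :=
  ((finrank ℂ W : ℝ))⁻¹ * ∑ l, ∑ k ∈ Finset.range (finrank ℂ W), applyI (θ l) (posN (F l) W k)

end
set_option linter.all false

noncomputable section
namespace Horn
open MvPolynomial

/-- Jacobian of a polynomial map. -/
def Jac {ι κ : Type} [Fintype ι] (Φ : κ → MvPolynomial ι ℂ) (x v : ι → ℂ) : κ → ℂ :=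
  fun k => ∑ i, v i * eval x (pderiv i (Φ k))

lemma pderiv_aeval {ι κ : Type} [Fintype κ] (Φ : κ → MvPolynomial ι ℂ) (P : MvPolynomial κ ℂ)
    (i : ι) : pderiv i (aeval Φ P) = ∑ k, aeval Φ (pderiv k P) * pderiv i (Φ k) := by
  classical
  induction P using MvPolynomial.induction_on with
  | C a => simp [algebraMap_eq]
  | add p q hp hq =>
    simp only [map_add, hp, hq, add_mul, Finset.sum_add_distrib]
  | mul_X p n hp =>
    have h : ∀ k, aeval Φ (pderiv k (p * X n)) * pderiv i (Φ k) =
        (aeval Φ (pderiv k p) * pderiv i (Φ k)) * Φ n +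
          (if k = n then aeval Φ p * pderiv i (Φ k) else 0) := by
      intro k
      rw [pderiv_mul, map_add, map_mul, map_mul, aeval_X]
      split_ifs with hk
      · rw [hk, pderiv_X_self, map_one]; ring
      · rw [pderiv_X_of_ne (Ne.symm hk), map_zero]; ring
    rw [Finset.sum_congr rfl (fun k _ => h k), Finset.sum_add_distrib, ← Finset.sum_mul, ← hp,
      map_mul, aeval_X, pderiv_mul]
    simp

lemma eq_C_of_pderiv {κ : Type} (P : MvPolynomial κ ℂ) (h : ∀ k, pderiv k P = 0) :
    P = C (coeff 0 P) := by
  classical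
  ext m
  rw [coeff_C]
  split_ifs with hm
  · rw [hm]
  · obtain ⟨k, hk⟩ : ∃ k, m k ≠ 0 := by
      by_contra hc; push Not at hc; exact hm (by ext k; simp [hc k])
    have h1 := coeff_pderiv (i := k) P (m - Finsupp.single k 1)
    rw [h k, tsub_add_cancel_of_le (by
      rw [Finsupp.single_le_iff]; omega)] at h1
    simp only [coeff_zero] at h1
    exact (mul_eq_zero.mp h1.symm).resolve_right (Nat.cast_add_one_ne_zero _)

lemma totalDegree_pderiv_lt {κ : Type} (P : MvPolynomial κ ℂ) (k : κ) (h : pderiv k P ≠ 0) :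
    (pderiv k P).totalDegree < P.totalDegree := by
  classical
  obtain ⟨m, hm, hm2⟩ := Finset.exists_mem_eq_sup (pderiv k P).support (support_nonempty.mpr h)
    (fun s => s.sum fun _ e => e)
  have h1 : coeff (m + Finsupp.single k 1) P ≠ 0 := by
    intro h0
    have := coeff_pderiv (i := k) P m
    rw [h0, zero_mul] at this
    exact (mem_support_iff.mp hm) this
  have h2 := le_totalDegree (mem_support_iff.mpr h1)
  rw [Finsupp.sum_add_index' (by simp) (by simp), Finsupp.sum_single_index rfl] at h2
  have h3 : (pderiv k P).totalDegree = m.sum fun _ e => e := hm2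
  omega

theorem algIndep_of_jac {ι κ : Type} [Fintype ι] [Fintype κ] (Φ : κ → MvPolynomial ι ℂ)
    (x : ι → ℂ) (h : ∀ y, ∃ v, Jac Φ x v = y) : AlgebraicIndependent ℂ Φ := by
  classical
  choose v hv using fun k : κ => h (Pi.single k 1)
  set N : Matrix κ κ (MvPolynomial ι ℂ) := fun a k => ∑ i, C (v a i) * pderiv i (Φ k) with hN
  have hdet : N.det ≠ 0 := by
    intro h0
    have h1 : (eval x) N.det = 0 := by rw [h0, map_zero]
    rw [RingHom.map_det] at h1
    have h2 : (eval x).mapMatrix N = 1 := by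
      ext a k
      have := congrFun (hv a) k
      simp only [Jac] at this
      have h3 : (eval x).mapMatrix N a k = eval x (∑ i, C (v a i) * pderiv i (Φ k)) := rfl
      rw [h3]
      simp only [map_sum, map_mul, eval_C, this, Matrix.one_apply, Pi.single_apply]
      simp [eq_comm]
    rw [h2, Matrix.det_one] at h1
    exact one_ne_zero h1
  rw [algebraicIndependent_iff]
  suffices H : ∀ n, ∀ P : MvPolynomial κ ℂ, P.totalDegree ≤ n → aeval Φ P = 0 → P = 0 from
    fun P hP => H _ P le_rfl hP
  intro n
  induction n using Nat.strong_induction_on with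
  | _ n ih =>
    intro P hPn hP
    have hw : (fun k => aeval Φ (pderiv k P)) = 0 := by
      apply Matrix.eq_zero_of_mulVec_eq_zero hdet
      ext1 a
      simp only [Matrix.mulVec, dotProduct, hN, Finset.sum_mul, Pi.zero_apply]
      rw [Finset.sum_comm]
      apply Finset.sum_eq_zero
      intro i _
      have h3 := pderiv_aeval Φ P i
      rw [hP, map_zero] at h3
      calc _ = C (v a i) * ∑ k, aeval Φ (pderiv k P) * pderiv i (Φ k) := by
            rw [Finset.mul_sum]; apply Finset.sum_congr rfl; intros; ring
        _ = 0 := by rw [← h3, mul_zero]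
    have hz : ∀ k, pderiv k P = 0 := by
      intro k
      by_contra hne
      have := totalDegree_pderiv_lt P k hne
      exact hne (ih _ (lt_of_lt_of_le this hPn) _ le_rfl (congrFun hw k))
    have hC := eq_C_of_pderiv P hz
    rw [hC] at hP
    rw [hC]
    simp only [algHom_C, algebraMap_eq] at hP
    have := (C_injective ι ℂ) (hP.trans (map_zero C).symm)
    rw [this, map_zero]

lemma exists_eval_ne_zero {ι : Type} (P : MvPolynomial ι ℂ) (h : P ≠ 0) : ∃ x, eval x P ≠ 0 := by
  by_contra hc
  push Not at hc
  exact h (MvPolynomial.funext (fun x => by simp [hc x]))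

lemma deriv_aeval_of_kills {ι : Type} (D : Derivation ℂ (MvPolynomial ι ℂ) (MvPolynomial ι ℂ))
    (A : Subalgebra ℂ (MvPolynomial ι ℂ)) (hA : ∀ a ∈ A, D a = 0) (p : Polynomial A)
    (y : MvPolynomial ι ℂ) :
    D (Polynomial.aeval y p) = Polynomial.aeval y (Polynomial.derivative p) * D y := by
  induction p using Polynomial.induction_on' with
  | add p q hp hq => simp only [map_add, hp, hq, add_mul]
  | monomial n a =>
    rw [Polynomial.aeval_monomial, Polynomial.derivative_monomial, Polynomial.aeval_monomial,
      Derivation.leibniz, Derivation.leibniz_pow]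
    have : D (algebraMap A (MvPolynomial ι ℂ) a) = 0 := hA _ a.2
    rw [this]
    simp only [smul_eq_mul, nsmul_eq_mul, mul_zero, add_zero, map_mul, map_natCast]
    ring

theorem jac_of_algIndep {ι κ : Type} [Fintype ι] [Fintype κ] (Φ : κ → MvPolynomial ι ℂ)
    (hΦ : AlgebraicIndependent ℂ Φ) (δ : MvPolynomial ι ℂ) (hδ : δ ≠ 0) :
    ∃ x, eval x δ ≠ 0 ∧ ∀ y, ∃ v, Jac Φ x v = y := by
  classical
  obtain ⟨t, hst, ht⟩ := exists_isTranscendenceBasis_superset (R := ℂ) (s := Set.range Φ)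
    hΦ.to_subtype_range 
  have hcard := ht.cardinalMk_eq (IsTranscendenceBasis.mvPolynomial ι ℂ)
  obtain ⟨e⟩ := Cardinal.eq.mp hcard
  set J : Matrix ι ι (MvPolynomial ι ℂ) := fun a i => pderiv i (e.symm a : MvPolynomial ι ℂ) with hJ
  have hdet : J.det ≠ 0 := by
    intro h0
    obtain ⟨w, hw0, hw⟩ := Matrix.exists_mulVec_eq_zero_iff.mpr h0
    apply hw0
    set D : Derivation ℂ (MvPolynomial ι ℂ) (MvPolynomial ι ℂ) := ∑ i, w i • pderiv i with hD
    have hDa : ∀ a, D a = ∑ i, w i * pderiv i a := by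
      intro a
      rw [hD, ← Derivation.coeFnAddMonoidHom_apply, map_sum, Finset.sum_apply]
      rfl
    have hkill : ∀ a ∈ Algebra.adjoin ℂ (Set.range ((↑) : t → MvPolynomial ι ℂ)), D a = 0 := by
      intro a ha
      induction ha using Algebra.adjoin_induction with
      | mem x hx =>
        obtain ⟨y, rfl⟩ := hx
        have := congrFun hw (e y)
        simp only [Matrix.mulVec, dotProduct, hJ, Equiv.symm_apply_apply, Pi.zero_apply] at this
        rw [hDa, ← this]
        apply Finset.sum_congr rfl; intros; ring
      | algebraMap r => simp
      | add x y _ _ hx hy => simp [hx, hy]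
      | mul x y _ _ hx hy => simp [hx, hy]
    have halg := ht.isAlgebraic
    have hX : ∀ j, D (X j) = 0 := by
      intro j
      set A := Algebra.adjoin ℂ (Set.range ((↑) : t → MvPolynomial ι ℂ)) with hA
      have hex : ∃ n, ∃ p : Polynomial A, p ≠ 0 ∧ Polynomial.aeval (X j : MvPolynomial ι ℂ) p = 0
          ∧ p.natDegree = n := by
        obtain ⟨p, hp, hp2⟩ := halg.isAlgebraic (X j : MvPolynomial ι ℂ)
        exact ⟨_, p, hp, hp2, rfl⟩
      obtain ⟨p, hp, hp2, hpn⟩ := Nat.find_spec hex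
      have h1 := deriv_aeval_of_kills D A hkill p (X j)
      rw [hp2, map_zero] at h1
      rcases mul_eq_zero.mp h1.symm with h2 | h2
      · exfalso
        by_cases hd : p.natDegree = 0
        · rw [Polynomial.eq_C_of_natDegree_eq_zero hd, Polynomial.aeval_C] at hp2
          have : p.coeff 0 = 0 := by
            apply Subtype.ext; exact hp2
          rw [Polynomial.eq_C_of_natDegree_eq_zero hd, this] at hp
          simp at hp
        · have hlt := Polynomial.natDegree_derivative_lt hd
          refine Nat.find_min hex (m := (Polynomial.derivative p).natDegree) (by omega) 
            ⟨Polynomial.derivative p, ?_, h2, rfl⟩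
          intro h3
          exact hd (Polynomial.natDegree_eq_zero_of_derivative_eq_zero h3)
      · exact h2
    ext1 j
    have := hX j
    rw [hDa, Finset.sum_eq_single j] at this
    · simpa using this
    · intro b _ hb; rw [pderiv_X_of_ne (Ne.symm hb), mul_zero]
    · simp
  obtain ⟨x, hx⟩ := exists_eval_ne_zero _ (mul_ne_zero hdet hδ)
  rw [map_mul] at hx
  refine ⟨x, right_ne_zero_of_mul hx, fun y => ?_⟩
  have hJx : ((eval x).mapMatrix J).det ≠ 0 := by
    rw [← RingHom.map_det]; exact left_ne_zero_of_mul hx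
  set M := (eval x).mapMatrix J with hM
  set z : ι → ℂ := fun a => if h : ∃ k, Φ k = (e.symm a : MvPolynomial ι ℂ) then y h.choose else 0
    with hz
  refine ⟨M⁻¹.mulVec z, ?_⟩
  have h1 : M.mulVec (M⁻¹.mulVec z) = z := by
    rw [Matrix.mulVec_mulVec, Matrix.mul_nonsing_inv _ (isUnit_iff_ne_zero.mpr hJx),
      Matrix.one_mulVec]
  ext1 k
  have h2 := congrFun h1 (e ⟨Φ k, hst ⟨k, rfl⟩⟩)
  have h3 : z (e ⟨Φ k, hst ⟨k, rfl⟩⟩) = y k := by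
    have hex : ∃ k', Φ k' = (e.symm (e ⟨Φ k, hst ⟨k, rfl⟩⟩) : MvPolynomial ι ℂ) := ⟨k, by simp⟩
    simp only [hz]
    rw [dif_pos hex]
    congr 1
    apply hΦ.injective
    rw [hex.choose_spec]; simp
  rw [h3] at h2
  rw [← h2]
  have h4 : ∀ i, M (e ⟨Φ k, hst ⟨k, rfl⟩⟩) i = eval x (pderiv i (Φ k)) := by
    intro i
    have : M (e ⟨Φ k, hst ⟨k, rfl⟩⟩) i = eval x (pderiv i
      (e.symm (e ⟨Φ k, hst ⟨k, rfl⟩⟩) : MvPolynomial ι ℂ)) := rfl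
    rw [this, Equiv.symm_apply_apply]
  generalize M⁻¹.mulVec z = w
  simp only [Jac, Matrix.mulVec, dotProduct, h4]
  apply Finset.sum_congr rfl; intros; ring

end Horn

end

noncomputable section
namespace Horn
open MvPolynomial

theorem dominant_image {ι κ : Type} [Finite ι] [Finite κ] (Φ : κ → MvPolynomial ι ℂ)
    (hΦ : AlgebraicIndependent ℂ Φ) (δ : MvPolynomial ι ℂ) (hδ : δ ≠ 0) :
    ∃ P : MvPolynomial κ ℂ, P ≠ 0 ∧ ∀ y, eval y P ≠ 0 →
      ∃ x, eval x δ ≠ 0 ∧ ∀ k, eval x (Φ k) = y k := by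
  classical
  set f : MvPolynomial κ ℂ →+* MvPolynomial ι ℂ := (aeval Φ).toRingHom with hf
  have hfp : f.FinitePresentation := by
    rw [← RingHom.FinitePresentation.of_finiteType]
    apply RingHom.FiniteType.of_comp_finiteType (f := (C : ℂ →+* MvPolynomial κ ℂ))
    have : f.comp C = (algebraMap ℂ (MvPolynomial ι ℂ)) := by
      ext1 a; simp [hf]
    rw [this, RingHom.finiteType_algebraMap]
    infer_instance
  have hc := PrimeSpectrum.isConstructible_comap_image hfp
    (PrimeSpectrum.isConstructible_basicOpen (f := δ))
  obtain ⟨S, hS⟩ := PrimeSpectrum.exists_constructibleSetData_iff.mpr hc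
  have hbot : (⊥ : PrimeSpectrum (MvPolynomial κ ℂ)) ∈ S.toSet := by
    rw [hS]
    refine ⟨⊥, ?_, ?_⟩
    · simpa using hδ
    · ext1
      ext a
      change f a ∈ (⊥ : Ideal (MvPolynomial ι ℂ)) ↔ a ∈ (⊥ : Ideal (MvPolynomial κ ℂ))
      rw [Ideal.mem_bot, Ideal.mem_bot]
      constructor
      · intro h; exact (algebraicIndependent_iff.mp hΦ) a h
      · intro h; rw [h, map_zero]
  obtain ⟨D, hD, hDb⟩ := Set.mem_iUnion₂.mp hbot
  have hg : ∀ i, D.g i = 0 := by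
    intro i
    have := hDb.1 ⟨i, rfl⟩
    exact this
  have hf0 : D.f ≠ 0 := by
    intro h0
    apply hDb.2
    rw [h0]
    intro a ha
    rw [Set.mem_singleton_iff] at ha
    rw [ha]; exact Submodule.zero_mem _
  refine ⟨D.f, hf0, fun y hy => ?_⟩
  set m : PrimeSpectrum (MvPolynomial κ ℂ) := ⟨vanishingIdeal ℂ {y}, inferInstance⟩ with hm
  have hmS : m ∈ S.toSet := by
    refine Set.mem_iUnion₂.mpr ⟨D, hD, ?_, ?_⟩
    · rintro _ ⟨i, rfl⟩
      rw [hg]; exact Submodule.zero_mem _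
    · intro h
      have h1 : D.f ∈ vanishingIdeal ℂ {y} := h rfl
      rw [mem_vanishingIdeal_singleton_iff] at h1
      exact hy h1
  rw [hS] at hmS
  obtain ⟨q, hq, hqm⟩ := hmS
  have hδq : δ ∉ q.asIdeal := hq
  have hv : vanishingIdeal ℂ (zeroLocus ℂ q.asIdeal) = q.asIdeal := by
    rw [vanishingIdeal_zeroLocus_eq_radical, q.2.radical]
  rw [← hv, mem_vanishingIdeal_iff] at hδq
  push Not at hδq
  obtain ⟨x, hx, hxδ⟩ := hδq
  refine ⟨x, hxδ, fun k => ?_⟩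
  have h1 : (X k - C (y k) : MvPolynomial κ ℂ) ∈ m.asIdeal := by
    rw [hm]; change _ ∈ vanishingIdeal ℂ {y}
    rw [mem_vanishingIdeal_singleton_iff]; simp
  rw [← hqm] at h1
  have h2 : f (X k - C (y k)) ∈ q.asIdeal := h1
  have h3 := hx _ h2
  simp [hf] at h3
  rw [← sub_eq_zero]
  simpa [sub_eq_zero, coe_aeval_eq_eval] using h3

/-! ### Genericity -/

/-- `S` contains an open dense set. -/
def Gen {E : Type*} [TopologicalSpace E] (S : Set E) : Prop := ∃ O ⊆ S, IsOpen O ∧ Dense O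

lemma Gen.inter {E : Type*} [TopologicalSpace E] {S T : Set E} (hS : Gen S) (hT : Gen T) :
    Gen (S ∩ T) := by
  obtain ⟨O, h1, h2, h3⟩ := hS
  obtain ⟨O', h1', h2', h3'⟩ := hT
  exact ⟨O ∩ O', Set.inter_subset_inter h1 h1', h2.inter h2', h3.inter_of_isOpen_left h3' h2⟩

lemma Gen.mono {E : Type*} [TopologicalSpace E] {S T : Set E} (hS : Gen S) (h : S ⊆ T) :
    Gen T := by
  obtain ⟨O, h1, h2, h3⟩ := hS
  exact ⟨O, h1.trans h, h2, h3⟩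

lemma Gen.univ {E : Type*} [TopologicalSpace E] : Gen (Set.univ : Set E) :=
  ⟨Set.univ, subset_rfl, isOpen_univ, dense_univ⟩

lemma Gen.all {E : Type*} [TopologicalSpace E] {ι : Type*} [Finite ι] {S : ι → Set E}
    (hS : ∀ i, Gen (S i)) : Gen {x | ∀ i, x ∈ S i} := by
  classical
  have : Fintype ι := Fintype.ofFinite ι
  have H : ∀ t : Finset ι, Gen {x | ∀ i ∈ t, x ∈ S i} := by
    intro t
    induction t using Finset.induction_on with
    | empty => exact Gen.univ.mono (by intro x _; simp)
    | insert a t _ ih =>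
      exact ((hS a).inter ih).mono (by
        rintro x ⟨h1, h2⟩ i hi
        rcases Finset.mem_insert.mp hi with rfl | h
        · exact h1
        · exact h2 i h)
  exact (H Finset.univ).mono (fun x hx i => hx i (Finset.mem_univ _))

lemma Gen.nonempty {E : Type*} [TopologicalSpace E] [Nonempty E] {S : Set E} (hS : Gen S) :
    S.Nonempty := by
  obtain ⟨O, h1, h2, h3⟩ := hS
  exact h3.nonempty.mono h1

lemma Gen.dense {E : Type*} [TopologicalSpace E] {S : Set E} (hS : Gen S) : Dense S := by
  obtain ⟨O, h1, h2, h3⟩ := hS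
  exact h3.mono h1

lemma Gen.imp {E : Type*} [TopologicalSpace E] {S : Set E} {p : Prop} (hS : p → Gen S) :
    Gen {x | p → x ∈ S} := by
  by_cases h : p
  · exact (hS h).mono (fun x hx _ => hx)
  · exact Gen.univ.mono (fun x _ hp => absurd hp h)

/-- Polynomial-like functions. -/
def Ent {E : Type*} [AddCommGroup E] [Module ℂ E] [TopologicalSpace E] (F : E → ℂ) : Prop :=
  Continuous F ∧ ∀ x y : E, Differentiable ℂ (fun t : ℂ => F (x + t • y))

section Ent
variable {E : Type*} [AddCommGroup E] [Module ℂ E] [TopologicalSpace E]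

lemma Ent.const (c : ℂ) : Ent (fun _ : E => c) := ⟨continuous_const, fun _ _ => by fun_prop⟩
lemma Ent.add {F G : E → ℂ} (hF : Ent F) (hG : Ent G) : Ent (fun x => F x + G x) :=
  ⟨hF.1.add hG.1, fun x y => (hF.2 x y).add (hG.2 x y)⟩
lemma Ent.mul {F G : E → ℂ} (hF : Ent F) (hG : Ent G) : Ent (fun x => F x * G x) :=
  ⟨hF.1.mul hG.1, fun x y => (hF.2 x y).mul (hG.2 x y)⟩
lemma Ent.sum {ι : Type*} (s : Finset ι) {F : ι → E → ℂ} (hF : ∀ i, Ent (F i)) :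
    Ent (fun x => ∑ i ∈ s, F i x) := by
  classical
  induction s using Finset.induction_on with
  | empty => simpa using Ent.const 0
  | insert a t ha ih =>
    simp only [Finset.sum_insert ha]
    exact (hF a).add ih
lemma Ent.prod {ι : Type*} (s : Finset ι) {F : ι → E → ℂ} (hF : ∀ i, Ent (F i)) :
    Ent (fun x => ∏ i ∈ s, F i x) := by
  classical
  induction s using Finset.induction_on with
  | empty => simpa using Ent.const 1
  | insert a t ha ih =>
    simp only [Finset.prod_insert ha]
    exact (hF a).mul ih
lemma Ent.det {ι : Type*} [Fintype ι] [DecidableEq ι] {M : E → Matrix ι ι ℂ}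
    (hM : ∀ i j, Ent (fun x => M x i j)) : Ent (fun x => (M x).det) := by
  simp only [Matrix.det_apply']
  exact Ent.sum _ (fun σ => (Ent.const _).mul (Ent.prod _ (fun i => hM _ _)))
lemma Ent.mulM {m n k : Type*} [Fintype n] {M : E → Matrix m n ℂ} {N : E → Matrix n k ℂ}
    (hM : ∀ i j, Ent (fun x => M x i j)) (hN : ∀ i j, Ent (fun x => N x i j)) (i j) :
    Ent (fun x => (M x * N x) i j) := by
  simp only [Matrix.mul_apply]
  exact Ent.sum _ (fun a => (hM _ _).mul (hN _ _))
lemma Ent.adj {ι : Type*} [Fintype ι] [DecidableEq ι] {M : E → Matrix ι ι ℂ}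
    (hM : ∀ i j, Ent (fun x => M x i j)) (i j) : Ent (fun x => (M x).adjugate i j) := by
  simp only [Matrix.adjugate_apply]
  apply Ent.det
  intro a b
  simp only [Matrix.updateRow_apply]
  split_ifs
  · exact Ent.const _
  · exact hM _ _
lemma Ent.clm {F : E → ℂ} (hF : Continuous F) (ha : ∀ x y, F (x + y) = F x + F y)
    (hs : ∀ (c : ℂ) x, F (c • x) = c * F x) : Ent F :=
  ⟨hF, fun x y => by simp only [ha, hs]; fun_prop⟩
lemma Ent.comp {E' : Type*} [AddCommGroup E'] [Module ℂ E'] [TopologicalSpace E'] {F : E → ℂ}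
    (hF : Ent F) {L : E' → E} (hL : Continuous L) (ha : ∀ x y, L (x + y) = L x + L y)
    (hs : ∀ (c : ℂ) x, L (c • x) = c • L x) : Ent (fun x => F (L x)) :=
  ⟨hF.1.comp hL, fun x y => by simp only [ha, hs]; exact hF.2 _ _⟩

lemma Ent.gen [ContinuousAdd E] [ContinuousSMul ℂ E] {F : E → ℂ} (hF : Ent F) (x0 : E)
    (h0 : F x0 ≠ 0) : Gen {x | F x ≠ 0} := by
  refine ⟨_, subset_rfl, isOpen_ne_fun hF.1 continuous_const, ?_⟩
  intro x
  rw [mem_closure_iff_frequently]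
  intro hev
  set g : ℂ → ℂ := fun t => F (x + t • (x0 - x)) with hg
  have hgd : Differentiable ℂ g := hF.2 _ _
  have hcont : Continuous (fun t : ℂ => x + t • (x0 - x)) := by fun_prop
  have hev2 : ∀ᶠ t in nhds (0 : ℂ), g t = 0 := by
    have : Filter.Tendsto (fun t : ℂ => x + t • (x0 - x)) (nhds 0) (nhds x) := by
      have := hcont.tendsto 0
      simpa using this
    filter_upwards [this.eventually hev] with t ht
    by_contra hc
    exact ht hc
  have han : AnalyticOnNhd ℂ g Set.univ := fun z _ => hgd.analyticAt z
  have := han.eqOn_zero_of_preconnected_of_eventuallyEq_zero isPreconnected_univ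
    (Set.mem_univ 0) hev2 (Set.mem_univ 1)
  apply h0
  simpa [hg] using this

lemma exists_rank_factor {m n : Type*} [Fintype m] [Fintype n] [DecidableEq m] [DecidableEq n]
    (M : Matrix m n ℂ) :
    ∃ (π : Matrix (Fin M.rank) m ℂ) (ι : Matrix n (Fin M.rank) ℂ), π * M * ι = 1 := by
  classical
  set f := M.mulVecLin with hf
  have hr : finrank ℂ (LinearMap.range f) = M.rank := rfl
  set b := Module.finBasisOfFinrankEq ℂ (LinearMap.range f) hr with hb
  choose w hw using fun j => (b j).2
  set g : (Fin M.rank → ℂ) →ₗ[ℂ] (m → ℂ) := f ∘ₗ (Fintype.linearCombination ℂ w) with hg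
  have hginj : Function.Injective g := by
    have : g = (LinearMap.range f).subtype ∘ₗ (b.equivFun.symm : (Fin M.rank → ℂ) →ₗ[ℂ] _) := by
      apply LinearMap.pi_ext'
      intro i
      ext1
      simp [hg, Fintype.linearCombination_apply, hw, Basis.equivFun_symm_apply,
        Pi.single_apply]
    rw [this]
    exact (Subtype.val_injective).comp b.equivFun.symm.injective
  obtain ⟨p, hp⟩ := g.exists_leftInverse_of_injective (LinearMap.ker_eq_bot.mpr hginj)
  refine ⟨LinearMap.toMatrix' p, LinearMap.toMatrix' (Fintype.linearCombination ℂ w), ?_⟩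
  have hM : M = LinearMap.toMatrix' f := by
    rw [hf]; exact (LinearMap.toMatrix'_toLin' M).symm
  have h2 : M * LinearMap.toMatrix' (Fintype.linearCombination ℂ w) = LinearMap.toMatrix' g := by
    rw [hg, LinearMap.toMatrix'_comp, ← hM]
  rw [Matrix.mul_assoc, h2, ← LinearMap.toMatrix'_comp, hp, LinearMap.toMatrix'_id]

lemma gen_rank [ContinuousAdd E] [ContinuousSMul ℂ E] {m n : Type*} [Fintype m] [Fintype n]
    [DecidableEq m] [DecidableEq n] {M : E → Matrix m n ℂ} (hM : ∀ i j, Ent (fun x => M x i j))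
    (x0 : E) : Gen {x | (M x0).rank ≤ (M x).rank} := by
  obtain ⟨π, ι, h⟩ := exists_rank_factor (M x0)
  have hE : Ent (fun x => (π * M x * ι).det) := by
    apply Ent.det
    apply Ent.mulM (M := fun x => π * M x) (N := fun _ => ι)
    · apply Ent.mulM (M := fun x => π) (N := M)
      · intros; exact Ent.const _
      · exact hM
    · intros; exact Ent.const _
  refine (hE.gen x0 (by rw [h]; simp)).mono ?_
  intro x hx
  have h1 : (π * M x * ι).rank = (M x0).rank := by
    rw [Matrix.rank_of_isUnit _ ((Matrix.isUnit_iff_isUnit_det _).mpr (isUnit_iff_ne_zero.mpr hx))]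
    simp
  change (M x0).rank ≤ (M x).rank
  rw [← h1]
  exact (Matrix.rank_mul_le_left _ _).trans (Matrix.rank_mul_le_right _ _)

end Ent

lemma Ent.mvp {ι : Type} (P : MvPolynomial ι ℂ) : Ent (fun x : ι → ℂ => eval x P) := by
  induction P using MvPolynomial.induction_on with
  | C a => simpa using Ent.const a
  | add p q hp hq => simpa using hp.add hq
  | mul_X p n hp =>
    simp only [map_mul, eval_X]
    exact hp.mul (Ent.clm (continuous_apply n) (fun _ _ => rfl) (fun _ _ => rfl))

lemma gen_mvp {ι : Type} (P : MvPolynomial ι ℂ) (h : P ≠ 0) : Gen {x : ι → ℂ | eval x P ≠ 0} := by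
  obtain ⟨x, hx⟩ := exists_eval_ne_zero P h
  exact (Ent.mvp P).gen x hx

end Horn

end

noncomputable section
namespace Horn

lemma adapted {E : Type*} [AddCommGroup E] [Module ℂ E] [FiniteDimensional ℂ E] (d : ℕ)
    (X : Fin d → Submodule ℂ E) (h : ∀ k : Fin d, (k : ℕ) + 1 ≤ finrank ℂ (X k)) :
    ∃ v : Fin d → E, LinearIndependent ℂ v ∧ ∀ k, v k ∈ X k := by
  induction d with
  | zero => exact ⟨Fin.elim0, linearIndependent_empty_type, fun k => k.elim0⟩
  | succ d ih =>
    obtain ⟨v, hv, hvX⟩ := ih (fun k => X k.castSucc) (fun k => h k.castSucc)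
    have : ¬ (X (Fin.last d) ≤ Submodule.span ℂ (Set.range v)) := by
      intro hle
      have h1 := Submodule.finrank_mono hle
      have h2 := h (Fin.last d)
      have h3 := finrank_range_le_card (R := ℂ) v
      simp only [Fin.val_last, Fintype.card_fin] at h2 h3
      have h4 : finrank ℂ (Submodule.span ℂ (Set.range v)) ≤ d := h3
      omega
    obtain ⟨x, hx, hx2⟩ := SetLike.not_le_iff_exists.mp this
    refine ⟨Fin.snoc v x, linearIndependent_finSnoc.mpr ⟨hv, hx2⟩, ?_⟩
    intro k
    refine Fin.lastCases ?_ (fun i => ?_) k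
    · simpa using hx
    · simpa using hvX i

/-- Coordinate subspace in coordinates `u`. -/
def fl {r : ℕ} (u : Matrix (Fin r) (Fin r) ℂ) (A : Set (Fin r)) : Submodule ℂ (Fin r → ℂ) where
  carrier := {v | ∀ a, a ∉ A → u.mulVec v a = 0}
  add_mem' := by intro x y hx hy a ha; simp [Matrix.mulVec_add, hx a ha, hy a ha]
  zero_mem' := by intro a _; simp
  smul_mem' := by intro c x hx a ha; simp [Matrix.mulVec_smul, hx a ha]

lemma mem_fl {r : ℕ} {u : Matrix (Fin r) (Fin r) ℂ} {A : Set (Fin r)} {v : Fin r → ℂ} :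
    v ∈ fl u A ↔ ∀ a, a ∉ A → u.mulVec v a = 0 := Iff.rfl

lemma fl_mono {r : ℕ} (u : Matrix (Fin r) (Fin r) ℂ) {A B : Set (Fin r)} (h : A ⊆ B) :
    fl u A ≤ fl u B := fun v hv a ha => hv a (fun h' => ha (h h'))

/-- The data of a position: vectors with leading coordinates `J`. -/
def IsPos {r d : ℕ} (u : Matrix (Fin r) (Fin r) ℂ) (S : Submodule ℂ (Fin r → ℂ))
    (J : Fin d → Fin r) (w : Fin d → Fin r → ℂ) : Prop :=
  ∀ k, w k ∈ S ∧ u.mulVec (w k) (J k) = 1 ∧ ∀ a, J k < a → u.mulVec (w k) a = 0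

lemma leading_indep {r d : ℕ} (u : Matrix (Fin r) (Fin r) ℂ)
    (J : Fin d → Fin r) (hJ : StrictMono J) (w : Fin d → Fin r → ℂ)
    (h1 : ∀ k, u.mulVec (w k) (J k) = 1) (h2 : ∀ k a, J k < a → u.mulVec (w k) a = 0)
    (c : Fin d → ℂ) (A : Set (Fin r)) 
    (h : ∑ k, c k • w k ∈ fl u A) : ∀ k, (∀ k', k ≤ k' → J k' ∉ A) → c k = 0 := by
  have key : ∀ n : ℕ, ∀ k : Fin d, d - (k : ℕ) = n → (∀ k', k ≤ k' → J k' ∉ A) → c k = 0 := by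
    intro n
    induction n using Nat.strong_induction_on with
    | _ n ih =>
      intro k hk hA
      have h0 := h (J k) (hA k le_rfl)
      rw [Matrix.mulVec_sum, Finset.sum_apply, Finset.sum_eq_single k] at h0
      · simpa [Matrix.mulVec_smul, h1] using h0
      · intro b _ hb
        rw [Matrix.mulVec_smul, Pi.smul_apply, smul_eq_mul]
        rcases lt_or_gt_of_ne hb with hlt | hgt
        · rw [h2 b _ (hJ hlt), mul_zero]
        · rw [ih (d - b) (by have := b.2; have := Fin.lt_def.mp hgt; omega) b rfl (fun k' hk' =>
            hA k' (hgt.le.trans hk')), zero_mul]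
      · simp
  exact fun k => key _ k rfl

lemma IsPos.linearIndependent {r d : ℕ} {u : Matrix (Fin r) (Fin r) ℂ}
    {S : Submodule ℂ (Fin r → ℂ)} {J : Fin d → Fin r} {w : Fin d → Fin r → ℂ}
    (h : IsPos u S J w) (hJ : StrictMono J) : LinearIndependent ℂ w := by
  rw [Fintype.linearIndependent_iff]
  intro c hc k
  exact leading_indep u J hJ w (fun k => (h k).2.1) (fun k => (h k).2.2) c ∅
    (by rw [hc]; exact Submodule.zero_mem _) k (by simp)

lemma IsPos.span_eq {r d : ℕ} {u : Matrix (Fin r) (Fin r) ℂ}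
    {S : Submodule ℂ (Fin r → ℂ)} {J : Fin d → Fin r} {w : Fin d → Fin r → ℂ}
    (h : IsPos u S J w) (hJ : StrictMono J) (hS : finrank ℂ S = d) :
    Submodule.span ℂ (Set.range w) = S := by
  apply Submodule.eq_of_le_of_finrank_eq
  · rw [Submodule.span_le]; rintro _ ⟨k, rfl⟩; exact (h k).1
  · rw [finrank_span_eq_card (h.linearIndependent hJ), hS]; simp

lemma IsPos.finrank_eq {r d : ℕ} {u : Matrix (Fin r) (Fin r) ℂ}
    {S : Submodule ℂ (Fin r → ℂ)} {J : Fin d → Fin r} {w : Fin d → Fin r → ℂ}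
    (h : IsPos u S J w) (hJ : StrictMono J) (hS : finrank ℂ S = d) (A : Set (Fin r))
    (hA : IsLowerSet A) [DecidablePred (fun k => J k ∈ A)] :
    finrank ℂ ↥(S ⊓ fl u A) = (Finset.univ.filter (fun k => J k ∈ A)).card := by
  classical
  have hli := h.linearIndependent hJ
  have : S ⊓ fl u A = Submodule.span ℂ (Set.range (fun k : {k // J k ∈ A} => w k.1)) := by
    apply le_antisymm
    · rintro v ⟨hv1, hv2⟩
      have hv1' : v ∈ S := hv1
      rw [← h.span_eq hJ hS, Submodule.mem_span_range_iff_exists_fun] at hv1'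
      obtain ⟨c, rfl⟩ := hv1'
      apply Submodule.sum_mem
      intro k _
      by_cases hk : J k ∈ A
      · exact Submodule.smul_mem _ _ (Submodule.subset_span ⟨⟨k, hk⟩, rfl⟩)
      · rw [leading_indep u J hJ w (fun k => (h k).2.1) (fun k => (h k).2.2) c A hv2 k, zero_smul]
        · exact Submodule.zero_mem _
        · intro k' hk' hc
          exact hk (hA (hJ.monotone hk') hc)
    · rw [Submodule.span_le]
      rintro _ ⟨k, rfl⟩
      refine ⟨(h k).1, ?_⟩
      intro a ha
      apply (h k).2.2
      by_contra hc
      exact ha (hA (not_lt.mp hc) k.2)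
  have h5 := finrank_span_eq_card (hli.comp (fun k : {k // J k ∈ A} => k.1) Subtype.val_injective)
  rw [this, ← Fintype.card_subtype]
  exact h5

lemma exists_pos {r d : ℕ} (u : Matrix (Fin r) (Fin r) ℂ) (hu : IsUnit u.det)
    (S : Submodule ℂ (Fin r → ℂ)) (hS : finrank ℂ S = d) :
    ∃ (J : Fin d → Fin r) (w : Fin d → Fin r → ℂ), StrictMono J ∧ IsPos u S J w := by
  classical
  set T : Finset (Fin r) := Finset.univ.filter (fun j => ∃ v ∈ S, u.mulVec v j = 1 ∧
    ∀ a, j < a → u.mulVec v a = 0) with hT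
  have hTm : ∀ j : T, ∃ v ∈ S, u.mulVec v j = 1 ∧ ∀ a, (j : Fin r) < a → u.mulVec v a = 0 :=
    fun j => (Finset.mem_filter.mp j.2).2
  choose v hv1 hv2 hv3 using hTm
  have hinj : ∀ x ∈ S, (∀ j ∈ T, u.mulVec x j = 0) → x = 0 := by
    intro x hx h0
    by_contra hne
    have hux : u.mulVec x ≠ 0 := by
      intro h; exact hne (Matrix.eq_zero_of_mulVec_eq_zero hu.ne_zero h)
    set B := Finset.univ.filter (fun a => u.mulVec x a ≠ 0) with hB
    have hBne : B.Nonempty := by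
      obtain ⟨a, ha⟩ := Function.ne_iff.mp hux
      exact ⟨a, by simpa [hB] using ha⟩
    have hmax := B.max'_mem hBne
    set j := B.max' hBne with hj
    have hj0 : u.mulVec x j ≠ 0 := by
      have := hmax; rw [hB, Finset.mem_filter] at this; exact this.2
    apply hj0
    apply h0
    rw [hT, Finset.mem_filter]
    refine ⟨Finset.mem_univ _, (u.mulVec x j)⁻¹ • x, S.smul_mem _ hx, ?_, ?_⟩
    · simp [Matrix.mulVec_smul, hj0]
    · intro a ha
      have : u.mulVec x a = 0 := by
        by_contra hc
        have := B.le_max' a (by simpa [hB] using hc)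
        exact absurd ha (not_lt.mpr this)
      simp [Matrix.mulVec_smul, this]
  have hle : d ≤ T.card := by
    set f : S →ₗ[ℂ] (T → ℂ) := (LinearMap.pi (fun j : T => LinearMap.proj (j : Fin r))) ∘ₗ
      u.mulVecLin ∘ₗ S.subtype with hf
    have hfi : Function.Injective f := by
      rw [← LinearMap.ker_eq_bot, LinearMap.ker_eq_bot']
      intro x hx
      apply Subtype.ext
      apply hinj x x.2
      intro j hj
      exact congrFun hx ⟨j, hj⟩
    have := LinearMap.finrank_le_finrank_of_injective hfi
    simpa [hS] using this
  set J' := T.orderEmbOfFin rfl with hJ'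
  have hmem : ∀ i, J' i ∈ T := fun i => T.orderEmbOfFin_mem rfl i
  have hP : IsPos u S (J') (fun i => v ⟨J' i, hmem i⟩) := fun i =>
    ⟨hv1 _, hv2 _, hv3 _⟩
  have hge : T.card ≤ d := by
    have h1 := hP.linearIndependent J'.strictMono
    have h2 : Submodule.span ℂ (Set.range (fun i => v ⟨J' i, hmem i⟩)) ≤ S := by
      rw [Submodule.span_le]; rintro _ ⟨i, rfl⟩; exact hv1 _
    have h3 := Submodule.finrank_mono h2
    rw [finrank_span_eq_card h1, hS] at h3
    simpa using h3
  have hc : T.card = d := le_antisymm hge hle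
  subst hc
  exact ⟨J', _, J'.strictMono, hP⟩

lemma finrank_fl {r : ℕ} (u : Matrix (Fin r) (Fin r) ℂ) (hu : IsUnit u.det) (i : Fin r) :
    finrank ℂ (fl u (Set.Iic i)) = i + 1 := by
  classical
  have hP : IsPos u ⊤ id (fun k => u⁻¹.mulVec (Pi.single k 1)) := by
    intro k
    rw [Matrix.mulVec_mulVec, Matrix.mul_nonsing_inv _ hu, Matrix.one_mulVec]
    refine ⟨trivial, by simp, fun a ha => ?_⟩
    have hne : a ≠ k := ne_of_gt ha
    simp [Pi.single_apply, hne]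
  have := hP.finrank_eq strictMono_id (by simp) (Set.Iic i) (isLowerSet_Iic i)
  rw [top_inf_eq] at this
  rw [this]
  simp only [id, Set.mem_Iic]
  have h2 : (Finset.univ.filter (fun k : Fin r => k ≤ i)) = Finset.Iic i := by ext; simp
  rw [h2]; simp

/-- The flag of an invertible matrix. -/
def flagOf {r : ℕ} (u : Matrix (Fin r) (Fin r) ℂ) (hu : IsUnit u.det) : Flagg r where
  F := fun i => fl u (Set.Iic i)
  mono := fun i j h => fl_mono u (Set.Iic_subset_Iic.mpr h)
  rank_eq := finrank_fl u hu

lemma exists_flagOf {r : ℕ} (F : Flagg r) : ∃ u : Matrix (Fin r) (Fin r) ℂ, IsUnit u.det ∧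
    ∀ i, F.F i = fl u (Set.Iic i) := by
  obtain ⟨v, hv, hvF⟩ := adapted r F.F (fun k => (F.rank_eq k).ge)
  set M : Matrix (Fin r) (Fin r) ℂ := (Matrix.of v).transpose with hM
  have hMu : IsUnit M := by
    rw [← Matrix.linearIndependent_cols_iff_isUnit]; exact hv
  have hMd : IsUnit M.det := (Matrix.isUnit_iff_isUnit_det _).mp hMu
  have hud : IsUnit (M⁻¹).det := by rw [Matrix.isUnit_nonsing_inv_det_iff]; exact hMd
  refine ⟨M⁻¹, hud, fun i => ?_⟩
  symm
  apply Submodule.eq_of_le_of_finrank_eq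
  · intro x hx
    have hx2 : x = ∑ k, (M⁻¹.mulVec x) k • v k := by
      have : M.mulVec (M⁻¹.mulVec x) = x := by
        rw [Matrix.mulVec_mulVec, Matrix.mul_nonsing_inv _ hMd, Matrix.one_mulVec]
      conv_lhs => rw [← this]
      ext a
      simp [Matrix.mulVec, dotProduct, hM, mul_comm]
    rw [hx2]
    apply Submodule.sum_mem
    intro k _
    by_cases hk : k ≤ i
    · exact Submodule.smul_mem _ _ (F.mono hk (hvF k))
    · rw [hx k hk, zero_smul]; exact Submodule.zero_mem _
  · rw [finrank_fl _ hud, F.rank_eq]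

/-- `V` lies in the intersection of Schubert varieties. -/
def Om {s d r : ℕ} (K : Fin s → Fin d → Fin r) (u : Fin s → Matrix (Fin r) (Fin r) ℂ)
    (V : Submodule ℂ (Fin r → ℂ)) : Prop :=
  finrank ℂ V = d ∧ ∀ (l : Fin s) (k : Fin d), (k : ℕ) + 1 ≤ finrank ℂ ↥(V ⊓ fl (u l) (Set.Iic (K l k)))

lemma intersecting_iff {s d r : ℕ} (K : Fin s → Fin d → Fin r) :
    Intersecting K ↔ ∀ u : Fin s → Matrix (Fin r) (Fin r) ℂ, (∀ l, IsUnit (u l).det) →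
      ∃ V, Om K u V := by
  constructor
  · intro h u hu
    obtain ⟨V, h1, h2⟩ := h (fun l => flagOf (u l) (hu l))
    exact ⟨V, h1, h2⟩
  · intro h F
    choose u hu hF using fun l => exists_flagOf (F l)
    obtain ⟨V, h1, h2⟩ := h u hu
    exact ⟨V, h1, fun l k => by rw [hF]; exact h2 l k⟩

/-- Matrix data witnessing `Om`. -/
def OmM {s d r : ℕ} (K : Fin s → Fin d → Fin r) (u : Fin s → Matrix (Fin r) (Fin r) ℂ)
    (ι : Matrix (Fin r) (Fin d) ℂ) (c : Fin s → Matrix (Fin d) (Fin d) ℂ) : Prop :=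
  ∀ l, IsUnit (c l).det ∧ ∀ k a, K l k < a → (u l * ι * c l) a k = 0

lemma mulVec_col {m n k : Type*} [Fintype n] [Fintype m] (A : Matrix k m ℂ) (B : Matrix m n ℂ) (j : n) (a : k) :
    A.mulVec (fun i => B i j) a = (A * B) a j := rfl

lemma Om.toM {s d r : ℕ} {K : Fin s → Fin d → Fin r} {u : Fin s → Matrix (Fin r) (Fin r) ℂ}
    {V : Submodule ℂ (Fin r → ℂ)} (h : Om K u V) :
    ∀ (ι : Matrix (Fin r) (Fin d) ℂ), LinearMap.range ι.mulVecLin = V →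
      ∃ c, OmM K u ι c := by
  intro ι hι
  have hinj : Function.Injective ι.mulVecLin := by
    rw [← LinearMap.ker_eq_bot, ← Submodule.finrank_eq_zero]
    have := LinearMap.finrank_range_add_finrank_ker ι.mulVecLin
    rw [hι, h.1] at this
    simp at this; simpa using this
  have key : ∀ l, ∃ c : Matrix (Fin d) (Fin d) ℂ, IsUnit c.det ∧
      ∀ k a, K l k < a → (u l * ι * c) a k = 0 := by
    intro l
    obtain ⟨v, hv, hvX⟩ := adapted d (fun k => V ⊓ fl (u l) (Set.Iic (K l k))) (h.2 l)
    have hvr : ∀ k, ∃ w, ι.mulVecLin w = v k := fun k => by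
      have := (hvX k).1; rw [← hι] at this; exact this
    choose w hw using hvr
    have hwi : LinearIndependent ℂ w := by
      apply LinearIndependent.of_comp ι.mulVecLin
      have : (ι.mulVecLin ∘ w) = v := funext hw
      rw [this]; exact hv
    refine ⟨(Matrix.of w).transpose, ?_, ?_⟩
    · rw [← Matrix.isUnit_iff_isUnit_det, ← Matrix.linearIndependent_cols_iff_isUnit]; exact hwi
    · intro k a ha
      have h1 := (hvX k).2 a (by simpa using ha)
      rw [← hw k] at h1
      rw [Matrix.mul_assoc]
      exact h1
  choose c hc using key
  exact ⟨c, hc⟩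

lemma Om.exists_mat {d r : ℕ} {V : Submodule ℂ (Fin r → ℂ)} (h : finrank ℂ V = d) :
    ∃ (ι : Matrix (Fin r) (Fin d) ℂ) (lam : Matrix (Fin d) (Fin r) ℂ), lam * ι = 1 ∧
      LinearMap.range ι.mulVecLin = V := by
  set b := finBasisOfFinrankEq ℂ V h with hb
  set g : (Fin d → ℂ) →ₗ[ℂ] (Fin r → ℂ) := V.subtype ∘ₗ (b.equivFun.symm : _ →ₗ[ℂ] V) with hg
  have hgi : Function.Injective g := (Subtype.val_injective).comp b.equivFun.symm.injective
  obtain ⟨p, hp⟩ := g.exists_leftInverse_of_injective (LinearMap.ker_eq_bot.mpr hgi)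
  refine ⟨LinearMap.toMatrix' g, LinearMap.toMatrix' p, ?_, ?_⟩
  · rw [← LinearMap.toMatrix'_comp, hp, LinearMap.toMatrix'_id]
  · have : (LinearMap.toMatrix' g).mulVecLin = g := Matrix.toLin'_toMatrix' g
    rw [this, hg, LinearMap.range_comp]
    simp

lemma OmM.toOm {s d r : ℕ} {K : Fin s → Fin d → Fin r} (hK : ∀ l, Monotone (K l))
    {u : Fin s → Matrix (Fin r) (Fin r) ℂ}
    {ι : Matrix (Fin r) (Fin d) ℂ} {lam : Matrix (Fin d) (Fin r) ℂ} (hι : lam * ι = 1)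
    {c : Fin s → Matrix (Fin d) (Fin d) ℂ} (h : OmM K u ι c) :
    Om K u (LinearMap.range ι.mulVecLin) := by
  have hinj : Function.Injective ι.mulVecLin := by
    apply Function.LeftInverse.injective (g := lam.mulVecLin)
    intro x
    simp [Matrix.mulVec_mulVec, hι]
  refine ⟨by rw [LinearMap.finrank_range_of_inj hinj]; simp, fun l k => ?_⟩
  have hli : LinearIndependent ℂ (fun j => ι.mulVecLin ((c l).col j)) := by
    apply LinearIndependent.map' _ _ (LinearMap.ker_eq_bot.mpr hinj)
    rw [Matrix.linearIndependent_cols_iff_isUnit, Matrix.isUnit_iff_isUnit_det]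
    exact (h l).1
  have hli2 := hli.comp (fun j : Set.Iic k => (j : Fin d)) Subtype.val_injective
  have h1 := finrank_span_eq_card hli2
  have h2 : Fintype.card (Set.Iic k) = k + 1 := by simp
  rw [← h2, ← h1]
  apply Submodule.finrank_mono
  rw [Submodule.span_le]
  rintro _ ⟨j, rfl⟩
  refine ⟨⟨_, rfl⟩, ?_⟩
  intro a ha
  have := (h l).2 (j : Fin d) a (lt_of_le_of_lt (hK l j.2) (by simpa using ha))
  rw [Matrix.mul_assoc] at this
  exact this

lemma IsPos.om {s r d : ℕ} {u : Fin s → Matrix (Fin r) (Fin r) ℂ}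
    {S : Submodule ℂ (Fin r → ℂ)} {J : Fin s → Fin d → Fin r} {w : Fin s → Fin d → Fin r → ℂ}
    (h : ∀ l, IsPos (u l) S (J l) (w l)) (hJ : ∀ l, StrictMono (J l)) (hS : finrank ℂ S = d) :
    Om J u S := by
  classical
  refine ⟨hS, fun l k => ?_⟩
  rw [(h l).finrank_eq (hJ l) hS _ (isLowerSet_Iic _)]
  have : (Finset.univ.filter (fun k' => J l k' ∈ Set.Iic (J l k))) = Finset.Iic k := by
    ext k'; simp [(hJ l).le_iff_le]
  rw [this]; simp

lemma IsPos.le_of_om {r d : ℕ} {u : Matrix (Fin r) (Fin r) ℂ}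
    {S : Submodule ℂ (Fin r → ℂ)} {J K : Fin d → Fin r} {w : Fin d → Fin r → ℂ}
    (h : IsPos u S J w) (hJ : StrictMono J) (hS : finrank ℂ S = d) (k : Fin d)
    (hK : (k : ℕ) + 1 ≤ finrank ℂ ↥(S ⊓ fl u (Set.Iic (K k)))) : J k ≤ K k := by
  classical
  rw [h.finrank_eq hJ hS _ (isLowerSet_Iic _)] at hK
  by_contra hc
  push Not at hc
  have : (Finset.univ.filter (fun k' => J k' ∈ Set.Iic (K k))) ⊆ Finset.Iio k := by
    intro k' hk'
    simp at hk'
    simp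
    exact hJ.lt_iff_lt.mp (lt_of_le_of_lt hk' hc)
  have := Finset.card_le_card this
  rw [Fin.card_Iio] at this
  omega

end Horn

end

noncomputable section
namespace Horn

def Surj {s d p : ℕ} (b : Fin s → Fin d → ℕ) (f : Fin s → Matrix (Fin d) (Fin d) ℂ)
    (g : Fin s → Matrix (Fin p) (Fin p) ℂ) : Prop :=
  ∀ τ : Fin s → Matrix (Fin p) (Fin d) ℂ, ∃ φ : Matrix (Fin p) (Fin d) ℂ,
    ∀ (l : Fin s) (i : Fin p) (k : Fin d), b l k ≤ (i : ℕ) → (g l * φ * f l) i k = τ l i k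

def Good {s d : ℕ} (p : ℕ) (b : Fin s → Fin d → ℕ) : Prop :=
  ∃ (f : Fin s → Matrix (Fin d) (Fin d) ℂ) (g : Fin s → Matrix (Fin p) (Fin p) ℂ), Surj b f g

def ee {s d : ℕ} (p : ℕ) (b : Fin s → Fin d → ℕ) : ℤ :=
  (p : ℤ) * d - ∑ l, ∑ k, ((p : ℤ) - b l k)

abbrev Rows {s d : ℕ} (p : ℕ) (b : Fin s → Fin d → ℕ) : Type :=
  {x : Fin s × Fin p × Fin d // b x.1 x.2.2 ≤ (x.2.1 : ℕ)}

def Tm {s d p : ℕ} (b : Fin s → Fin d → ℕ) (f : Fin s → Matrix (Fin d) (Fin d) ℂ)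
    (g : Fin s → Matrix (Fin p) (Fin p) ℂ) : Matrix (Rows p b) (Fin p × Fin d) ℂ :=
  fun x y => g x.1.1 x.1.2.1 y.1 * f x.1.1 y.2 x.1.2.2

lemma Tm_mulVec {s d p : ℕ} (b : Fin s → Fin d → ℕ) (f : Fin s → Matrix (Fin d) (Fin d) ℂ)
    (g : Fin s → Matrix (Fin p) (Fin p) ℂ) (φ : Fin p × Fin d → ℂ) (x : Rows p b) :
    (Tm b f g).mulVec φ x = (g x.1.1 * (Matrix.of fun i j => φ (i, j)) * f x.1.1) x.1.2.1 x.1.2.2 := by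
  simp only [Matrix.mulVec, dotProduct, Tm, Matrix.mul_apply, Matrix.of_apply, Finset.sum_mul,
    Fintype.sum_prod_type]
  rw [Finset.sum_comm]
  apply Finset.sum_congr rfl; intro a _
  apply Finset.sum_congr rfl; intro c _
  ring

lemma surj_iff {s d p : ℕ} (b : Fin s → Fin d → ℕ) (f : Fin s → Matrix (Fin d) (Fin d) ℂ)
    (g : Fin s → Matrix (Fin p) (Fin p) ℂ) :
    Surj b f g ↔ Function.Surjective (Tm b f g).mulVecLin := by
  constructor
  · intro h τ
    obtain ⟨φ, hφ⟩ := h (fun l => Matrix.of fun i k => if h : b l k ≤ (i : ℕ) then τ ⟨(l, i, k), h⟩ else 0)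
    refine ⟨fun y => φ y.1 y.2, ?_⟩
    ext x
    rw [Matrix.mulVecLin_apply, Tm_mulVec]
    have := hφ x.1.1 x.1.2.1 x.1.2.2 x.2
    rw [Matrix.of_apply, dif_pos x.2] at this
    exact this
  · intro h τ
    obtain ⟨φ, hφ⟩ := h (fun x => τ x.1.1 x.1.2.1 x.1.2.2)
    refine ⟨Matrix.of fun i j => φ (i, j), fun l i k hb => ?_⟩
    have := congrFun hφ ⟨(l, i, k), hb⟩
    rw [Matrix.mulVecLin_apply, Tm_mulVec] at this
    exact this

lemma surj_iff_rank {s d p : ℕ} (b : Fin s → Fin d → ℕ) (f : Fin s → Matrix (Fin d) (Fin d) ℂ)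
    (g : Fin s → Matrix (Fin p) (Fin p) ℂ) :
    Surj b f g ↔ Fintype.card (Rows p b) ≤ (Tm b f g).rank := by
  rw [surj_iff, ← LinearMap.range_eq_top]
  constructor
  · intro h
    rw [Matrix.rank, h, finrank_top]; simp
  · intro h
    apply Submodule.eq_top_of_finrank_eq
    apply le_antisymm (Submodule.finrank_le _)
    rw [finrank_fintype_fun_eq_card]; exact h

lemma card_rows {s d p : ℕ} (b : Fin s → Fin d → ℕ) (hb : ∀ l k, b l k ≤ p) :
    (Fintype.card (Rows p b) : ℤ) = ∑ l, ∑ k, ((p : ℤ) - b l k) := by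
  classical
  rw [Fintype.card_subtype, Finset.card_filter]
  rw [Fintype.sum_prod_type]
  push_cast
  apply Finset.sum_congr rfl; intro l _
  rw [Fintype.sum_prod_type, Finset.sum_comm]
  apply Finset.sum_congr rfl; intro k _
  have h1 : (∑ i : Fin p, if b l k ≤ (i : ℕ) then (1 : ℤ) else 0) =
      ((Finset.univ.filter (fun i : Fin p => b l k ≤ (i : ℕ))).card : ℤ) := by
    rw [Finset.card_filter]; push_cast; rfl
  rw [h1]
  have h2 : (Finset.univ.filter (fun i : Fin p => b l k ≤ (i : ℕ))).card = p - b l k := by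
    have h3 := Finset.card_filter_add_card_filter_not (s := (Finset.univ : Finset (Fin p)))
      (fun i : Fin p => b l k ≤ (i : ℕ))
    simp only [not_le, Finset.card_univ, Fintype.card_fin] at h3
    have h4 : (Finset.univ.filter (fun i : Fin p => (i : ℕ) < b l k)).card = b l k := by
      rw [Fin.card_filter_val_lt]; exact min_eq_right (hb l k)
    omega
  rw [h2]; push_cast [hb l k]; ring

lemma ee_nonneg {s d p : ℕ} {b : Fin s → Fin d → ℕ} (hb : ∀ l k, b l k ≤ p) (h : Good p b) :
    0 ≤ ee p b := by
  obtain ⟨f, g, h⟩ := h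
  rw [surj_iff_rank] at h
  have h2 := h.trans (Matrix.rank_le_card_width (Tm b f g))
  have h3 := card_rows b hb
  simp only [Fintype.card_prod, Fintype.card_fin] at h2
  unfold ee
  rw [← h3]
  have : (Fintype.card (Rows p b) : ℤ) ≤ p * d := by exact_mod_cast h2
  linarith

section
variable {E : Type*} [AddCommGroup E] [Module ℂ E] [TopologicalSpace E]
  [ContinuousAdd E] [ContinuousSMul ℂ E]

lemma gen_Tm_rank {s d p : ℕ} (b : Fin s → Fin d → ℕ) (F : E → Fin s → Matrix (Fin d) (Fin d) ℂ)
    (G : E → Fin s → Matrix (Fin p) (Fin p) ℂ) (hF : ∀ l i j, Ent (fun x => F x l i j))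
    (hG : ∀ l i j, Ent (fun x => G x l i j)) (x0 : E) :
    Gen {x | (Tm b (F x0) (G x0)).rank ≤ (Tm b (F x) (G x)).rank} := by
  apply gen_rank (M := fun x => Tm b (F x) (G x))
  intro i j
  exact (hG _ _ _).mul (hF _ _ _)

lemma gen_surj {s d p : ℕ} (b : Fin s → Fin d → ℕ) (F : E → Fin s → Matrix (Fin d) (Fin d) ℂ)
    (G : E → Fin s → Matrix (Fin p) (Fin p) ℂ) (hF : ∀ l i j, Ent (fun x => F x l i j))
    (hG : ∀ l i j, Ent (fun x => G x l i j)) (x0 : E) (h : Surj b (F x0) (G x0)) :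
    Gen {x | Surj b (F x) (G x)} := by
  refine (gen_Tm_rank b F G hF hG x0).mono (fun x hx => ?_)
  rw [surj_iff_rank] at h
  rw [Set.mem_setOf_eq, surj_iff_rank]
  exact h.trans hx

lemma gen_unit {s d : ℕ} (F : E → Fin s → Matrix (Fin d) (Fin d) ℂ)
    (hF : ∀ l i j, Ent (fun x => F x l i j)) (x0 : E) (h0 : ∀ l, IsUnit (F x0 l).det) :
    Gen {x | ∀ l, IsUnit (F x l).det} := by
  apply Gen.all (S := fun l => {x | IsUnit (F x l).det})
  intro l
  exact ((Ent.det (hF l)).gen x0 (h0 l).ne_zero).mono (fun x hx => isUnit_iff_ne_zero.mpr hx)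
end

lemma ent_coord {s d : ℕ} (l : Fin s) (i j : Fin d) :
    Ent (fun x : Fin s → Matrix (Fin d) (Fin d) ℂ => x l i j) :=
  Ent.clm (by fun_prop) (fun _ _ => rfl) (fun _ _ => rfl)

lemma Good.inv {s d p : ℕ} {b : Fin s → Fin d → ℕ} (h : Good p b) :
    ∃ (f : Fin s → Matrix (Fin d) (Fin d) ℂ) (g : Fin s → Matrix (Fin p) (Fin p) ℂ), Surj b f g ∧
      (∀ l, IsUnit (f l).det) ∧ ∀ l, IsUnit (g l).det := by
  obtain ⟨f, g, h⟩ := h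
  have e1 : ∀ l i j, Ent (fun x : (Fin s → Matrix (Fin d) (Fin d) ℂ) × (Fin s → Matrix (Fin p) (Fin p) ℂ) => x.1 l i j) := fun l i j =>
    Ent.clm (by fun_prop) (fun _ _ => rfl) (fun _ _ => rfl)
  have e2 : ∀ l i j, Ent (fun x : (Fin s → Matrix (Fin d) (Fin d) ℂ) × (Fin s → Matrix (Fin p) (Fin p) ℂ) => x.2 l i j) := fun l i j =>
    Ent.clm (by fun_prop) (fun _ _ => rfl) (fun _ _ => rfl)
  have h1 := gen_surj b (fun x : (Fin s → Matrix (Fin d) (Fin d) ℂ) × (Fin s → Matrix (Fin p) (Fin p) ℂ) => x.1) (fun x : (Fin s → Matrix (Fin d) (Fin d) ℂ) × (Fin s → Matrix (Fin p) (Fin p) ℂ) => x.2) e1 e2 (f, g) h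
  have h2 := gen_unit (fun x : (Fin s → Matrix (Fin d) (Fin d) ℂ) × (Fin s → Matrix (Fin p) (Fin p) ℂ) => x.1) e1 (fun _ => 1, fun _ => 1) (by simp)
  have h3 := gen_unit (fun x : (Fin s → Matrix (Fin d) (Fin d) ℂ) × (Fin s → Matrix (Fin p) (Fin p) ℂ) => x.2) e2 (fun _ => 1, fun _ => 1) (by simp)
  obtain ⟨x, ⟨hx1, hx2⟩, hx3⟩ := ((h1.inter h2).inter h3).nonempty
  exact ⟨x.1, x.2, hx1, hx2, hx3⟩

lemma Good.comp {s d r p : ℕ} {b : Fin s → Fin r → ℕ} (hb : ∀ l, Monotone (b l)) (h : Good p b)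
    {J : Fin s → Fin d → Fin r} (hJ : Intersecting J) : Good p (fun l k => b l (J l k)) := by
  obtain ⟨f, g, hfg, hf, hg⟩ := h.inv
  obtain ⟨V, hV⟩ := (intersecting_iff J).mp hJ (fun l => (f l)⁻¹)
    (fun l => by rw [Matrix.isUnit_nonsing_inv_det_iff]; exact hf l)
  obtain ⟨ι, lam, hι, hιV⟩ := Om.exists_mat hV.1
  obtain ⟨c, hc⟩ := hV.toM ι hιV
  refine ⟨c, g, fun τ => ?_⟩
  obtain ⟨φ, hφ⟩ := hfg (fun l => τ l * ((c l)⁻¹ * lam * f l))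
  refine ⟨φ * ι, fun l i k hik => ?_⟩
  have e1 : g l * (φ * ι) * c l = (g l * φ * f l) * ((f l)⁻¹ * ι * c l) := by
    have := Matrix.mul_nonsing_inv (f l) (hf l)
    calc g l * (φ * ι) * c l = g l * φ * (1 : Matrix (Fin r) (Fin r) ℂ) * (ι * c l) := by simp only [Matrix.mul_one, Matrix.mul_assoc]
      _ = _ := by rw [← this]; simp only [Matrix.mul_assoc]
  have e2 : τ l = (τ l * ((c l)⁻¹ * lam * f l)) * ((f l)⁻¹ * ι * c l) := by
    have h1 := Matrix.mul_nonsing_inv (f l) (hf l)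
    have h2 := Matrix.nonsing_inv_mul (c l) (hc l).1
    have : (c l)⁻¹ * lam * f l * ((f l)⁻¹ * ι * c l) = 1 := by
      calc (c l)⁻¹ * lam * f l * ((f l)⁻¹ * ι * c l) 
          = (c l)⁻¹ * (lam * (f l * (f l)⁻¹) * ι) * c l := by simp only [Matrix.mul_assoc]
        _ = 1 := by rw [h1, Matrix.mul_one, hι, Matrix.mul_one, h2]
    rw [Matrix.mul_assoc, this, Matrix.mul_one]
  rw [e1, e2, Matrix.mul_apply, Matrix.mul_apply]
  apply Finset.sum_congr rfl
  intro a _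
  by_cases ha : J l k < a
  · rw [(hc l).2 k a ha]; simp
  · rw [hφ l i a ((hb l (not_lt.mp ha)).trans hik)]

lemma Intersecting.comp {s d' d r : ℕ} {J : Fin s → Fin d → Fin r} {K : Fin s → Fin d' → Fin d}
    (hJm : ∀ l, Monotone (J l)) (hKm : ∀ l, Monotone (K l)) 
    (hJ : Intersecting J) (hK : Intersecting K) : Intersecting (fun l k => J l (K l k)) := by
  rw [intersecting_iff]
  intro u hu
  obtain ⟨V, hV⟩ := (intersecting_iff J).mp hJ u hu
  obtain ⟨ι, lam, hι, hιV⟩ := Om.exists_mat hV.1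
  obtain ⟨c, hc⟩ := hV.toM ι hιV
  obtain ⟨V', hV'⟩ := (intersecting_iff K).mp hK (fun l => (c l)⁻¹)
    (fun l => by rw [Matrix.isUnit_nonsing_inv_det_iff]; exact (hc l).1)
  obtain ⟨ι', lam', hι', hιV'⟩ := Om.exists_mat hV'.1
  obtain ⟨c', hc'⟩ := hV'.toM ι' hιV'
  refine ⟨_, OmM.toOm (fun l => (hJm l).comp (hKm l)) (ι := ι * ι') (lam := lam' * lam) ?_ (c := c') ?_⟩
  · calc lam' * lam * (ι * ι') = lam' * (lam * ι) * ι' := by simp only [Matrix.mul_assoc]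
      _ = 1 := by rw [hι, Matrix.mul_one, hι']
  · intro l
    refine ⟨(hc' l).1, fun k a ha => ?_⟩
    have e1 : u l * (ι * ι') * c' l = (u l * ι * c l) * ((c l)⁻¹ * ι' * c' l) := by
      have := Matrix.mul_nonsing_inv (c l) (hc l).1
      calc u l * (ι * ι') * c' l = u l * ι * (1 : Matrix (Fin d) (Fin d) ℂ) * (ι' * c' l) := by
            simp only [Matrix.mul_one, Matrix.mul_assoc]
        _ = _ := by rw [← this]; simp only [Matrix.mul_assoc]
    rw [e1, Matrix.mul_apply]
    apply Finset.sum_eq_zero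
    intro j _
    by_cases hj : K l k < j
    · rw [(hc' l).2 k j hj, mul_zero]
    · rw [(hc l).2 j a (lt_of_le_of_lt (hJm l (not_lt.mp hj)) ha), zero_mul]

end Horn

end

noncomputable section
namespace Horn
open MvPolynomial

section DD
variable {ι : Type} [Fintype ι] (x v : ι → ℂ)

def DD (P : MvPolynomial ι ℂ) : ℂ := ∑ i, v i * eval x (pderiv i P)

lemma DD_X (i : ι) : DD x v (X i) = v i := by
  classical
  unfold DD
  rw [Finset.sum_eq_single i]
  · simp
  · intro j _ hj; simp [pderiv_X_of_ne hj.symm]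
  · simp

lemma DD_add (P Q : MvPolynomial ι ℂ) : DD x v (P + Q) = DD x v P + DD x v Q := by
  simp [DD, mul_add, Finset.sum_add_distrib]

lemma DD_zero : DD x v 0 = 0 := by simp [DD]

lemma DD_mul (P Q : MvPolynomial ι ℂ) :
    DD x v (P * Q) = DD x v P * eval x Q + eval x P * DD x v Q := by
  simp only [DD, Derivation.leibniz, smul_eq_mul, map_add, map_mul, Finset.sum_mul, Finset.mul_sum,
    ← Finset.sum_add_distrib]
  apply Finset.sum_congr rfl; intro i _; ring

lemma DD_sum {α : Type*} (s : Finset α) (F : α → MvPolynomial ι ℂ) :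
    DD x v (∑ a ∈ s, F a) = ∑ a ∈ s, DD x v (F a) := by
  classical
  induction s using Finset.induction_on with
  | empty => simp [DD_zero]
  | insert a s ha ih => rw [Finset.sum_insert ha, Finset.sum_insert ha, DD_add, ih]
end DD

/-- Variables of the parametrization: `Z`, `c`, `m1`, `m2`. -/
abbrev Vr (s d p : ℕ) : Type :=
  (Fin p × Fin d) ⊕ (Fin s × Fin d × Fin d) ⊕ (Fin s × Fin (d + p) × Fin d) ⊕
    (Fin s × Fin (d + p) × Fin p)

abbrev Kp (s d p : ℕ) : Type := Fin s × Fin (d + p) × (Fin d ⊕ Fin p)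

section param
variable {s d p : ℕ} (K : Fin s → Fin d → Fin (d + p))

def vZ (x : Vr s d p → ℂ) : Matrix (Fin p) (Fin d) ℂ := fun i k => x (.inl (i, k))
def vC (x : Vr s d p → ℂ) (l : Fin s) : Matrix (Fin d) (Fin d) ℂ := fun i k => x (.inr (.inl (l, i, k)))
def vM1 (x : Vr s d p → ℂ) (l : Fin s) : Matrix (Fin (d + p)) (Fin d) ℂ :=
  fun a k => if a ≤ K l k then x (.inr (.inr (.inl (l, a, k)))) else 0
def vM2 (x : Vr s d p → ℂ) (l : Fin s) : Matrix (Fin (d + p)) (Fin p) ℂ :=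
  fun a i => x (.inr (.inr (.inr (l, a, i))))

def mkV (Z : Matrix (Fin p) (Fin d) ℂ) (c : Fin s → Matrix (Fin d) (Fin d) ℂ)
    (m1 : Fin s → Matrix (Fin (d + p)) (Fin d) ℂ) (m2 : Fin s → Matrix (Fin (d + p)) (Fin p) ℂ) :
    Vr s d p → ℂ
  | .inl (i, k) => Z i k
  | .inr (.inl (l, i, k)) => c l i k
  | .inr (.inr (.inl (l, a, k))) => m1 l a k
  | .inr (.inr (.inr (l, a, i))) => m2 l a i

def Phi : Kp s d p → MvPolynomial (Vr s d p) ℂ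
  | (l, a, .inl k) => ∑ j, (if a ≤ K l j then X (.inr (.inr (.inl (l, a, j)))) else 0) *
        X (.inr (.inl (l, j, k))) + ∑ i, X (.inr (.inr (.inr (l, a, i)))) * X (.inl (i, k))
  | (l, a, .inr i) => X (.inr (.inr (.inr (l, a, i))))

lemma vM1_mkV (Z : Matrix (Fin p) (Fin d) ℂ) (c : Fin s → Matrix (Fin d) (Fin d) ℂ)
    (m1 : Fin s → Matrix (Fin (d + p)) (Fin d) ℂ) (m2 : Fin s → Matrix (Fin (d + p)) (Fin p) ℂ)
    (h : ∀ l k a, K l k < a → m1 l a k = 0) : vM1 K (mkV Z c m1 m2) = m1 := by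
  funext l a k
  simp only [vM1, mkV]
  split_ifs with h1
  · rfl
  · exact (h l k a (not_le.mp h1)).symm

lemma vM1_zero (x : Vr s d p → ℂ) (l : Fin s) (k a) (h : K l k < a) : vM1 K x l a k = 0 := by
  simp [vM1, not_le.mpr h]

lemma eval_Phi_inl (x : Vr s d p → ℂ) (l a k) : eval x (Phi K (l, a, .inl k)) =
    (vM1 K x l * vC x l + vM2 x l * vZ x) a k := by
  simp only [Phi, map_add, map_sum, map_mul, eval_X, Matrix.add_apply, Matrix.mul_apply, vM1, vC, vM2, vZ]
  congr 1
  apply Finset.sum_congr rfl; intro j _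
  split_ifs <;> simp

lemma eval_Phi_inr (x : Vr s d p → ℂ) (l a i) : eval x (Phi K (l, a, .inr i)) = vM2 x l a i := by
  simp [Phi, vM2]

lemma Jac_Phi_inl (x v : Vr s d p → ℂ) (l a k) : Jac (Phi K) x v (l, a, .inl k) =
    (vM1 K v l * vC x l + vM1 K x l * vC v l + vM2 v l * vZ x + vM2 x l * vZ v) a k := by
  change DD x v _ = _
  simp only [Phi, DD_add, DD_sum, DD_mul, eval_X, DD_X, Matrix.add_apply, Matrix.mul_apply, vM1, vC, vM2, vZ,
    Finset.sum_add_distrib]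
  rw [← add_assoc]
  congr 2
  congr 1
  all_goals
    apply Finset.sum_congr rfl; intro j _
    split_ifs <;> simp [DD_X, DD_zero]

lemma Jac_Phi_inr (x v : Vr s d p → ℂ) (l a i) : Jac (Phi K) x v (l, a, .inr i) = vM2 v l a i := by
  change DD x v _ = _
  simp [Phi, DD_X, vM2]

/-- Reduced form of surjectivity of the Jacobian. -/
def PSurj (c : Fin s → Matrix (Fin d) (Fin d) ℂ)
    (m1 : Fin s → Matrix (Fin (d + p)) (Fin d) ℂ) (m2 : Fin s → Matrix (Fin (d + p)) (Fin p) ℂ) : Prop :=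
  ∀ Y : Fin s → Matrix (Fin (d + p)) (Fin d) ℂ, ∃ (φ : Matrix (Fin p) (Fin d) ℂ)
    (e : Fin s → Matrix (Fin (d + p)) (Fin d) ℂ) (c' : Fin s → Matrix (Fin d) (Fin d) ℂ),
    (∀ l k a, K l k < a → e l a k = 0) ∧ ∀ l, e l * c l + m1 l * c' l + m2 l * φ = Y l

lemma jac_of_psurj (x : Vr s d p → ℂ) (h : PSurj K (vC x) (vM1 K x) (vM2 x)) :
    ∀ y, ∃ v, Jac (Phi K) x v = y := by
  intro y
  obtain ⟨Y1, hY1⟩ : ∃ Y1 : Fin s → Matrix (Fin (d + p)) (Fin d) ℂ, ∀ l a k, Y1 l a k = y (l, a, .inl k) :=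
    ⟨fun l => Matrix.of fun a k => y (l, a, .inl k), fun _ _ _ => rfl⟩
  obtain ⟨Y2, hY2⟩ : ∃ Y2 : Fin s → Matrix (Fin (d + p)) (Fin p) ℂ, ∀ l a k, Y2 l a k = y (l, a, .inr k) :=
    ⟨fun l => Matrix.of fun a k => y (l, a, .inr k), fun _ _ _ => rfl⟩
  obtain ⟨φ, e, c', he, h2⟩ := h (fun l => Y1 l - Y2 l * vZ x)
  refine ⟨mkV φ c' e Y2, ?_⟩
  funext ⟨l, a, q⟩
  rcases q with k | i
  · rw [Jac_Phi_inl, vM1_mkV K _ _ _ _ he]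
    have h3 := congrFun (congrFun (h2 l) a) k
    have e1 : vC (mkV φ c' e Y2) l = c' l := rfl
    have e2 : vM2 (mkV φ c' e Y2) l = Y2 l := rfl
    have e3 : vZ (mkV φ c' e Y2) = φ := rfl
    rw [e1, e2, e3]
    simp only [Matrix.add_apply, Matrix.sub_apply, hY1] at h3 ⊢
    linear_combination h3
  · rw [Jac_Phi_inr, ← hY2]; rfl

lemma psurj_of_jac (x : Vr s d p → ℂ) (h : ∀ y, ∃ v, Jac (Phi K) x v = y) :
    PSurj K (vC x) (vM1 K x) (vM2 x) := by
  intro Y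
  obtain ⟨v, hv⟩ := h (fun q => match q with
    | (l, a, .inl k) => Y l a k
    | (l, a, .inr i) => 0)
  refine ⟨vZ v, vM1 K v, vC v, vM1_zero K v, fun l => ?_⟩
  have h2 : vM2 v l = 0 := by
    ext a i
    have := congrFun hv (l, a, .inr i)
    rw [Jac_Phi_inr] at this
    exact this
  ext a k
  have := congrFun hv (l, a, .inl k)
  rw [Jac_Phi_inl, h2, Matrix.zero_mul, add_zero] at this
  exact this

end param

/-! ### combinatorics of the complement -/

def bK {s d r : ℕ} (K : Fin s → Fin d → Fin r) : Fin s → Fin d → ℕ := fun l k => (K l k : ℕ) - k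

lemma le_of_strictMono {d r : ℕ} {K : Fin d → Fin r} (hK : StrictMono K) (k : Fin d) : (k : ℕ) ≤ K k := by
  obtain ⟨k, hk⟩ := k
  induction k with
  | zero => simp
  | succ k ih =>
    have h1 := ih (by omega)
    have h2 : K ⟨k, by omega⟩ < K ⟨k+1, hk⟩ := hK (by simp [Fin.lt_def])
    simp only [Fin.lt_def] at h2 h1 ⊢
    omega

lemma sub_mono {d r : ℕ} {K : Fin d → Fin r} (hK : StrictMono K) : Monotone (fun k => (K k : ℕ) - k) := by
  intro j k hjk
  obtain ⟨k, hk⟩ := k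
  obtain ⟨j, hj⟩ := j
  simp only [Fin.mk_le_mk] at hjk
  induction k, hjk using Nat.le_induction with
  | base => exact le_rfl
  | succ k hjk ih =>
    have h1 := ih (by omega)
    have h2 : K ⟨k, by omega⟩ < K ⟨k+1, hk⟩ := hK (by simp [Fin.lt_def])
    have h3 := le_of_strictMono hK ⟨k, by omega⟩
    simp only [Fin.lt_def] at h2 h1 h3 ⊢
    omega

lemma sub_le {d p : ℕ} {K : Fin d → Fin (d + p)} (hK : StrictMono K) (k : Fin d) : (K k : ℕ) - k ≤ p := by
  have hd : 0 < d := k.pos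
  have h1 := sub_mono hK (show k ≤ ⟨d - 1, by omega⟩ by simp [Fin.le_def]; omega)
  have := (K ⟨d-1, by omega⟩).2
  simp only at h1
  omega

lemma exists_compl {d p : ℕ} {K : Fin d → Fin (d + p)} (hK : StrictMono K) :
    ∃ e : Fin d ⊕ Fin p ≃ Fin (d + p), (∀ k, e (.inl k) = K k) ∧
      ∀ k i, K k < e (.inr i) → (K k : ℕ) - k ≤ i := by
  classical
  have hc : (Finset.univ.image K).card = d := by
    rw [Finset.card_image_of_injective _ hK.injective]; simp
  have hc' : (Finset.univ.image K)ᶜ.card = p := by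
    rw [Finset.card_compl, hc]; simp
  refine ⟨finSumEquivOfFinset hc hc', ?_, ?_⟩
  · intro k
    rw [finSumEquivOfFinset_inl]
    have := Finset.orderEmbOfFin_unique hc (f := K) (by simp) hK
    exact (congrFun this k).symm
  · intro k i hki
    rw [finSumEquivOfFinset_inr] at hki
    set O := (Finset.univ.image K)ᶜ.orderEmbOfFin hc' with hO
    -- the set of complement elements below `K k`
    have h1 : (Finset.univ.image K)ᶜ.filter (fun a => a < K k) ⊆ (Finset.Iio i).image O := by
      intro a ha
      simp only [Finset.mem_filter] at ha
      have : a ∈ Set.range O := by rw [hO, Finset.range_orderEmbOfFin]; exact ha.1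
      obtain ⟨j, rfl⟩ := this
      simp only [Finset.mem_image, Finset.mem_Iio]
      exact ⟨j, O.lt_iff_lt.mp (ha.2.trans hki), rfl⟩
    have h2 := Finset.card_le_card h1
    rw [Finset.card_image_of_injective _ O.injective, Fin.card_Iio] at h2
    have h3 : (Finset.univ.image K).filter (fun a => a < K k) = (Finset.Iio k).image K := by
      ext a; simp only [Finset.mem_filter, Finset.mem_image, Finset.mem_univ, true_and, Finset.mem_Iio]
      constructor
      · rintro ⟨⟨j, rfl⟩, h⟩; exact ⟨j, hK.lt_iff_lt.mp h, rfl⟩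
      · rintro ⟨j, h, rfl⟩; exact ⟨⟨j, rfl⟩, hK h⟩
    have h4 : ((Finset.univ.image K).filter (fun a => a < K k)).card = k := by
      rw [h3, Finset.card_image_of_injective _ hK.injective, Fin.card_Iio]
    have h5 : ((Finset.univ.image K).filter (fun a => a < K k)).card +
        ((Finset.univ.image K)ᶜ.filter (fun a => a < K k)).card = K k := by
      rw [← Finset.card_union_of_disjoint, ← Finset.filter_union, Finset.union_compl]
      · rw [← Fin.card_Iio]; congr 1; ext a; simp
      · exact Finset.disjoint_filter_filter disjoint_compl_right
    omega

end Horn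

end

noncomputable section
namespace Horn
open MvPolynomial

section
variable {s d p : ℕ}

def toY (u : Fin s → Matrix (Fin (d + p)) (Fin (d + p)) ℂ) : Kp s d p → ℂ :=
  fun q => u q.1 q.2.1 (finSumFinEquiv q.2.2)

def fromY (y : Kp s d p → ℂ) : Fin s → Matrix (Fin (d + p)) (Fin (d + p)) ℂ :=
  fun l => Matrix.of fun a j => y (l, a, finSumFinEquiv.symm j)

lemma toY_fromY (y : Kp s d p → ℂ) : toY (fromY y) = y := by
  funext ⟨l, a, q⟩; simp [toY, fromY]

lemma ent_toY (P : MvPolynomial (Kp s d p) ℂ) :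
    Ent (fun u : Fin s → Matrix (Fin (d + p)) (Fin (d + p)) ℂ => eval (toY u) P) := by
  induction P using MvPolynomial.induction_on with
  | C a => simpa using Ent.const a
  | add P Q h1 h2 => simpa using h1.add h2
  | mul_X P i h => simpa [toY] using h.mul (ent_coord i.1 i.2.1 (finSumFinEquiv i.2.2))

lemma ent_toY' {E : Type*} [AddCommGroup E] [Module ℂ E] [TopologicalSpace E]
    (P : MvPolynomial (Kp s d p) ℂ) (F : E → Fin s → Matrix (Fin (d + p)) (Fin (d + p)) ℂ)
    (hF : ∀ l i j, Ent (fun x => F x l i j)) : Ent (fun x => eval (toY (F x)) P) := by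
  induction P using MvPolynomial.induction_on with
  | C a => simpa using Ent.const a
  | add P Q h1 h2 => simpa using h1.add h2
  | mul_X P i h => simpa [toY] using h.mul (hF i.1 i.2.1 (finSumFinEquiv i.2.2))

lemma gen_toY (P : MvPolynomial (Kp s d p) ℂ) (hP : P ≠ 0) :
    Gen {u : Fin s → Matrix (Fin (d + p)) (Fin (d + p)) ℂ | eval (toY u) P ≠ 0} := by
  obtain ⟨y, hy⟩ := exists_eval_ne_zero P hP
  exact (ent_toY P).gen (fromY y) (by rw [toY_fromY]; exact hy)

/-- the chart -/
def iZ (Z : Matrix (Fin p) (Fin d) ℂ) : Matrix (Fin (d + p)) (Fin d) ℂ :=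
  Matrix.of fun a k => Fin.addCases (fun j => if j = k then 1 else 0) (fun i => - Z i k) a

def iL : Matrix (Fin d) (Fin (d + p)) ℂ := Matrix.of fun k a => if a = Fin.castAdd p k then 1 else 0

lemma iL_iZ (Z : Matrix (Fin p) (Fin d) ℂ) : (iL : Matrix (Fin d) (Fin (d + p)) ℂ) * iZ Z = 1 := by
  ext j k
  simp [Matrix.mul_apply, iL, iZ, Matrix.one_apply]

def bot (Z : Matrix (Fin (d + p)) (Fin d) ℂ) : Matrix (Fin p) (Fin d) ℂ := Matrix.of fun i k => Z (Fin.natAdd d i) k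

def u1 (u : Matrix (Fin (d + p)) (Fin (d + p)) ℂ) : Matrix (Fin (d + p)) (Fin d) ℂ :=
  Matrix.of fun a k => u a (Fin.castAdd p k)
def u2 (u : Matrix (Fin (d + p)) (Fin (d + p)) ℂ) : Matrix (Fin (d + p)) (Fin p) ℂ :=
  Matrix.of fun a k => u a (Fin.natAdd d k)

lemma mul_iZ (u : Matrix (Fin (d + p)) (Fin (d + p)) ℂ) (Z : Matrix (Fin p) (Fin d) ℂ) :
    u * iZ Z = u1 u - u2 u * Z := by
  ext a k
  simp [Matrix.mul_apply, iZ, Fin.sum_univ_add, u1, u2, Matrix.sub_apply, sub_eq_add_neg]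

variable (K : Fin s → Fin d → Fin (d + p))

lemma phi_eq_iff (x : Vr s d p → ℂ) (u : Fin s → Matrix (Fin (d + p)) (Fin (d + p)) ℂ) :
    (∀ k, eval x (Phi K k) = toY u k) ↔ ∀ l, vM1 K x l * vC x l + vM2 x l * vZ x = u1 (u l) ∧
      vM2 x l = u2 (u l) := by
  constructor
  · intro h l
    constructor
    · ext a k
      have := h (l, a, .inl k)
      rw [eval_Phi_inl] at this
      exact this
    · ext a k
      have := h (l, a, .inr k)
      rw [eval_Phi_inr] at this
      exact this
  · rintro h ⟨l, a, k | i⟩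
    · rw [eval_Phi_inl, (h l).1]; rfl
    · rw [eval_Phi_inr, (h l).2]; rfl

lemma phi_to_om (x : Vr s d p → ℂ) (u : Fin s → Matrix (Fin (d + p)) (Fin (d + p)) ℂ)
    (hc : ∀ l, IsUnit (vC x l).det) (h : ∀ k, eval x (Phi K k) = toY u k) :
    OmM K u (iZ (vZ x)) (fun l => (vC x l)⁻¹) := by
  rw [phi_eq_iff] at h
  intro l
  refine ⟨by rw [Matrix.isUnit_nonsing_inv_det_iff]; exact hc l, fun k a ha => ?_⟩
  rw [mul_iZ, ← (h l).1, ← (h l).2, add_sub_cancel_right, Matrix.mul_assoc,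
    Matrix.mul_nonsing_inv _ (hc l), Matrix.mul_one]
  exact vM1_zero K x l k a ha

lemma om_to_phi (u : Fin s → Matrix (Fin (d + p)) (Fin (d + p)) ℂ) (Z : Matrix (Fin p) (Fin d) ℂ)
    (c : Fin s → Matrix (Fin d) (Fin d) ℂ) (h : OmM K u (iZ Z) c) :
    ∃ x, ∀ k, eval x (Phi K k) = toY u k := by
  refine ⟨mkV Z (fun l => (c l)⁻¹) (fun l => u l * iZ Z * c l) (fun l => u2 (u l)), ?_⟩
  rw [phi_eq_iff]
  intro l
  rw [vM1_mkV]
  swap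
  · intro l k a ha; exact (h l).2 k a ha
  refine ⟨?_, rfl⟩
  change u l * iZ Z * c l * (c l)⁻¹ + u2 (u l) * Z = _
  rw [Matrix.mul_assoc, Matrix.mul_nonsing_inv _ (h l).1, Matrix.mul_one, mul_iZ, sub_add_cancel]

/-- base point -/
lemma base_point (hK : ∀ l, StrictMono (K l)) (f : Fin s → Matrix (Fin d) (Fin d) ℂ)
    (g : Fin s → Matrix (Fin p) (Fin p) ℂ) (hf : ∀ l, IsUnit (f l).det) :
    ∃ x : Vr s d p → ℂ, (∀ l, IsUnit (vC x l).det) ∧ 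
    ∃ R : Fin s → Matrix (Fin (d + p)) (Fin d) ℂ → Matrix (Fin p) (Fin d) ℂ,
      (∀ l, R l 0 = 0) ∧
      ∀ (Y : Fin s → Matrix (Fin (d + p)) (Fin d) ℂ) (φ : Matrix (Fin p) (Fin d) ℂ),
      (∀ l (i : Fin p) k, bK K l k ≤ (i : ℕ) → (g l * φ * f l) i k = R l (Y l) i k) →
      ∃ (e : Fin s → Matrix (Fin (d + p)) (Fin d) ℂ) (c' : Fin s → Matrix (Fin d) (Fin d) ℂ),
       (∀ l k a, K l k < a → e l a k = 0) ∧ ∀ l, e l * vC x l + vM1 K x l * c' l + vM2 x l * φ = Y l := by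
  choose q hq1 hq2 using fun l => exists_compl (hK l)
  let m1 : Fin s → Matrix (Fin (d + p)) (Fin d) ℂ := fun l => Matrix.of fun a j => if a = K l j then 1 else 0
  let m2 : Fin s → Matrix (Fin (d + p)) (Fin p) ℂ := fun l => Matrix.of fun a i => 
    Sum.elim (fun _ => 0) (fun i' => g l i' i) ((q l).symm a)
  have hm1 : ∀ l k a, K l k < a → m1 l a k = 0 := by
    intro l k a h
    simp [m1, h.ne']
  refine ⟨mkV 0 (fun l => (f l)⁻¹) m1 m2, ?_, 
    fun l Y => Matrix.of fun i k => (Y * f l) (q l (.inr i)) k, ?_, ?_⟩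
  · intro l
    change IsUnit ((f l)⁻¹).det
    rw [Matrix.isUnit_nonsing_inv_det_iff]; exact hf l
  · intro l; ext; simp
  · intro Y φ h
    rw [vM1_mkV K _ _ _ _ hm1]
    let c' : Fin s → Matrix (Fin d) (Fin d) ℂ := fun l => Matrix.of fun k' k => Y l (K l k') k
    refine ⟨fun l => (Y l - m1 l * c' l - m2 l * φ) * f l, c', ?_, ?_⟩
    · intro l k a ha
      obtain ⟨b, rfl⟩ := (q l).surjective a
      change ((Y l - m1 l * c' l - m2 l * φ) * f l) _ k = 0
      rcases b with k' | i'
      · rw [Matrix.mul_apply]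
        apply Finset.sum_eq_zero
        intro j _
        have : (Y l - m1 l * c' l - m2 l * φ) (q l (Sum.inl k')) j = 0 := by
          rw [Matrix.sub_apply, Matrix.sub_apply, Matrix.mul_apply, Matrix.mul_apply, hq1]
          rw [Finset.sum_eq_single k']
          · have : (q l).symm (K l k') = .inl k' := by rw [← hq1, Equiv.symm_apply_apply]
            simp [m1, m2, c', this]
          · intro b _ hb
            simp [m1, c', (hK l).injective.eq_iff, hb.symm]
          · simp
        rw [this, zero_mul]
      · have h2 : (g l * φ * f l) i' k = (Y l * f l) (q l (.inr i')) k := h l i' k (hq2 l k i' ha)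
        have h3 : ∀ j, (Y l - m1 l * c' l - m2 l * φ) (q l (Sum.inr i')) j = 
            Y l (q l (Sum.inr i')) j - (g l * φ) i' j := by
          intro j
          rw [Matrix.sub_apply, Matrix.sub_apply, Matrix.mul_apply, Matrix.mul_apply, Matrix.mul_apply]
          rw [Finset.sum_eq_zero]
          · simp [m2]
          · intro b _
            simp [m1, ← hq1]
        rw [Matrix.mul_apply]
        simp only [h3, sub_mul, Finset.sum_sub_distrib]
        rw [← Matrix.mul_apply, ← Matrix.mul_apply, h2]
        simp
    · intro l
      change (Y l - m1 l * c' l - m2 l * φ) * f l * (f l)⁻¹ + m1 l * c' l + m2 l * φ = _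
      rw [Matrix.mul_assoc, Matrix.mul_nonsing_inv _ (hf l), Matrix.mul_one]
      abel

lemma Surj.psurj (hK : ∀ l, StrictMono (K l)) (f : Fin s → Matrix (Fin d) (Fin d) ℂ)
    (g : Fin s → Matrix (Fin p) (Fin p) ℂ) (hf : ∀ l, IsUnit (f l).det)
    (h : Surj (bK K) f g) : ∃ x : Vr s d p → ℂ, (∀ l, IsUnit (vC x l).det) ∧
     (∀ y, ∃ v, Jac (Phi K) x v = y) ∧
     ∀ φ : Matrix (Fin p) (Fin d) ℂ, (∀ l (i : Fin p) k, bK K l k ≤ (i : ℕ) → (g l * φ * f l) i k = 0) →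
       ∃ v, Jac (Phi K) x v = 0 ∧ vZ v = φ := by
  obtain ⟨x, hx, R, hR, hY⟩ := base_point K hK f g hf
  refine ⟨x, hx, ?_, ?_⟩
  · apply jac_of_psurj
    intro Y
    obtain ⟨φ, hφ⟩ := h (fun l => R l (Y l))
    obtain ⟨e, c', h1, h2⟩ := hY Y φ hφ
    exact ⟨φ, e, c', h1, h2⟩
  · intro φ hφ
    obtain ⟨e, c', h1, h2⟩ := hY 0 φ (by intro l i k hi; rw [hφ l i k hi]; simp [hR])
    refine ⟨mkV φ c' e 0, ?_, rfl⟩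
    funext ⟨l, a, q⟩
    rcases q with k | i
    · rw [Jac_Phi_inl, vM1_mkV K _ _ _ _ h1]
      have h3 := congrFun (congrFun (h2 l) a) k
      have e1 : vC (mkV φ c' e 0) l = c' l := rfl
      have e2 : vM2 (mkV φ c' e 0) l = 0 := rfl
      have e3 : vZ (mkV φ c' e 0) = φ := rfl
      rw [e1, e2, e3, Matrix.zero_mul, add_zero]
      exact h3
    · rw [Jac_Phi_inr]; rfl

def dC (s d p : ℕ) : MvPolynomial (Vr s d p) ℂ :=
  ∏ l : Fin s, (Matrix.of fun i k : Fin d => (X (.inr (.inl (l, i, k))) : MvPolynomial (Vr s d p) ℂ)).det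

lemma eval_dC (x : Vr s d p → ℂ) : eval x (dC s d p) = ∏ l, (vC x l).det := by
  simp only [dC, map_prod]
  apply Finset.prod_congr rfl
  intro l _
  rw [RingHom.map_det]
  congr 1
  ext i k
  simp [vC]

lemma dC_ne : dC s d p ≠ 0 := by
  intro h
  have := eval_dC (mkV (s := s) (d := d) (p := p) 0 (fun _ => 1) 0 0)
  rw [h] at this
  have e : ∀ l, vC (mkV (s := s) (d := d) (p := p) 0 (fun _ => 1) 0 0) l = 1 := fun _ => rfl
  simp [e] at this

lemma dC_unit (x : Vr s d p → ℂ) (h : eval x (dC s d p) ≠ 0) (l : Fin s) : IsUnit (vC x l).det := by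
  rw [eval_dC, Finset.prod_ne_zero_iff] at h
  exact isUnit_iff_ne_zero.mpr (h l (Finset.mem_univ _))

lemma Good.gen_om (hK : ∀ l, StrictMono (K l)) (h : Good p (bK K)) :
    Gen {u | ∃ V, Om K u V} := by
  obtain ⟨f, g, h, hf, hg⟩ := h.inv
  obtain ⟨x, hx1, hx2, -⟩ := h.psurj K hK f g hf
  obtain ⟨P, hP, hP2⟩ := dominant_image (Phi K) (algIndep_of_jac (Phi K) x hx2) (dC s d p) dC_ne
  refine (gen_toY P hP).mono (fun u hu => ?_)
  obtain ⟨x, hx, hx'⟩ := hP2 (toY u) hu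
  exact ⟨_, (phi_to_om K x u (dC_unit x hx) hx').toOm (fun l => (hK l).monotone) (iL_iZ _)⟩

end
end Horn

end

noncomputable section
namespace Horn
open MvPolynomial

lemma isOpen_rank {m n : Type*} [Fintype m] [Fintype n] (N : ℕ) :
    IsOpen {M : Matrix m n ℂ | N ≤ M.rank} := by
  classical
  rw [isOpen_iff_mem_nhds]
  intro M0 hM0
  obtain ⟨π, ι, h⟩ := exists_rank_factor M0
  have hc : Continuous (fun M : Matrix m n ℂ => (π * M * ι).det) := by fun_prop
  have ho : IsOpen {M : Matrix m n ℂ | (π * M * ι).det ≠ 0} := isOpen_ne.preimage hc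
  filter_upwards [ho.mem_nhds (show (π * M0 * ι).det ≠ 0 by rw [h]; simp)] with M hM
  have h1 : (π * M * ι).rank = M0.rank := by
    rw [Matrix.rank_of_isUnit _ ((Matrix.isUnit_iff_isUnit_det _).mpr (isUnit_iff_ne_zero.mpr hM))]
    simp
  have h2 : M0.rank ≤ M.rank := by
    rw [← h1]
    exact (Matrix.rank_mul_le_left _ _).trans (Matrix.rank_mul_le_right _ _)
  exact le_trans hM0 h2

lemma om_range_iff {s d r : ℕ} (K : Fin s → Fin d → Fin r) (u : Fin s → Matrix (Fin r) (Fin r) ℂ)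
    (A : Matrix (Fin r) (Fin d) ℂ) (hA : A.conjTranspose * A = 1) :
    Om K u (LinearMap.range A.mulVecLin) ↔ ∀ l k, 
      ((u l * A).submatrix (Subtype.val : {a // K l k < a} → Fin r) id).rank + ((k : ℕ) + 1) ≤ d := by
  have hinj : Function.Injective A.mulVecLin := by
    intro x y hxy
    have := congrArg (A.conjTranspose.mulVec) hxy
    simpa [Matrix.mulVec_mulVec, hA] using this
  have h1 : finrank ℂ (LinearMap.range A.mulVecLin) = d := by
    rw [LinearMap.finrank_range_of_inj hinj]; simp
  have h2 : ∀ l k, finrank ℂ ↥(LinearMap.range A.mulVecLin ⊓ fl (u l) (Set.Iic (K l k))) + 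
      ((u l * A).submatrix (Subtype.val : {a // K l k < a} → Fin r) id).rank = d := by
    intro l k
    set N := ((u l * A).submatrix (Subtype.val : {a // K l k < a} → Fin r) id) with hN
    have h3 : LinearMap.range A.mulVecLin ⊓ fl (u l) (Set.Iic (K l k)) = 
        (LinearMap.ker N.mulVecLin).map A.mulVecLin := by
      ext v
      simp only [Submodule.mem_inf, LinearMap.mem_range, Submodule.mem_map, LinearMap.mem_ker]
      constructor
      · rintro ⟨⟨y, rfl⟩, h⟩
        refine ⟨y, ?_, rfl⟩
        ext a
        have := h a.1 (by simpa using a.2)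
        rw [Matrix.mulVecLin_apply, Matrix.mulVec_mulVec] at this
        exact this
      · rintro ⟨y, hy, rfl⟩
        refine ⟨⟨y, rfl⟩, fun a ha => ?_⟩
        have := congrFun hy ⟨a, by simpa using ha⟩
        rw [Matrix.mulVecLin_apply, Matrix.mulVec_mulVec]
        exact this
    rw [h3, LinearEquiv.finrank_eq (Submodule.equivMapOfInjective A.mulVecLin hinj (LinearMap.ker N.mulVecLin)).symm]
    have := LinearMap.finrank_range_add_finrank_ker N.mulVecLin
    rw [Matrix.rank]
    simp at this
    omega
  constructor
  · rintro ⟨-, h⟩ l k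
    have := h2 l k; have := h l k; omega
  · intro h
    refine ⟨h1, fun l k => ?_⟩
    have := h2 l k; have := h l k; omega

lemma exists_isometry {d r : ℕ} {V : Submodule ℂ (Fin r → ℂ)} (h : finrank ℂ V = d) :
    ∃ A : Matrix (Fin r) (Fin d) ℂ, A.conjTranspose * A = 1 ∧ LinearMap.range A.mulVecLin = V := by
  let e := (WithLp.linearEquiv 2 ℂ (Fin r → ℂ))
  let V' : Submodule ℂ (EuclideanSpace ℂ (Fin r)) := V.comap e.toLinearMap
  have hV' : finrank ℂ V' = d := by
    rw [← h]
    have h1 : V'.map e.toLinearMap = V := Submodule.map_comap_eq_of_surjective e.surjective V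
    exact (e.finrank_map_eq V').symm.trans (by rw [h1])
  let b := (stdOrthonormalBasis ℂ V').reindex (finCongr hV')
  let A : Matrix (Fin r) (Fin d) ℂ := Matrix.of fun i k => (b k : EuclideanSpace ℂ (Fin r)) i
  have hA : A.conjTranspose * A = 1 := by
    ext j k
    have := (orthonormal_iff_ite.mp b.orthonormal) j k
    rw [Matrix.one_apply, ← this, Submodule.coe_inner, EuclideanSpace.inner_eq_star_dotProduct]
    simp [Matrix.mul_apply, A, dotProduct, mul_comm]
  refine ⟨A, hA, ?_⟩
  apply Submodule.eq_of_le_of_finrank_eq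
  · rintro _ ⟨y, rfl⟩
    have : A.mulVecLin y = ∑ k, y k • e (b k : EuclideanSpace ℂ (Fin r)) := by
      ext i; simp [Matrix.mulVec, dotProduct, A, e, mul_comm]
    rw [this]
    exact Submodule.sum_mem _ fun k _ => V.smul_mem _ (b k).2
  · rw [h, LinearMap.finrank_range_of_inj]
    · simp
    · intro x y hxy
      have := congrArg (A.conjTranspose.mulVec) hxy
      simpa [Matrix.mulVec_mulVec, hA] using this

lemma compact_iso (d r : ℕ) : IsCompact {A : Matrix (Fin r) (Fin d) ℂ | A.conjTranspose * A = 1} := by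
  have h1 : IsCompact (Set.pi Set.univ fun _ : Fin r => Set.pi Set.univ fun _ : Fin d => Metric.closedBall (0 : ℂ) 1) :=
    isCompact_univ_pi fun _ => isCompact_univ_pi fun _ => isCompact_closedBall _ _
  apply IsCompact.of_isClosed_subset h1
  · apply isClosed_eq
    · fun_prop
    · fun_prop
  · intro A hA i _ k _
    have := congrFun (congrFun hA k) k
    simp only [Matrix.mul_apply, Matrix.conjTranspose_apply, Matrix.one_apply_eq] at this
    have h2 : (∑ j, ‖A j k‖ ^ 2 : ℝ) = 1 := by
      have h3 : ((∑ j, ‖A j k‖ ^ 2 : ℝ) : ℂ) = 1 := by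
        rw [← this]; push_cast
        apply Finset.sum_congr rfl; intro j _
        rw [← Complex.conj_mul']; rfl
      exact_mod_cast h3
    have h3 : ‖A i k‖ ^ 2 ≤ 1 := by
      rw [← h2]
      exact Finset.single_le_sum (f := fun j => ‖A j k‖ ^ 2) (fun _ _ => by positivity) (Finset.mem_univ i)
    rw [mem_closedBall_zero_iff]
    nlinarith [norm_nonneg (A i k)]

lemma closed_om {s d r : ℕ} (K : Fin s → Fin d → Fin r) :
    IsClosed {u : Fin s → Matrix (Fin r) (Fin r) ℂ | ∃ V, Om K u V} := by
  let C := {A : Matrix (Fin r) (Fin d) ℂ // A.conjTranspose * A = 1}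
  haveI : CompactSpace C := isCompact_iff_compactSpace.mp (compact_iso d r)
  have h1 : {u : Fin s → Matrix (Fin r) (Fin r) ℂ | ∃ V, Om K u V} = Prod.fst ''
      {x : (Fin s → Matrix (Fin r) (Fin r) ℂ) × C | ∀ l k, 
      ((x.1 l * x.2.1).submatrix (Subtype.val : {a // K l k < a} → Fin r) id).rank + ((k : ℕ) + 1) ≤ d} := by
    ext u
    constructor
    · rintro ⟨V, hV⟩
      obtain ⟨A, hA, rfl⟩ := exists_isometry hV.1
      exact ⟨(u, ⟨A, hA⟩), (om_range_iff K u A hA).mp hV, rfl⟩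
    · rintro ⟨⟨u, A⟩, h, rfl⟩
      exact ⟨_, (om_range_iff K u A.1 A.2).mpr h⟩
  rw [h1]
  apply isClosedMap_fst_of_compactSpace
  have : {x : (Fin s → Matrix (Fin r) (Fin r) ℂ) × C | ∀ l k, 
      ((x.1 l * x.2.1).submatrix (Subtype.val : {a // K l k < a} → Fin r) id).rank + ((k : ℕ) + 1) ≤ d} = 
      ⋂ l, ⋂ k, ((fun x : (Fin s → Matrix (Fin r) (Fin r) ℂ) × C => 
        ((x.1 l * x.2.1).submatrix (Subtype.val : {a // K l k < a} → Fin r) id)) ⁻¹' 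
         {M | d - (k : ℕ) ≤ M.rank})ᶜ := by
    ext x
    simp only [Set.mem_setOf_eq, Set.mem_iInter, Set.mem_compl_iff, Set.mem_preimage, not_le]
    refine forall_congr' fun l => forall_congr' fun k => ?_
    have := k.2
    omega
  rw [this]
  refine isClosed_iInter fun l => isClosed_iInter fun k => ?_
  rw [isClosed_compl_iff]
  apply IsOpen.preimage
  · apply Continuous.matrix_submatrix
    apply Continuous.matrix_mul
    · exact (continuous_apply l).comp continuous_fst
    · exact continuous_subtype_val.comp continuous_snd
  · exact isOpen_rank _

lemma Good.om {s d p : ℕ} {K : Fin s → Fin d → Fin (d + p)} (hK : ∀ l, StrictMono (K l)) (h : Good p (bK K))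
    (u : Fin s → Matrix (Fin (d + p)) (Fin (d + p)) ℂ) : ∃ V, Om K u V := by
  have h1 := (h.gen_om K hK).dense
  have h2 := (closed_om K).closure_eq
  rw [h1.closure_eq] at h2
  have : u ∈ (Set.univ : Set (Fin s → Matrix (Fin (d + p)) (Fin (d + p)) ℂ)) := Set.mem_univ u
  rw [h2] at this
  exact this

end Horn

end

noncomputable section
namespace Horn
open MvPolynomial

lemma flag_ext {d p : ℕ} (W : Fin d → Submodule ℂ (Fin p → ℂ)) (b : Fin d → ℕ) (hW : Monotone W)
    (hb : ∀ k, finrank ℂ (W k) ≤ b k) : ∃ g : Matrix (Fin p) (Fin p) ℂ, IsUnit g.det ∧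
      ∀ k, ∀ w ∈ W k, ∀ i : Fin p, b k ≤ i → g.mulVec w i = 0 := by
  classical
  let Y : Fin p → Submodule ℂ (Fin p → ℂ) := fun i => ⨆ k : {k : Fin d // b k ≤ i}, W k.1
  have hY : ∀ i, finrank ℂ (Y i) ≤ i := by
    intro i
    by_cases h : ∃ k : Fin d, b k ≤ i
    · obtain ⟨k0, hk0, hmax⟩ := (Finset.univ.filter (fun k : Fin d => b k ≤ i)).exists_max_image id
        (by obtain ⟨k, hk⟩ := h; exact ⟨k, by simp [hk]⟩)
      have h1 : Y i ≤ W k0 := iSup_le fun k => hW (hmax k.1 (by simp [k.2]))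
      have h2 := Submodule.finrank_mono h1
      have h3 := hb k0
      simp at hk0
      omega
    · haveI : IsEmpty {k : Fin d // b k ≤ i} := ⟨fun k => h ⟨k.1, k.2⟩⟩
      have : Y i = ⊥ := iSup_of_empty _
      rw [this]; simp
  obtain ⟨v, hv, hv2⟩ := adapted p (fun i => (Y i.rev).dualAnnihilator) (by
    intro i
    have h1 := Subspace.finrank_add_finrank_dualAnnihilator_eq (Y i.rev)
    have h2 := hY i.rev
    rw [Fin.val_rev] at h2
    simp only [finrank_fintype_fun_eq_card, Fintype.card_fin] at h1
    omega)
  let g : Matrix (Fin p) (Fin p) ℂ := Matrix.of fun i j => v i.rev (Pi.single j 1)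
  have hg : ∀ w i, g.mulVec w i = v i.rev w := by
    intro w i
    conv_rhs => rw [pi_eq_sum_univ' w, map_sum]
    simp only [Matrix.mulVec, dotProduct, g, Matrix.of_apply]
    apply Finset.sum_congr rfl; intro j _
    rw [map_smul, smul_eq_mul, mul_comm]
  refine ⟨g, ?_, ?_⟩
  · rw [← Matrix.isUnit_iff_isUnit_det, ← Matrix.linearIndependent_rows_iff_isUnit]
    have h1 : LinearIndependent ℂ (fun i : Fin p => v i.rev) := hv.comp _ Fin.rev_injective
    rw [Fintype.linearIndependent_iff] at h1 ⊢
    intro c hc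
    apply h1 c
    refine LinearMap.pi_ext' fun j => LinearMap.ext_ring ?_
    have := congrFun hc j
    simpa [g, Matrix.row] using this
  · intro k w hw i hi
    rw [hg]
    have := hv2 i.rev
    rw [Submodule.mem_dualAnnihilator, Fin.rev_rev] at this
    exact this w (Submodule.mem_iSup_of_mem (p := fun k : {k : Fin d // b k ≤ i} => W k.1) ⟨k, hi⟩ hw)

section
variable {s d p : ℕ} (K : Fin s → Fin d → Fin (d + p))

def Qm (Z : Matrix (Fin p) (Fin d) ℂ) : Matrix (Fin p) (Fin (d + p)) ℂ :=
  Matrix.of fun i a => Fin.addCases (fun k => Z i k) (fun i' => if i = i' then 1 else 0) a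

lemma Qm_iZ (Z : Matrix (Fin p) (Fin d) ℂ) : Qm Z * iZ Z = 0 := by
  ext i k
  simp [Matrix.mul_apply, Qm, iZ, Fin.sum_univ_add]

def J2 (d p : ℕ) : Matrix (Fin (d + p)) (Fin p) ℂ := Matrix.of fun a i => if a = Fin.natAdd d i then 1 else 0

lemma Qm_u2 (Z : Matrix (Fin p) (Fin d) ℂ) : Qm Z * J2 d p = 1 := by
  ext i k
  simp [Matrix.mul_apply, Qm, J2, Matrix.one_apply]

lemma u2_eq (u : Matrix (Fin (d + p)) (Fin (d + p)) ℂ) : u2 u = u * J2 d p := by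
  ext i k
  simp [Matrix.mul_apply, u2, J2]

lemma finrank_W (K : Fin d → Fin (d + p)) (hK : StrictMono K) (π : Matrix (Fin p) (Fin (d + p)) ℂ) 
    (m1 : Matrix (Fin (d + p)) (Fin d) ℂ) (q : Matrix (Fin d) (Fin (d + p)) ℂ) (hq : q * m1 = 1)
    (hπ : π * m1 = 0) (hm : ∀ k a, K k < a → m1 a k = 0) (k : Fin d) :
    finrank ℂ ((fl 1 (Set.Iic (K k))).map π.mulVecLin) ≤ (K k : ℕ) - k := by
  set E := fl (1 : Matrix (Fin (d + p)) (Fin (d + p)) ℂ) (Set.Iic (K k)) with hE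
  have h1 : finrank ℂ E = K k + 1 := finrank_fl 1 (by simp) (K k)
  have h2 := LinearMap.finrank_range_add_finrank_ker (π.mulVecLin.domRestrict E)
  rw [LinearMap.range_domRestrict, h1] at h2
  have hinj : Function.Injective m1.mulVecLin := by
    intro x y hxy
    have := congrArg q.mulVec hxy
    simpa [Matrix.mulVec_mulVec, hq] using this
  have h3 : finrank ℂ ((fl (1 : Matrix (Fin d) (Fin d) ℂ) (Set.Iic k)).map m1.mulVecLin) = k + 1 := by
    rw [LinearEquiv.finrank_eq (Submodule.equivMapOfInjective m1.mulVecLin hinj _).symm]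
    exact finrank_fl 1 (by simp) k
  have h4 : (fl (1 : Matrix (Fin d) (Fin d) ℂ) (Set.Iic k)).map m1.mulVecLin ≤ 
      (LinearMap.ker (π.mulVecLin.domRestrict E)).map E.subtype := by
    rintro _ ⟨y, hy, rfl⟩
    have hy' : ∀ j, k < j → y j = 0 := by
      intro j hj
      have := hy j (by simpa using hj)
      simpa using this
    have hmE : m1.mulVecLin y ∈ E := by
      intro a ha
      simp only [Set.mem_Iic, not_le] at ha
      rw [Matrix.one_mulVec, Matrix.mulVecLin_apply, Matrix.mulVec, dotProduct]
      apply Finset.sum_eq_zero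
      intro j _
      by_cases hj : k < j
      · rw [hy' j hj, mul_zero]
      · rw [hm j a (lt_of_le_of_lt (hK.monotone (not_lt.mp hj)) ha), zero_mul]
    refine ⟨⟨_, hmE⟩, ?_, rfl⟩
    simp [Matrix.mulVec_mulVec, hπ]
  have h5 := Submodule.finrank_mono h4
  rw [h3, LinearEquiv.finrank_eq (Submodule.equivMapOfInjective E.subtype Subtype.val_injective _).symm] at h5
  have := le_of_strictMono hK k
  omega

lemma good_of_psurj (hK : ∀ l, StrictMono (K l)) (x : Vr s d p → ℂ) 
    (u : Fin s → Matrix (Fin (d + p)) (Fin (d + p)) ℂ) (hu : ∀ l, IsUnit (u l).det)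
    (hc : ∀ l, IsUnit (vC x l).det) (hx : ∀ k, eval x (Phi K k) = toY u k)
    (h : PSurj K (vC x) (vM1 K x) (vM2 x)) : Good p (bK K) := by
  rw [phi_eq_iff] at hx
  have hm1c : ∀ l, vM1 K x l * vC x l = u l * iZ (vZ x) := fun l => by
    rw [mul_iZ, ← (hx l).1, ← (hx l).2, add_sub_cancel_right]
  have hm1 : ∀ l, vM1 K x l = u l * iZ (vZ x) * (vC x l)⁻¹ := fun l => by
    rw [← hm1c, Matrix.mul_assoc, Matrix.mul_nonsing_inv _ (hc l), Matrix.mul_one]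
  have hm2 : ∀ l, vM2 x l = u l * J2 d p := fun l => by rw [(hx l).2, u2_eq]
  let π : Fin s → Matrix (Fin p) (Fin (d + p)) ℂ := fun l => Qm (vZ x) * (u l)⁻¹
  have hπu : ∀ l, π l * u l = Qm (vZ x) := fun l => by
    simp only [π]; rw [Matrix.mul_assoc, Matrix.nonsing_inv_mul _ (hu l), Matrix.mul_one]
  have hπ1 : ∀ l, π l * vM1 K x l = 0 := fun l => by
    rw [hm1, ← Matrix.mul_assoc, ← Matrix.mul_assoc, hπu, Qm_iZ, Matrix.zero_mul]
  have hπ2 : ∀ l, π l * vM2 x l = 1 := fun l => by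
    rw [hm2, ← Matrix.mul_assoc, hπu, Qm_u2]
  have hleft : ∀ l, (vC x l * (iL : Matrix (Fin d) (Fin (d + p)) ℂ) * (u l)⁻¹) * vM1 K x l = 1 := fun l => by
    rw [hm1]
    calc vC x l * (iL : Matrix (Fin d) (Fin (d + p)) ℂ) * (u l)⁻¹ * (u l * iZ (vZ x) * (vC x l)⁻¹) 
        = vC x l * ((iL : Matrix (Fin d) (Fin (d + p)) ℂ) * ((u l)⁻¹ * u l) * iZ (vZ x)) * (vC x l)⁻¹ := by simp only [Matrix.mul_assoc]
      _ = 1 := by rw [Matrix.nonsing_inv_mul _ (hu l), Matrix.mul_one, iL_iZ, Matrix.mul_one,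
                    Matrix.mul_nonsing_inv _ (hc l)]
  choose g hg hgW using fun l => flag_ext 
    (fun k => (fl 1 (Set.Iic (K l k))).map (π l).mulVecLin) (bK K l)
    (fun j k hjk => Submodule.map_mono (fl_mono _ (Set.Iic_subset_Iic.mpr ((hK l).monotone hjk))))
    (finrank_W (K l) (hK l) (π l) (vM1 K x l) _ (hleft l) (hπ1 l) (vM1_zero K x l))
  refine ⟨fun l => (vC x l)⁻¹, g, fun τ => ?_⟩
  obtain ⟨φ, e, c', he, hY⟩ := h (fun l => vM2 x l * ((g l)⁻¹ * τ l * vC x l))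
  refine ⟨φ, fun l i k hik => ?_⟩
  have h1 : π l * e l + φ * (vC x l)⁻¹ = (g l)⁻¹ * τ l := by
    have h2 := congrArg (fun M => π l * M * (vC x l)⁻¹) (hY l)
    simp only [Matrix.mul_add, Matrix.add_mul] at h2
    rw [← Matrix.mul_assoc (π l) (vM1 K x l), hπ1, ← Matrix.mul_assoc (π l) (vM2 x l), hπ2,
      ← Matrix.mul_assoc (π l) (vM2 x l), hπ2] at h2
    simp only [Matrix.mul_assoc, Matrix.zero_mul, Matrix.one_mul, Matrix.mul_nonsing_inv _ (hc l),
      Matrix.mul_one, add_zero] at h2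
    exact h2
  have h2 : g l * φ * (vC x l)⁻¹ = τ l - g l * (π l * e l) := by
    have : φ * (vC x l)⁻¹ = (g l)⁻¹ * τ l - π l * e l := by rw [← h1]; abel
    rw [Matrix.mul_assoc, this, Matrix.mul_sub, ← Matrix.mul_assoc, Matrix.mul_nonsing_inv _ (hg l), Matrix.one_mul]
  have h3 : (g l * (π l * e l)) i k = 0 := by
    refine hgW l k (fun j => (π l * e l) j k) ⟨fun a => e l a k, ?_, ?_⟩ i hik
    · intro a ha
      rw [Matrix.one_mulVec]
      exact he l k a (by simpa using ha)
    · rfl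
  rw [h2, Matrix.sub_apply, h3, sub_zero]

end
end Horn

end

noncomputable section
namespace Horn
open MvPolynomial

lemma DD_lin {ι : Type} [Fintype ι] (x w v : ι → ℂ) (a : ℂ) (P : MvPolynomial ι ℂ) :
    DD x (w + a • v) P = DD x w P + a * DD x v P := by
  simp only [DD, Pi.add_apply, Pi.smul_apply, smul_eq_mul, add_mul, Finset.sum_add_distrib,
    Finset.mul_sum, mul_assoc]

lemma ent_ev {E : Type*} [AddCommGroup E] [Module ℂ E] [TopologicalSpace E] {s d p : ℕ}
    (P : MvPolynomial (Option (Kp s d p)) ℂ) (F : E → Fin s → Matrix (Fin (d + p)) (Fin (d + p)) ℂ)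
    (hF : ∀ l i j, Ent (fun x => F x l i j)) (z : E → ℂ) (hz : Ent z) :
    Ent (fun x => eval (fun o => o.elim (z x) (toY (F x))) P) := by
  induction P using MvPolynomial.induction_on with
  | C a => simpa using Ent.const a
  | add P Q h1 h2 => simpa using h1.add h2
  | mul_X P i h =>
    cases i with
    | none => simpa using h.mul hz
    | some i => simpa [toY] using h.mul (hF i.1 i.2.1 (finSumFinEquiv i.2.2))

section
variable {s d p : ℕ} (K : Fin s → Fin d → Fin (d + p))

def dU (s d p : ℕ) : MvPolynomial (Kp s d p) ℂ :=
  ∏ l : Fin s, (Matrix.of fun i k : Fin (d + p) => 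
    (X (l, i, finSumFinEquiv.symm k) : MvPolynomial (Kp s d p) ℂ)).det

lemma eval_dU (y : Kp s d p → ℂ) : eval y (dU s d p) = ∏ l, (fromY y l).det := by
  simp only [dU, map_prod]
  apply Finset.prod_congr rfl
  intro l _
  rw [RingHom.map_det]
  congr 1
  ext i k
  simp [fromY]

lemma dU_ne : dU s d p ≠ 0 := by
  intro h
  have := eval_dU (toY (s := s) (d := d) (p := p) (fun _ => 1))
  rw [h] at this
  have e : ∀ l, fromY (toY (s := s) (d := d) (p := p) (fun _ => 1)) l = 1 := fun l => by
    ext i j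
    change (1 : Matrix (Fin (d + p)) (Fin (d + p)) ℂ) i (finSumFinEquiv (finSumFinEquiv.symm j)) = _
    rw [Equiv.apply_symm_apply]
  simp [e] at this

lemma good_of_algIndep (hK : ∀ l, StrictMono (K l)) (h : AlgebraicIndependent ℂ (Phi K)) : 
    Good p (bK K) := by
  have h1 : aeval (Phi K) (dU s d p) ≠ 0 := by
    intro h2
    exact dU_ne (h (by rw [h2, map_zero]))
  obtain ⟨x, hx, hx2⟩ := jac_of_algIndep (Phi K) h (dC s d p * aeval (Phi K) (dU s d p)) (mul_ne_zero dC_ne h1)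
  rw [map_mul] at hx
  have hx3 := left_ne_zero_of_mul hx
  have hx4 := right_ne_zero_of_mul hx
  have e1 : eval x (aeval (Phi K) (dU s d p)) = eval (fun k => eval x (Phi K k)) (dU s d p) := by
    rw [← MvPolynomial.bind₁, MvPolynomial.eval, MvPolynomial.eval₂Hom_bind₁]
    rfl
  rw [e1, eval_dU, Finset.prod_ne_zero_iff] at hx4
  refine good_of_psurj K hK x (fromY (fun k => eval x (Phi K k))) 
    (fun l => isUnit_iff_ne_zero.mpr (hx4 l (Finset.mem_univ _))) (dC_unit x hx3) ?_ (psurj_of_jac K x hx2)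
  intro k
  rw [toY_fromY]

lemma gen_empty (hK : ∀ l, StrictMono (K l)) (h : ¬ Good p (bK K)) :
    Gen {u | ∀ V, ¬ Om K u V} := by
  have h1 : ¬ AlgebraicIndependent ℂ (Phi K) := fun h2 => h (good_of_algIndep K hK h2)
  rw [algebraicIndependent_iff] at h1
  push Not at h1
  obtain ⟨P, hP, hP0⟩ := h1
  have key : ∀ u Z c, OmM K u (iZ Z) c → eval (toY u) P = 0 := by
    intro u Z c hO
    obtain ⟨x, hx⟩ := om_to_phi K u Z c hO
    have e1 : eval x (aeval (Phi K) P) = eval (fun k => eval x (Phi K k)) P := by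
      rw [← MvPolynomial.bind₁, MvPolynomial.eval, MvPolynomial.eval₂Hom_bind₁]
      rfl
    rw [hP, map_zero] at e1
    rw [← funext hx]
    exact e1.symm
  refine (gen_toY P hP0).mono ?_
  intro u hu V hV
  obtain ⟨ι, lam, hι, hιV⟩ := Om.exists_mat hV.1
  obtain ⟨c, hc⟩ := hV.toM ι hιV
  let Λ : Matrix (Fin (d + p)) (Fin (d + p)) ℂ := (iL : Matrix (Fin d) (Fin (d + p)) ℂ).transpose * lam
  let H : ℂ × ℂ → Matrix (Fin (d + p)) (Fin (d + p)) ℂ := fun x => x.1 • 1 + x.2 • Λ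
  have hH : ∀ i j, Ent (fun x => H x i j) := by
    intro i j
    refine Ent.clm ?_ ?_ ?_
    · simp only [H, Matrix.add_apply, Matrix.smul_apply, smul_eq_mul]; fun_prop
    · intro x y; simp [H]; ring
    · intro x y; simp [H]; ring
  let A : ℂ × ℂ → Matrix (Fin d) (Fin d) ℂ := fun x => (iL : Matrix (Fin d) (Fin (d + p)) ℂ) * (H x * ι)
  have hA : ∀ i j, Ent (fun x => A x i j) := by
    apply Ent.mulM (M := fun _ => iL) (N := fun x => H x * ι)
    · intros; exact Ent.const _
    · apply Ent.mulM (M := H) (N := fun _ => ι) hH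
      intros; exact Ent.const _
  have hLL : (iL : Matrix (Fin d) (Fin (d + p)) ℂ) * (iL : Matrix (Fin d) (Fin (d + p)) ℂ).transpose = 1 := by
    ext i j; simp [iL, Matrix.mul_apply, Matrix.one_apply, eq_comm]
  have g1 := (Ent.det hA).gen (0, 1) (by
    have : A (0, 1) = 1 := by
      simp only [A, H, Λ]
      rw [zero_smul, zero_add, one_smul, Matrix.mul_assoc, hι, Matrix.mul_one, hLL]
    rw [this]; simp)
  have g2 := (Ent.det hH).gen (1, 0) (by simp [H])
  have g3 := (ent_toY' P (fun x l => u l * (H x).adjugate) (fun l => by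
    apply Ent.mulM (M := fun _ => u l) (N := fun x => (H x).adjugate)
    · intros; exact Ent.const _
    · exact Ent.adj hH)).gen (1, 0) (by
      have : H (1, 0) = 1 := by simp [H]
      simp only [this, Matrix.adjugate_one, Matrix.mul_one]
      exact hu)
  obtain ⟨x, ⟨hx1, hx2⟩, hx3⟩ := ((g1.inter g2).inter g3).nonempty
  have hx1' : IsUnit (A x).det := isUnit_iff_ne_zero.mpr hx1
  apply hx3
  apply key _ (- bot (H x * ι * (A x)⁻¹)) (fun l => A x * c l)
  have e1 : iZ (- bot (H x * ι * (A x)⁻¹)) = H x * ι * (A x)⁻¹ := by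
    ext a k
    refine Fin.addCases (fun j => ?_) (fun i => ?_) a
    · have h5 : (iL : Matrix (Fin d) (Fin (d + p)) ℂ) * (H x * ι * (A x)⁻¹) = 1 := by
        rw [← Matrix.mul_assoc]; exact Matrix.mul_nonsing_inv _ hx1'
      have h6 := congrFun (congrFun h5 j) k
      have h7 : ∀ M : Matrix (Fin (d + p)) (Fin d) ℂ, ((iL : Matrix (Fin d) (Fin (d + p)) ℂ) * M) j k = 
          M (Fin.castAdd p j) k := by intro M; simp [iL, Matrix.mul_apply]
      rw [h7] at h6
      rw [h6]
      simp [iZ, Matrix.one_apply]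
    · simp [iZ, bot]
  intro l
  refine ⟨by rw [Matrix.det_mul]; exact hx1'.mul (hc l).1, fun k a ha => ?_⟩
  rw [e1]
  have e2 : u l * (H x).adjugate * (H x * ι * (A x)⁻¹) * (A x * c l) = (H x).det • (u l * ι * c l) := by
    calc _ = u l * ((H x).adjugate * H x) * ι * ((A x)⁻¹ * A x) * c l := by simp only [Matrix.mul_assoc]
      _ = _ := by rw [Matrix.adjugate_mul, Matrix.nonsing_inv_mul _ hx1', Matrix.mul_one]; simp
  rw [e2, Matrix.smul_apply, (hc l).2 k a ha, smul_zero]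

theorem intersecting_iff_good (hK : ∀ l, StrictMono (K l)) : Intersecting K ↔ Good p (bK K) := by
  constructor
  · intro h
    by_contra hc
    have g1 := gen_empty K hK hc
    have g2 := gen_unit (fun u : Fin s → Matrix (Fin (d + p)) (Fin (d + p)) ℂ => u) ent_coord (fun _ => 1) (by simp)
    obtain ⟨u, h1, h2⟩ := (g1.inter g2).nonempty
    obtain ⟨V, hV⟩ := (intersecting_iff K).mp h u h2
    exact h1 V hV
  · intro h
    rw [intersecting_iff]
    exact fun u _ => h.om hK u

lemma iZ_inj {Z Z' : Matrix (Fin p) (Fin d) ℂ} 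
    (h : LinearMap.range (iZ Z).mulVecLin = LinearMap.range (iZ Z').mulVecLin) : Z = Z' := by
  have h1 : ∀ y : Fin d → ℂ, (iZ Z).mulVec y = (iZ Z').mulVec y := by
    intro y
    have h2 : (iZ Z).mulVecLin y ∈ LinearMap.range (iZ Z').mulVecLin := h ▸ LinearMap.mem_range_self _ y
    obtain ⟨y', hy'⟩ := h2
    have h3 := congrArg (iL : Matrix (Fin d) (Fin (d + p)) ℂ).mulVec hy'
    simp only [Matrix.mulVecLin_apply, Matrix.mulVec_mulVec, iL_iZ, Matrix.one_mulVec] at h3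
    rw [← h3]
    exact h3 ▸ hy'.symm
  ext i k
  have h2 := congrFun (h1 (Pi.single k 1)) (Fin.natAdd d i)
  simpa [iZ] using h2

/-- If the expected dimension is nonzero, generic intersections have at least two points. -/
lemma gen_two (hK : ∀ l, StrictMono (K l)) (h : Good p (bK K)) (he : ee p (bK K) ≠ 0) :
    Gen {u | ∃ V V', V ≠ V' ∧ Om K u V ∧ Om K u V'} := by
  classical
  obtain ⟨f, g, h, hf, hg⟩ := h.inv
  -- nontrivial kernel
  obtain ⟨φ, hφ0, hφ⟩ : ∃ φ : Matrix (Fin p) (Fin d) ℂ, φ ≠ 0 ∧ 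
      ∀ l (i : Fin p) k, bK K l k ≤ (i : ℕ) → (g l * φ * f l) i k = 0 := by
    by_contra hc
    push Not at hc
    have hinj : LinearMap.ker (Tm (bK K) f g).mulVecLin = ⊥ := by
      rw [LinearMap.ker_eq_bot']
      intro y hy
      by_contra hy0
      obtain ⟨l, i, k, h1, h2⟩ := hc (Matrix.of fun i j => y (i, j)) (by
        intro h3; apply hy0; funext ⟨i, j⟩; exact congrFun (congrFun h3 i) j)
      apply h2
      have := congrFun hy ⟨(l, i, k), h1⟩
      rw [Matrix.mulVecLin_apply, Tm_mulVec] at this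
      exact this
    have h1 := LinearMap.finrank_range_add_finrank_ker (Tm (bK K) f g).mulVecLin
    have h2 := (surj_iff (bK K) f g).mp h
    rw [hinj, LinearMap.range_eq_top.mpr h2] at h1
    simp only [finrank_top, finrank_fintype_fun_eq_card, finrank_bot, Fintype.card_prod, Fintype.card_fin] at h1
    apply he
    unfold ee
    rw [← card_rows (bK K) (fun l k => sub_le (hK l) k)]
    have : (Fintype.card (Rows p (bK K)) : ℤ) = p * d := by exact_mod_cast h1
    rw [this]; ring
  obtain ⟨x, hx1, hx2, hx3⟩ := h.psurj K hK f g hf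
  obtain ⟨v, hv, hvZ⟩ := hx3 φ hφ
  obtain ⟨i0, k0, hik⟩ : ∃ i k, φ i k ≠ 0 := by
    by_contra hc; push Not at hc; exact hφ0 (by ext i k; exact hc i k)
  let Φ' : Option (Kp s d p) → MvPolynomial (Vr s d p) ℂ := fun o => o.elim (X (.inl (i0, k0))) (Phi K)
  have hJ : ∀ y, ∃ v, Jac Φ' x v = y := by
    intro y
    obtain ⟨w, hw⟩ := hx2 (fun k => y (some k))
    let a := (y none - w (.inl (i0, k0))) / φ i0 k0
    refine ⟨w + a • v, ?_⟩
    have hlin : ∀ P, DD x (w + a • v) P = DD x w P + a * DD x v P := by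
      exact fun P => DD_lin x w v a P
    funext o
    change DD x (w + a • v) (Φ' o) = _
    rw [hlin]
    cases o with
    | none =>
      change DD x w (X _) + a * DD x v (X _) = _
      rw [DD_X, DD_X]
      have : v (.inl (i0, k0)) = φ i0 k0 := congrFun (congrFun hvZ i0) k0
      rw [this]
      simp only [a]; field_simp; ring
    | some k =>
      have h1 := congrFun hw k
      have h2 := congrFun hv k
      change DD x w (Phi K k) = _ at h1
      change DD x v (Phi K k) = _ at h2
      change DD x w (Phi K k) + a * DD x v (Phi K k) = _
      rw [h1, h2]; simp
  obtain ⟨P, hP, hP2⟩ := dominant_image Φ' (algIndep_of_jac Φ' x hJ) (dC s d p) dC_ne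
  obtain ⟨y0, hy0⟩ := exists_eval_ne_zero P hP
  have hev : ∀ u z, eval (fun o => o.elim z (toY u)) P ≠ 0 → ∃ Z : Matrix (Fin p) (Fin d) ℂ, Z i0 k0 = z ∧
      Om K u (LinearMap.range (iZ Z).mulVecLin) := by
    intro u z hz
    obtain ⟨x, hx, hx2⟩ := hP2 _ hz
    refine ⟨vZ x, ?_, OmM.toOm (fun l => (hK l).monotone) (iL_iZ _) 
      (phi_to_om K x u (dC_unit x hx) (fun k => hx2 (some k)))⟩
    have := hx2 none
    simpa [Φ', vZ] using this
  let u0 := fromY (fun k => y0 (some k))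
  have h0 : eval (fun o => o.elim (y0 none) (toY u0)) P ≠ 0 := by
    have : (fun o : Option (Kp s d p) => o.elim (y0 none) (toY u0)) = y0 := by
      simp only [u0, toY_fromY]
      funext o; cases o <;> rfl
    rw [this]; exact hy0
  have hid : Ent (fun z : ℂ => z) := Ent.clm continuous_id (fun _ _ => rfl) (fun _ _ => rfl)
  have g1 := (ent_ev P (fun _ : ℂ => u0) (fun _ _ _ => Ent.const _) (fun z => z) hid).gen (y0 none) h0
  have g2 := (hid.add (Ent.const (- y0 none))).gen (y0 none + 1) (by simp)
  obtain ⟨z1, hz1, hz2⟩ := (g1.inter g2).nonempty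
  have g3 := (ent_ev P (fun u : Fin s → Matrix (Fin (d + p)) (Fin (d + p)) ℂ => u) ent_coord 
    (fun _ => y0 none) (Ent.const _)).gen u0 h0
  have g4 := (ent_ev P (fun u : Fin s → Matrix (Fin (d + p)) (Fin (d + p)) ℂ => u) ent_coord 
    (fun _ => z1) (Ent.const _)).gen u0 hz1
  refine (g3.inter g4).mono ?_
  rintro u ⟨h3, h4⟩
  obtain ⟨Z, hZ, hZ2⟩ := hev u _ h3
  obtain ⟨Z', hZ', hZ2'⟩ := hev u _ h4
  refine ⟨_, _, ?_, hZ2, hZ2'⟩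
  intro h5
  have := iZ_inj h5
  apply hz2
  rw [← hZ, ← hZ', this]; ring

end
end Horn

end

noncomputable section
namespace Horn

lemma Gen.fst {E F : Type*} [TopologicalSpace E] [TopologicalSpace F] {S : Set E} (h : Gen S) :
    Gen {x : E × F | x.1 ∈ S} := by
  obtain ⟨O, h1, h2, h3⟩ := h
  exact ⟨Prod.fst ⁻¹' O, fun x hx => h1 hx, h2.preimage continuous_fst, h3.preimage isOpenMap_fst⟩

lemma Gen.snd {E F : Type*} [TopologicalSpace E] [TopologicalSpace F] {S : Set F} (h : Gen S) :
    Gen {x : E × F | x.2 ∈ S} := by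
  obtain ⟨O, h1, h2, h3⟩ := h
  exact ⟨Prod.snd ⁻¹' O, fun x hx => h1 hx, h2.preimage continuous_snd, h3.preimage isOpenMap_snd⟩

/-- For generic `u`, only intersecting positions occur. -/
lemma gen_pos (s r : ℕ) : Gen {u : Fin s → Matrix (Fin r) (Fin r) ℂ | 
    ∀ (d : ℕ) (J : Fin s → Fin d → Fin r) V, (∀ l, StrictMono (J l)) → Om J u V → Intersecting J} := by
  have h1 : ∀ (d : Fin (r + 1)) (J : Fin s → Fin d → Fin r), 
      Gen {u : Fin s → Matrix (Fin r) (Fin r) ℂ | (∀ l, StrictMono (J l)) → ¬ Intersecting J → ∀ V, ¬ Om J u V} := by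
    intro d J
    obtain ⟨d, hd⟩ := d
    obtain ⟨q, rfl⟩ := Nat.exists_eq_add_of_le (Nat.lt_succ_iff.mp hd)
    by_cases hJ : ∀ l, StrictMono (J l)
    · by_cases hI : Intersecting J
      · exact Gen.univ.mono (fun u _ _ h => absurd hI h)
      · refine (gen_empty (p := q) J hJ ?_).mono (fun u hu _ _ => hu)
        rwa [← intersecting_iff_good (p := q) J hJ]
    · exact Gen.univ.mono (fun u _ h => absurd h hJ)
  have h2 := Gen.all (fun d => Gen.all (h1 d))
  refine h2.mono ?_
  intro u hu d J V hJ hV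
  by_contra hI
  have hd : d ≤ r := by
    rw [← hV.1]
    exact (Submodule.finrank_le V).trans (by simp)
  exact hu ⟨d, Nat.lt_succ_iff.mpr hd⟩ J hJ hI V hV

lemma pencil {m n : Type*} [Fintype m] [Fintype n] [DecidableEq m] [DecidableEq n]
    (T0 T1 : Matrix m n ℂ) (h : ∀ t : ℂ, (T0 + t • T1).rank ≤ T0.rank) (φ : n → ℂ)
    (hφ : T0.mulVec φ = 0) : ∃ ψ, T0.mulVec ψ = T1.mulVec φ := by
  classical
  by_contra hc
  have hc' : T1.mulVec φ ∉ LinearMap.range T0.mulVecLin := fun ⟨ψ, h⟩ => hc ⟨ψ, h⟩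
  obtain ⟨lam, hl1, hl2⟩ := Submodule.exists_dual_map_eq_bot_of_notMem hc' inferInstance
  obtain ⟨π, ι, hπ⟩ := exists_rank_factor T0
  let L : Matrix Unit m ℂ := Matrix.of fun _ j => lam (Pi.single j 1)
  have hL : ∀ v : m → ℂ, L.mulVec v = fun _ => lam v := by
    intro v; funext _
    rw [LinearMap.pi_apply_eq_sum_univ lam v]
    simp [L, Matrix.mulVec, dotProduct, mul_comm]
    apply Finset.sum_congr rfl
    intro i _; congr 2; ext j; simp [Pi.single_apply, eq_comm]
  have hLT : L * T0 = 0 := by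
    ext i j
    have h1 : lam (T0.mulVec (Pi.single j 1)) = 0 := by
      have : lam (T0.mulVec (Pi.single j 1)) ∈ (LinearMap.range T0.mulVecLin).map lam := ⟨_, ⟨_, rfl⟩, rfl⟩
      rw [hl2] at this; simpa using this
    have h2 := congrFun (hL (T0.mulVec (Pi.single j 1))) i
    rw [h1, Matrix.mulVec_mulVec] at h2
    simpa using h2
  let c : Matrix n Unit ℂ := Matrix.replicateCol Unit φ
  have hTc : T0 * c = 0 := by
    ext i j; exact congrFun hφ i
  let a := lam (T1.mulVec φ)
  have hLc : L * T1 * c = Matrix.of fun _ _ => a := by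
    ext i j
    rw [Matrix.mul_assoc]
    exact congrFun (hL (T1.mulVec φ)) i
  let M : ℂ → Matrix (Fin T0.rank ⊕ Unit) (Fin T0.rank ⊕ Unit) ℂ := fun t => 
    Matrix.fromBlocks (1 + t • (π * T1 * ι)) (π * T1 * c) (t • (L * T1 * ι)) (L * T1 * c)
  have hid : Ent (fun z : ℂ => z) := Ent.clm continuous_id (fun _ _ => rfl) (fun _ _ => rfl)
  have hM : ∀ i j, Ent (fun t => M t i j) := by
    rintro (i | i) (j | j)
    · simpa [M] using (Ent.const _).add (hid.mul (Ent.const _))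
    · simpa [M] using (Ent.const _)
    · simpa [M] using (hid.mul (Ent.const _))
    · simpa [M] using (Ent.const _)
  have g1 := (Ent.det hM).gen 0 (by
    simp only [M, zero_smul, add_zero]
    rw [Matrix.det_fromBlocks_zero₂₁, Matrix.det_one, hLc]
    simpa [a] using hl1)
  have g2 := hid.gen 1 one_ne_zero
  obtain ⟨t, ht1, ht2⟩ := (g1.inter g2).nonempty
  have e1 : Matrix.fromRows π L * (T0 + t • T1) * Matrix.fromCols ι (t⁻¹ • c) = M t := by
    rw [Matrix.fromRows_mul, Matrix.fromRows_mul_fromCols]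
    have e0 : π * (T0 + t • T1) * (t⁻¹ • c) = π * T1 * c := by
      rw [Matrix.mul_assoc, Matrix.add_mul, Matrix.mul_smul, hTc, Matrix.smul_mul, Matrix.mul_smul, smul_smul,
        mul_inv_cancel₀ ht2]
      simp [Matrix.mul_assoc]
    have e0' : L * (T0 + t • T1) * (t⁻¹ • c) = L * T1 * c := by
      rw [Matrix.mul_assoc, Matrix.add_mul, Matrix.mul_smul, hTc, Matrix.smul_mul, Matrix.mul_smul, smul_smul,
        mul_inv_cancel₀ ht2]
      simp [Matrix.mul_assoc]
    have e0'' : L * (T0 + t • T1) = t • (L * T1) := by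
      rw [Matrix.mul_add, hLT, zero_add, Matrix.mul_smul]
    rw [e0, e0', e0'', Matrix.mul_add, Matrix.add_mul, hπ]
    simp [M]
  have h1 : (M t).rank = T0.rank + 1 := by
    rw [Matrix.rank_of_isUnit _ ((Matrix.isUnit_iff_isUnit_det _).mpr (isUnit_iff_ne_zero.mpr ht1))]
    simp
  have h2 := (Matrix.rank_mul_le_left (Matrix.fromRows π L * (T0 + t • T1)) (Matrix.fromCols ι (t⁻¹ • c))).trans
    (Matrix.rank_mul_le_right _ _)
  rw [e1, h1] at h2
  have := h t
  omega

lemma exists_factor {p r q : ℕ} (A : Matrix (Fin p) (Fin r) ℂ) (D : Matrix (Fin q) (Fin r) ℂ)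
    (h : ∀ v, A.mulVec v = 0 → D.mulVec v = 0) : ∃ N : Matrix (Fin q) (Fin p) ℂ, N * A = D := by
  let q1 := (LinearMap.ker A.mulVecLin).liftQ A.mulVecLin le_rfl
  let q2 := (LinearMap.ker A.mulVecLin).liftQ D.mulVecLin (fun v hv => h v hv)
  have : LinearMap.ker q1 = ⊥ := Submodule.ker_liftQ_eq_bot _ _ _ le_rfl
  obtain ⟨g, hg⟩ := q1.exists_leftInverse_of_injective this
  refine ⟨LinearMap.toMatrix' (q2 ∘ₗ g), ?_⟩
  apply Matrix.toLin'.injective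
  rw [Matrix.toLin'_mul, Matrix.toLin'_toMatrix']
  apply LinearMap.ext
  intro v
  have h1 : A.mulVecLin v = q1 (Submodule.Quotient.mk v) := rfl
  change q2 (g (A.mulVecLin v)) = D.mulVec v
  have h2 : g (q1 (Submodule.Quotient.mk v)) = Submodule.Quotient.mk v := LinearMap.congr_fun hg _
  rw [h1, h2]
  rfl

lemma rank_le_of_ker {m n m' : Type*} [Fintype m] [Fintype n] [Fintype m'] (A : Matrix m n ℂ) (B : Matrix m' n ℂ)
    (h : ∀ v, A.mulVec v = 0 → B.mulVec v = 0) : B.rank ≤ A.rank := by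
  have h1 := LinearMap.finrank_range_add_finrank_ker A.mulVecLin
  have h2 := LinearMap.finrank_range_add_finrank_ker B.mulVecLin
  have h3 : LinearMap.ker A.mulVecLin ≤ LinearMap.ker B.mulVecLin := fun v hv => h v hv
  have h4 := Submodule.finrank_mono h3
  unfold Matrix.rank
  omega

lemma Tm_ker {s d p : ℕ} (b : Fin s → Fin d → ℕ) (f : Fin s → Matrix (Fin d) (Fin d) ℂ)
    (g : Fin s → Matrix (Fin p) (Fin p) ℂ) (φ : Fin p × Fin d → ℂ) :
    (Tm b f g).mulVec φ = 0 ↔ ∀ l (i : Fin p) k, b l k ≤ (i : ℕ) → 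
      (g l * (Matrix.of fun i j => φ (i, j)) * f l) i k = 0 := by
  constructor
  · intro h l i k hb
    have := congrFun h ⟨(l, i, k), hb⟩
    rwa [Tm_mulVec] at this
  · intro h
    funext x
    rw [Tm_mulVec]
    exact h _ _ _ x.2

lemma rank_tri_le {s d p : ℕ} (b : Fin s → Fin d → ℕ) (hb : ∀ l, Monotone (b l)) 
    (f t : Fin s → Matrix (Fin d) (Fin d) ℂ)
    (g : Fin s → Matrix (Fin p) (Fin p) ℂ) (ht : ∀ l i j, j < i → t l i j = 0) : 
    (Tm b (fun l => f l * t l) g).rank ≤ (Tm b f g).rank := by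
  apply rank_le_of_ker
  intro φ
  rw [Tm_ker, Tm_ker]
  intro h l i k hk
  rw [← Matrix.mul_assoc, Matrix.mul_apply]
  apply Finset.sum_eq_zero
  intro j _
  by_cases hj : k < j
  · rw [ht l j k hj, mul_zero]
  · rw [h l i j ((hb l (not_lt.mp hj)).trans hk), zero_mul]

lemma rank_tri {s d p : ℕ} (b : Fin s → Fin d → ℕ) (hb : ∀ l, Monotone (b l)) 
    (f t : Fin s → Matrix (Fin d) (Fin d) ℂ)
    (g : Fin s → Matrix (Fin p) (Fin p) ℂ) (ht : ∀ l i j, j < i → t l i j = 0) (hu : ∀ l, IsUnit (t l).det) : 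
    (Tm b (fun l => f l * t l) g).rank = (Tm b f g).rank := by
  apply le_antisymm (rank_tri_le b hb f t g ht)
  have h1 := rank_tri_le b hb (fun l => f l * t l) (fun l => (t l)⁻¹) g (by
    intro l i j hij
    have : Invertible (t l) := Matrix.invertibleOfIsUnitDet _ (hu l)
    have h2 : Matrix.BlockTriangular (t l) id := fun i j hij => ht l i j hij
    exact Matrix.blockTriangular_inv_of_blockTriangular h2 hij)
  have h2 : (fun l => f l * t l * (t l)⁻¹) = f := by
    funext l; rw [Matrix.mul_assoc, Matrix.mul_nonsing_inv _ (hu l), Matrix.mul_one]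
  rw [h2] at h1
  exact h1

lemma intersecting_id (s r : ℕ) : Intersecting (fun (_ : Fin s) (k : Fin r) => k) := by
  intro F
  refine ⟨⊤, by simp, fun l k => ?_⟩
  rw [top_inf_eq, (F l).rank_eq]

end Horn

end

noncomputable section
namespace Horn

/-- selection matrix -/
def PJ {d r : ℕ} (J : Fin d → Fin r) : Matrix (Fin d) (Fin r) ℂ := Matrix.of fun k j => if J k = j then 1 else 0
def DJ {d r : ℕ} (J : Fin d → Fin r) : Matrix (Fin r) (Fin r) ℂ := 
  Matrix.of fun i j => if i = j ∧ ∀ k, J k ≠ j then 1 else 0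

lemma mul_PJ_J {d r p : ℕ} {J : Fin d → Fin r} (hJ : Function.Injective J) (A : Matrix (Fin p) (Fin d) ℂ) (i k) :
    (A * PJ J) i (J k) = A i k := by
  simp [PJ, Matrix.mul_apply, hJ.eq_iff]

lemma mul_PJ_not {d r p : ℕ} {J : Fin d → Fin r} (A : Matrix (Fin p) (Fin d) ℂ) (i j) 
    (hj : ∀ k, J k ≠ j) : (A * PJ J) i j = 0 := by
  simp [PJ, Matrix.mul_apply, hj]

lemma mul_DJ_J {d r p : ℕ} {J : Fin d → Fin r} (A : Matrix (Fin p) (Fin r) ℂ) (i k) :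
    (A * DJ J) i (J k) = 0 := by
  rw [Matrix.mul_apply]
  apply Finset.sum_eq_zero
  intro j _
  rw [DJ, Matrix.of_apply, if_neg, mul_zero]
  rintro ⟨h1, h2⟩; exact h2 k rfl

lemma mul_DJ_not {d r p : ℕ} {J : Fin d → Fin r} (A : Matrix (Fin p) (Fin r) ℂ) (i j) 
    (hj : ∀ k, J k ≠ j) : (A * DJ J) i j = A i j := by
  simp [DJ, Matrix.mul_apply, hj]

lemma DJ_J {d r : ℕ} {J : Fin d → Fin r} (i k) : DJ J i (J k) = 0 := by
  rw [DJ, Matrix.of_apply, if_neg]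
  rintro ⟨h1, h2⟩; exact h2 k rfl

lemma DJ_mulVec {d r : ℕ} {J : Fin d → Fin r} (v : Fin r → ℂ) (k) :
    (DJ J).mulVec v (J k) = 0 := by
  simp only [DJ, Matrix.mulVec, dotProduct, Matrix.of_apply]
  apply Finset.sum_eq_zero
  intro j _
  rw [if_neg, zero_mul]
  rintro ⟨h1, h2⟩; exact h2 k h1

lemma exists_max_rank {s r p : ℕ} (b : Fin s → Fin r → ℕ) : 
    ∃ (f : Fin s → Matrix (Fin r) (Fin r) ℂ) (g : Fin s → Matrix (Fin p) (Fin p) ℂ), 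
    ∀ f' (g' : Fin s → Matrix (Fin p) (Fin p) ℂ), (Tm b f' g').rank ≤ (Tm b f g).rank := by
  let F : (Fin s → Matrix (Fin r) (Fin r) ℂ) × (Fin s → Matrix (Fin p) (Fin p) ℂ) → ℕ := fun x => 
    Fintype.card (Rows p b) - (Tm b x.1 x.2).rank
  let x := Function.argmin F
  refine ⟨x.1, x.2, fun f' g' => ?_⟩
  have h1 : F x ≤ F (f', g') := Function.argmin_le F _
  have h2 := Matrix.rank_le_card_height (Tm b f' g')
  have h3 := Matrix.rank_le_card_height (Tm b x.1 x.2)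
  simp only [F] at h1
  omega

/-- The final step: at a point of maximal rank with kernel element `φ`, surjectivity on
the kernel of `φ` gives surjectivity. -/
lemma surj_of_max {s r p d : ℕ} (b : Fin s → Fin r → ℕ) (f f' : Fin s → Matrix (Fin r) (Fin r) ℂ)
    (g : Fin s → Matrix (Fin p) (Fin p) ℂ) (hg : ∀ l, IsUnit (g l).det)
    (φ : Matrix (Fin p) (Fin r) ℂ)
    (J : Fin s → Fin d → Fin r) (hJ : ∀ l, Function.Injective (J l))
    (ι : Matrix (Fin r) (Fin d) ℂ) (lam : Matrix (Fin d) (Fin r) ℂ) (hι : lam * ι = 1)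
    (hφι : φ * ι = 0) (c : Fin s → Matrix (Fin d) (Fin d) ℂ)
    (hf' : ∀ l, f' l = ι * c l * PJ (J l) + f l * DJ (J l))
    (hmax : ∀ g' : Fin s → Matrix (Fin p) (Fin p) ℂ, (Tm b f' g').rank ≤ (Tm b f' g).rank)
    (hφ : ∀ l (i : Fin p) k, b l k ≤ (i : ℕ) → (g l * φ * f l) i k = 0)
    (hs : Surj (fun l k => b l (J l k)) c g)
    (hN : ∀ l, ∃ N : Matrix (Fin r) (Fin p) ℂ, N * (φ * f l * DJ (J l)) = DJ (J l)) :
    Surj b f' g := by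
  intro τ
  have e1 : ∀ l (A : Matrix (Fin p) (Fin r) ℂ) i k, (A * f' l) i (J l k) = (A * ι * c l) i k := by
    intro l A i k
    rw [hf' l, Matrix.mul_add, Matrix.add_apply, ← Matrix.mul_assoc, ← Matrix.mul_assoc, ← Matrix.mul_assoc,
      mul_PJ_J (hJ l), mul_DJ_J, add_zero]
  have e2 : ∀ l, φ * f' l = φ * f l * DJ (J l) := by
    intro l
    rw [hf' l, Matrix.mul_add, ← Matrix.mul_assoc, ← Matrix.mul_assoc, hφι]
    simp [Matrix.mul_assoc]
  obtain ⟨χ, hχ⟩ := hs (fun l => Matrix.of fun i k => τ l i (J l k))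
  let τ' : Fin s → Matrix (Fin p) (Fin r) ℂ := fun l => τ l - g l * (χ * lam) * f' l
  have hτ' : ∀ l (i : Fin p) k, b l (J l k) ≤ (i : ℕ) → τ' l i (J l k) = 0 := by
    intro l i k hk
    have := hχ l i k hk
    simp only [τ', Matrix.sub_apply]
    rw [e1]
    have e3 : g l * (χ * lam) * ι * c l = g l * χ * c l := by
      calc _ = g l * (χ * (lam * ι)) * c l := by simp only [Matrix.mul_assoc]
        _ = _ := by rw [hι, Matrix.mul_one]
    rw [e3, this, Matrix.of_apply, sub_self]
  choose N hN using hN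
  let x : Fin s → Matrix (Fin p) (Fin p) ℂ := fun l => (g l)⁻¹ * τ' l * N l
  have ex : ∀ l, g l * x l * φ * f' l = τ' l * DJ (J l) := by
    intro l
    calc g l * x l * φ * f' l = (g l * (g l)⁻¹) * τ' l * (N l * (φ * f' l)) := by
          simp only [x, Matrix.mul_assoc]
      _ = _ := by rw [e2, hN, Matrix.mul_nonsing_inv _ (hg l), Matrix.one_mul]
  obtain ⟨ψ, hψ⟩ := pencil (Tm b f' g) (Tm b f' (fun l => g l * x l)) (by
    intro t
    have : Tm b f' g + t • Tm b f' (fun l => g l * x l) = Tm b f' (fun l => g l + t • (g l * x l)) := by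
      ext i j
      simp [Tm]; ring
    rw [this]
    exact hmax _) (fun y => φ y.1 y.2) (by
      rw [Tm_ker]
      intro l i k hk
      change (g l * φ * f' l) i k = 0
      rw [Matrix.mul_assoc, e2, ← Matrix.mul_assoc]
      by_cases hj : ∃ k', J l k' = k
      · obtain ⟨k', rfl⟩ := hj
        exact mul_DJ_J _ _ _
      · push Not at hj
        rw [mul_DJ_not _ _ _ hj, ← Matrix.mul_assoc]
        exact hφ l i k hk)
  refine ⟨χ * lam + Matrix.of fun i j => ψ (i, j), fun l i k hk => ?_⟩
  have h1 := congrFun hψ ⟨(l, i, k), hk⟩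
  rw [Tm_mulVec, Tm_mulVec] at h1
  change (g l * (Matrix.of fun i j => ψ (i, j)) * f' l) i k = (g l * x l * φ * f' l) i k at h1
  rw [Matrix.mul_add, Matrix.add_mul, Matrix.add_apply, h1, ex]
  by_cases hj : ∃ k', J l k' = k
  · obtain ⟨k', rfl⟩ := hj
    have := hτ' l i k' hk
    rw [mul_DJ_J, add_zero]
    exact (sub_eq_zero.mp this).symm
  · push Not at hj
    rw [mul_DJ_not _ _ _ hj]
    simp only [τ', Matrix.sub_apply]; ring

theorem good_of_ineq (s p : ℕ) : ∀ (r : ℕ) (b : Fin s → Fin r → ℕ), (∀ l, Monotone (b l)) → 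
    (∀ l k, b l k ≤ p) →
    (∀ (d : ℕ) (J : Fin s → Fin d → Fin r), (∀ l, StrictMono (J l)) → Intersecting J → 
      0 ≤ ee p (fun l k => b l (J l k))) → Good p b := by
  intro r
  induction r using Nat.strong_induction_on with
  | _ r ih =>
  intro b hb hbp hI
  classical
  -- goodness of smaller ones
  have hsm : ∀ (d : ℕ), d < r → ∀ J : Fin s → Fin d → Fin r, (∀ l, StrictMono (J l)) → Intersecting J → 
      Good p (fun l k => b l (J l k)) := by
    intro d hd J hJm hJ
    apply ih d hd _ (fun l => (hb l).comp (hJm l).monotone) (fun l k => hbp _ _)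
    intro d' K hKm hK
    exact hI d' (fun l k => J l (K l k)) (fun l => (hJm l).comp (hKm l)) 
      (Intersecting.comp (fun l => (hJm l).monotone) (fun l => (hKm l).monotone) hJ hK)
  have hc0 : ∀ (d : Fin r) (J : Fin s → Fin d → Fin r), ∃ c : Fin s → Matrix (Fin d) (Fin d) ℂ, 
      Gen {g : Fin s → Matrix (Fin p) (Fin p) ℂ | (∀ l, StrictMono (J l)) → Intersecting J → 
        Surj (fun l k => b l (J l k)) c g} := by
    intro d J
    by_cases h : (∀ l, StrictMono (J l)) ∧ Intersecting J
    · obtain ⟨c, g, hcg⟩ := hsm d d.2 J h.1 h.2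
      exact ⟨c, (gen_surj _ (fun _ => c) (fun g => g) (fun _ _ _ => Ent.const _) ent_coord g hcg).mono 
        (fun g hg _ _ => hg)⟩
    · exact ⟨0, Gen.univ.mono (fun g _ h1 h2 => absurd ⟨h1, h2⟩ h)⟩
  choose c0 hc0 using hc0
  obtain ⟨f0, g0, hmax⟩ := exists_max_rank (p := p) b
  -- make `f0` invertible
  have hu0 : ∃ u0 : Fin s → Matrix (Fin r) (Fin r) ℂ, 
      (Tm b f0 g0).rank ≤ (Tm b (fun l => (u0 l).adjugate) g0).rank := by
    have g1 := gen_Tm_rank b (fun f => f) (fun _ => g0) ent_coord (fun _ _ _ => Ent.const _) f0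
    have g2 := gen_unit (fun u : Fin s → Matrix (Fin r) (Fin r) ℂ => u) ent_coord (fun _ => 1) (by simp)
    obtain ⟨f1, h1, h2⟩ := (g1.inter g2).nonempty
    refine ⟨fun l => (f1 l)⁻¹, h1.trans ?_⟩
    have h3 : ∀ l, IsUnit ((f1 l)⁻¹).det := fun l => by
      rw [Matrix.isUnit_nonsing_inv_det_iff]; exact h2 l
    have h4 : (fun l => ((f1 l)⁻¹).adjugate) = fun l => f1 l * (((f1 l)⁻¹).det • 1) := by
      funext l
      have h5 := Matrix.mul_adjugate ((f1 l)⁻¹)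
      calc ((f1 l)⁻¹).adjugate = f1 l * ((f1 l)⁻¹ * ((f1 l)⁻¹).adjugate) := by
            rw [← Matrix.mul_assoc, Matrix.mul_nonsing_inv _ (h2 l), Matrix.one_mul]
        _ = _ := by rw [h5]
    rw [h4, rank_tri b hb]
    · intro l i j hij
      simp [Matrix.one_apply, hij.ne']
    · intro l
      rw [Matrix.det_smul, Matrix.det_one, mul_one]
      exact (h3 l).pow _
  obtain ⟨u0, hu0⟩ := hu0
  have e1 : ∀ l i j, Ent (fun x : (Fin s → Matrix (Fin r) (Fin r) ℂ) × (Fin s → Matrix (Fin p) (Fin p) ℂ) => x.1 l i j) := fun l i j =>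
    Ent.clm (by fun_prop) (fun _ _ => rfl) (fun _ _ => rfl)
  have e2 : ∀ l i j, Ent (fun x : (Fin s → Matrix (Fin r) (Fin r) ℂ) × (Fin s → Matrix (Fin p) (Fin p) ℂ) => x.2 l i j) := fun l i j =>
    Ent.clm (by fun_prop) (fun _ _ => rfl) (fun _ _ => rfl)
  have G1 := gen_Tm_rank b (fun x : (Fin s → Matrix (Fin r) (Fin r) ℂ) × (Fin s → Matrix (Fin p) (Fin p) ℂ) => fun l => (x.1 l).adjugate) (fun x => x.2) (fun l => Ent.adj (e1 l)) e2 (u0, g0)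
  have G2 := gen_unit (fun x : (Fin s → Matrix (Fin r) (Fin r) ℂ) × (Fin s → Matrix (Fin p) (Fin p) ℂ) => x.1) e1 (fun _ => 1, fun _ => 1) (by simp)
  have G3 := gen_unit (fun x : (Fin s → Matrix (Fin r) (Fin r) ℂ) × (Fin s → Matrix (Fin p) (Fin p) ℂ) => x.2) e2 (fun _ => 1, fun _ => 1) (by simp)
  have G4 : Gen {x : (Fin s → Matrix (Fin r) (Fin r) ℂ) × (Fin s → Matrix (Fin p) (Fin p) ℂ) | _} := (gen_pos s r).fst
  have G5 : Gen {x : (Fin s → Matrix (Fin r) (Fin r) ℂ) × (Fin s → Matrix (Fin p) (Fin p) ℂ) | _} := (Gen.all (fun d => Gen.all (hc0 d))).snd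
  obtain ⟨⟨u, g⟩, ⟨⟨⟨h1, hu⟩, hg⟩, hpos⟩, hc⟩ := ((((G1.inter G2).inter G3).inter G4).inter G5).nonempty
  clear G1 G2 G3 G4 G5
  simp only [Set.mem_setOf_eq] at h1 hu hg hpos hc
  let f : Fin s → Matrix (Fin r) (Fin r) ℂ := fun l => (u l).adjugate
  have hR : ∀ f' (g' : Fin s → Matrix (Fin p) (Fin p) ℂ), (Tm b f' g').rank ≤ (Tm b f g).rank := fun f' g' => 
    (hmax f' g').trans (hu0.trans h1)
  by_cases hker : ∀ φ : Fin p × Fin r → ℂ, (Tm b f g).mulVec φ = 0 → φ = 0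
  · refine ⟨f, g, ?_⟩
    rw [surj_iff_rank]
    have h2 := LinearMap.finrank_range_add_finrank_ker (Tm b f g).mulVecLin
    have h3 : LinearMap.ker (Tm b f g).mulVecLin = ⊥ := by
      rw [LinearMap.ker_eq_bot']; exact hker
    rw [h3] at h2
    simp only [finrank_bot, finrank_fintype_fun_eq_card, Fintype.card_prod, Fintype.card_fin, add_zero] at h2
    change (Tm b f g).rank = _ at h2
    rw [h2]
    have h4 := hI r (fun _ k => k) (fun l => strictMono_id) (intersecting_id s r)
    unfold ee at h4
    rw [← card_rows b hbp] at h4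
    have : (Fintype.card (Rows p b) : ℤ) ≤ (p * r : ℕ) := by push_cast; linarith
    exact_mod_cast this
  · push Not at hker
    obtain ⟨φ', hφ', hφ0⟩ := hker
    rw [Tm_ker] at hφ'
    obtain ⟨φ, hφe⟩ : ∃ φ : Matrix (Fin p) (Fin r) ℂ, φ = Matrix.of fun i j => φ' (i, j) := ⟨_, rfl⟩
    rw [← hφe] at hφ'
    have hφne : φ ≠ 0 := by
      intro h
      apply hφ0
      funext ⟨i, j⟩
      have := congrFun (congrFun (hφe.symm.trans h) i) j
      exact this
    let S := LinearMap.ker φ.mulVecLin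
    obtain ⟨d, hd⟩ : ∃ d, finrank ℂ S = d := ⟨_, rfl⟩
    have hdr : d < r := by
      rw [← hd]
      have : finrank ℂ S < finrank ℂ (Fin r → ℂ) := by
        apply Submodule.finrank_lt
        intro h
        apply hφne
        have : φ.mulVecLin = 0 := LinearMap.ker_eq_top.mp h
        ext i j
        have := congrFun (LinearMap.congr_fun this (Pi.single j 1)) i
        simpa using this
      simpa using this
    choose J w hJm hw using fun l => exists_pos (u l) (hu l) S hd
    have hJ : Intersecting J := hpos d J S hJm (IsPos.om hw hJm hd)
    have hcg : Surj (fun l k => b l (J l k)) (c0 ⟨d, hdr⟩ J) g := hc ⟨d, hdr⟩ J hJm hJ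
    obtain ⟨ι, lam, hι, hιS⟩ := Om.exists_mat hd
    have hφι : φ * ι = 0 := by
      ext i j
      have : ι.mulVecLin (Pi.single j 1) ∈ S := hιS ▸ LinearMap.mem_range_self _ _
      have := congrFun (LinearMap.mem_ker.mp this) i
      simp at this
      exact this
    have hui : ∀ l, f l * u l = (u l).det • 1 := fun l => Matrix.adjugate_mul _
    have hiu : ∀ l, u l * f l = (u l).det • 1 := fun l => Matrix.mul_adjugate _
    let F : (Fin s → Matrix (Fin d) (Fin d) ℂ) → Fin s → Matrix (Fin r) (Fin r) ℂ := fun c l => 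
      ι * c l * PJ (J l) + f l * DJ (J l)
    have hF : ∀ l i j, Ent (fun c => F c l i j) := by
      intro l i j
      have h2 : Ent (fun c : Fin s → Matrix (Fin d) (Fin d) ℂ => (ι * c l * PJ (J l)) i j) := by
        apply Ent.mulM (M := fun c : Fin s → Matrix (Fin d) (Fin d) ℂ => ι * c l) (N := fun _ => PJ (J l))
        · apply Ent.mulM (M := fun c : Fin s → Matrix (Fin d) (Fin d) ℂ => ι) 
            (N := fun c => c l)
          · intros; exact Ent.const _
          · exact ent_coord l
        · intros; exact Ent.const _
      exact h2.add (Ent.const _)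
    let c1 : Fin s → Matrix (Fin d) (Fin d) ℂ := fun l => lam * Matrix.of fun a k => w l k a
    have hc1 : ∀ l, ι * c1 l = Matrix.of fun a k => w l k a := by
      intro l
      ext a k
      have h2 : w l k ∈ LinearMap.range ι.mulVecLin := hιS ▸ (hw l k).1
      obtain ⟨y, hy⟩ := h2
      have h3 : (ι * c1 l) a k = ι.mulVec (lam.mulVec (w l k)) a := rfl
      have h4 : lam.mulVec (ι.mulVec y) = y := by rw [Matrix.mulVec_mulVec, hι, Matrix.one_mulVec]
      rw [h3, ← hy, Matrix.mulVecLin_apply, h4]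
      exact congrFun hy a
    -- the triangular matrix
    let t : Fin s → Matrix (Fin r) (Fin r) ℂ := fun l => ((u l).det)⁻¹ • (u l * F c1 l)
    have huF : ∀ l, u l * F c1 l = (u l * Matrix.of fun a k => w l k a) * PJ (J l) + (u l).det • DJ (J l) := by
      intro l
      simp only [F]
      rw [hc1, Matrix.mul_add, ← Matrix.mul_assoc, ← Matrix.mul_assoc, hiu]
      simp
    have ht1 : ∀ l i j, j < i → (u l * F c1 l) i j = 0 := by
      intro l i j hij
      rw [huF, Matrix.add_apply]
      by_cases hj : ∃ k', J l k' = j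
      · obtain ⟨k', rfl⟩ := hj
        rw [mul_PJ_J (hJm l).injective]
        have h2 : (u l * Matrix.of fun a k => w l k a) i k' = 0 := (hw l k').2.2 i hij
        rw [h2, Matrix.smul_apply, DJ_J]; simp
      · push Not at hj
        rw [mul_PJ_not _ _ _ hj]
        simp [DJ, hij.ne']
    have ht2 : ∀ l i, (u l * F c1 l) i i ≠ 0 := by
      intro l j
      rw [huF, Matrix.add_apply]
      by_cases hj : ∃ k', J l k' = j
      · obtain ⟨k', rfl⟩ := hj
        rw [mul_PJ_J (hJm l).injective]
        have h2 : (u l * Matrix.of fun a k => w l k a) (J l k') k' = 1 := (hw l k').2.1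
        rw [h2, Matrix.smul_apply, DJ_J]; simp
      · push Not at hj
        rw [mul_PJ_not _ _ _ hj]
        simp [DJ, hj, (hu l).ne_zero]
    have hft : (fun l => f l * t l) = F c1 := by
      funext l
      simp only [t]
      rw [Matrix.mul_smul, ← Matrix.mul_assoc, hui, Matrix.smul_mul, Matrix.one_mul, smul_smul,
        inv_mul_cancel₀ (hu l).ne_zero, one_smul]
    have hrk : (Tm b (F c1) g).rank = (Tm b f g).rank := by
      rw [← hft]
      apply rank_tri b hb
      · intro l i j hij
        simp [t, ht1 l i j hij]
      · intro l
        have h2 : Matrix.BlockTriangular (u l * F c1 l) id := fun i j hij => ht1 l i j hij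
        simp only [t]
        rw [Matrix.det_smul, Matrix.det_of_upperTriangular h2]
        apply IsUnit.mul
        · exact (isUnit_iff_ne_zero.mpr (inv_ne_zero (hu l).ne_zero)).pow _
        · rw [isUnit_iff_ne_zero, Finset.prod_ne_zero_iff]
          exact fun i _ => ht2 l i
    have K1 := gen_Tm_rank b F (fun _ => g) hF (fun _ _ _ => Ent.const _) c1
    have K2 := gen_surj (fun l k => b l (J l k)) (fun c => c) (fun _ => g) ent_coord (fun _ _ _ => Ent.const _) _ hcg
    obtain ⟨c, hc2, hc3⟩ := (K1.inter K2).nonempty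
    refine ⟨F c, g, surj_of_max b f (F c) g hg φ J (fun l => (hJm l).injective) ι lam hι hφι c (fun l => rfl) ?_ ?_ 
      hc3 ?_⟩
    · intro g'
      refine (hR _ _).trans ?_
      rw [← hrk]; exact hc2
    · exact hφ'
    · intro l
      apply exists_factor
      intro v hv
      have hS : (f l * DJ (J l)).mulVec v ∈ S := by
        change φ.mulVec _ = 0
        rw [Matrix.mulVec_mulVec, ← Matrix.mul_assoc]; exact hv
      have h3 : (u l).mulVec ((f l * DJ (J l)).mulVec v) = (u l).det • (DJ (J l)).mulVec v := by
        rw [Matrix.mulVec_mulVec, ← Matrix.mul_assoc, hiu, Matrix.smul_mul, Matrix.one_mul, Matrix.smul_mulVec]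
      have h4 : (f l * DJ (J l)).mulVec v = 0 := by
        rw [← (hw l).span_eq (hJm l) hd, Submodule.mem_span_range_iff_exists_fun] at hS
        obtain ⟨a, ha⟩ := hS
        have h5 := leading_indep (u l) (J l) (hJm l) (w l) (fun k => (hw l k).2.1) (fun k => (hw l k).2.2) a
          {j | ∀ k, J l k ≠ j} (by
            rw [ha]
            intro j hj
            simp only [Set.mem_setOf_eq, not_forall, not_not] at hj
            obtain ⟨k, rfl⟩ := hj
            rw [h3, Pi.smul_apply, DJ_mulVec, smul_zero])
        rw [← ha]
        apply Finset.sum_eq_zero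
        intro k _
        rw [h5 k (fun k' _ h => h k' rfl), zero_smul]
      rw [h4, Matrix.mulVec_zero] at h3
      exact (smul_eq_zero.mp h3.symm).resolve_left (hu l).ne_zero

end Horn

end

noncomputable section
namespace Horn

lemma edim_comp {s d r p : ℕ} (I : Fin s → Fin r → Fin (r + p)) (hI : ∀ l, StrictMono (I l)) 
    (J : Fin s → Fin d → Fin r) : 
    edim (fun l k => I l (J l k)) = edim J + ee p (fun l k => bK I l (J l k)) := by
  have h1 : ∀ l k, ((bK I l k : ℕ) : ℤ) = (I l k : ℤ) - k := by
    intro l k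
    have := le_of_strictMono (hI l) k
    simp only [bK]
    push_cast [this]; rfl
  have h2 : ∀ l, ∑ k, ((p : ℤ) - (bK I l (J l k) : ℕ)) = d * p - (dimI (fun k => I l (J l k)) - dimI (J l)) := by
    intro l
    simp only [h1, dimI, ← Finset.sum_sub_distrib]
    rw [Finset.sum_sub_distrib]
    simp
  unfold edim ee
  simp only [h2]
  push_cast
  simp only [Finset.sum_sub_distrib, Finset.sum_const, Finset.card_univ, Fintype.card_fin]
  simp only [nsmul_eq_mul]
  ring

lemma edim_id (s r : ℕ) : edim (fun (_ : Fin s) (k : Fin r) => k) = 0 := by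
  simp [edim, dimI]

lemma edim_eq {s r p : ℕ} (I : Fin s → Fin r → Fin (r + p)) (hI : ∀ l, StrictMono (I l)) : 
    edim I = ee p (bK I) := by
  have := edim_comp I hI (fun _ k => k)
  rw [edim_id, zero_add] at this
  exact this

lemma gen_two' {s d r : ℕ} (K : Fin s → Fin d → Fin r) (hd : d ≤ r) (hK : ∀ l, StrictMono (K l)) 
    (hI : Intersecting K) (he : edim K ≠ 0) : Gen {u | ∃ V V', V ≠ V' ∧ Om K u V ∧ Om K u V'} := by
  obtain ⟨q, rfl⟩ := Nat.exists_eq_add_of_le hd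
  exact gen_two K hK ((intersecting_iff_good K hK).mp hI) (by rwa [edim_eq K hK] at he)

section
variable {s r p : ℕ} (b : Fin s → Fin r → ℕ)

def EE (p : ℕ) (b : Fin s → Fin r → ℕ) (u : Fin s → Matrix (Fin r) (Fin r) ℂ) (V : Submodule ℂ (Fin r → ℂ)) : ℤ :=
  (p : ℤ) * finrank ℂ V - ∑ l, ∑ i : Fin p, (finrank ℂ ↥(V ⊓ fl (u l) {j | b l j ≤ (i : ℕ)}) : ℤ)

lemma EE_pos (hb : ∀ l, Monotone (b l)) (hbp : ∀ l k, b l k ≤ p) (u : Fin s → Matrix (Fin r) (Fin r) ℂ) 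
    {V : Submodule ℂ (Fin r → ℂ)} {d : ℕ}
    (hd : finrank ℂ V = d) {J : Fin s → Fin d → Fin r} {w : Fin s → Fin d → Fin r → ℂ} 
    (hw : ∀ l, IsPos (u l) V (J l) (w l)) (hJ : ∀ l, StrictMono (J l)) : 
    EE p b u V = ee p (fun l k => b l (J l k)) := by
  classical
  unfold EE ee
  rw [hd, ← card_rows (fun l k => b l (J l k)) (fun l k => hbp _ _)]
  congr 1
  rw [Fintype.card_subtype, Finset.card_filter, Fintype.sum_prod_type]
  push_cast
  apply Finset.sum_congr rfl; intro l _
  rw [Fintype.sum_prod_type]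
  apply Finset.sum_congr rfl; intro i _
  rw [(hw l).finrank_eq (hJ l) hd _ (by
    intro a c hca ha
    exact (hb l hca).trans ha), Finset.card_filter]
  push_cast
  rfl

lemma EE_le (hb : ∀ l, Monotone (b l)) (hbp : ∀ l k, b l k ≤ p) (u : Fin s → Matrix (Fin r) (Fin r) ℂ) 
    (hu : ∀ l, IsUnit (u l).det) {V : Submodule ℂ (Fin r → ℂ)} {d : ℕ} {K : Fin s → Fin d → Fin r} 
    (hV : Om K u V) : EE p b u V ≤ ee p (fun l k => b l (K l k)) := by
  choose J w hJm hw using fun l => exists_pos (u l) (hu l) V hV.1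
  rw [EE_pos b hb hbp u hV.1 hw hJm]
  unfold ee
  apply sub_le_sub_left
  apply Finset.sum_le_sum; intro l _
  apply Finset.sum_le_sum; intro k _
  apply sub_le_sub_left
  exact_mod_cast hb l ((hw l).le_of_om (hJm l) hV.1 k (hV.2 l k))

lemma EE_submod (u : Fin s → Matrix (Fin r) (Fin r) ℂ) (V V' : Submodule ℂ (Fin r → ℂ)) :
    EE p b u (V ⊔ V') + EE p b u (V ⊓ V') ≤ EE p b u V + EE p b u V' := by
  have h1 : (finrank ℂ ↥(V ⊔ V') : ℤ) + finrank ℂ ↥(V ⊓ V') = finrank ℂ V + finrank ℂ V' := by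
    exact_mod_cast Submodule.finrank_sup_add_finrank_inf_eq V V'
  have h2 : ∀ W : Submodule ℂ (Fin r → ℂ), (finrank ℂ ↥(V ⊓ W) : ℤ) + finrank ℂ ↥(V' ⊓ W) ≤ 
      finrank ℂ ↥((V ⊔ V') ⊓ W) + finrank ℂ ↥((V ⊓ V') ⊓ W) := by
    intro W
    have h3 := Submodule.finrank_sup_add_finrank_inf_eq (V ⊓ W) (V' ⊓ W)
    have h4 : V ⊓ W ⊔ V' ⊓ W ≤ (V ⊔ V') ⊓ W := 
      sup_le (inf_le_inf_right _ le_sup_left) (inf_le_inf_right _ le_sup_right)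
    have h5 : V ⊓ W ⊓ (V' ⊓ W) = (V ⊓ V') ⊓ W := by rw [inf_inf_inf_comm, inf_idem]
    rw [h5] at h3
    have h6 := Submodule.finrank_mono h4
    have : finrank ℂ ↥(V ⊓ W) + finrank ℂ ↥(V' ⊓ W) ≤ 
      finrank ℂ ↥((V ⊔ V') ⊓ W) + finrank ℂ ↥((V ⊓ V') ⊓ W) := by omega
    exact_mod_cast this
  have h3 : ∑ l, ∑ i : Fin p, (finrank ℂ ↥(V ⊓ fl (u l) {j | b l j ≤ (i : ℕ)}) : ℤ) + 
      ∑ l, ∑ i : Fin p, (finrank ℂ ↥(V' ⊓ fl (u l) {j | b l j ≤ (i : ℕ)}) : ℤ) ≤ 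
      ∑ l, ∑ i : Fin p, (finrank ℂ ↥((V ⊔ V') ⊓ fl (u l) {j | b l j ≤ (i : ℕ)}) : ℤ) + 
      ∑ l, ∑ i : Fin p, (finrank ℂ ↥((V ⊓ V') ⊓ fl (u l) {j | b l j ≤ (i : ℕ)}) : ℤ) := by
    simp only [← Finset.sum_add_distrib]
    exact Finset.sum_le_sum fun l _ => Finset.sum_le_sum fun i _ => h2 _
  unfold EE
  have h4 : (p : ℤ) * finrank ℂ ↥(V ⊔ V') + p * finrank ℂ ↥(V ⊓ V') = p * finrank ℂ V + p * finrank ℂ V' := by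
    rw [← mul_add, h1, mul_add]
  linarith

/-- The admissible pairs. -/
def Adm (d : ℕ) (J : Fin s → Fin d → Fin r) : Prop := 1 ≤ d ∧ (∀ l, StrictMono (J l)) ∧ Intersecting J

lemma exists_opt {d1 : ℕ} (J1 : Fin s → Fin d1 → Fin r) (hd1 : d1 ≤ r) (h1 : Adm d1 J1) : 
    ∃ (d0 : ℕ) (K0 : Fin s → Fin d0 → Fin r), d0 ≤ r ∧ Adm d0 K0 ∧ ∀ (d : ℕ) (J : Fin s → Fin d → Fin r), 
      d ≤ r → Adm d J → 
      ee p (fun l k => b l (K0 l k)) * d ≤ ee p (fun l k => b l (J l k)) * d0 ∧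
      (ee p (fun l k => b l (K0 l k)) * d = ee p (fun l k => b l (J l k)) * d0 → d ≤ d0) := by
  classical
  let X := Σ d : Fin (r + 1), Fin s → Fin d → Fin r
  let F : X → ℚ ×ₗ ℤ := fun x => toLex ((ee p (fun l k => b l (x.2 l k)) : ℚ) / ((x.1 : ℕ) : ℚ), - ((x.1 : ℕ) : ℤ))
  obtain ⟨x, hx, hmin⟩ := Set.exists_min_image {x : X | Adm x.1 x.2} F (Set.toFinite _) 
    ⟨⟨⟨d1, Nat.lt_succ_iff.mpr hd1⟩, J1⟩, h1⟩
  obtain ⟨⟨d0, hd0⟩, K0⟩ := x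
  refine ⟨d0, K0, Nat.lt_succ_iff.mp hd0, hx, fun d J hd hJ => ?_⟩
  have h2 := hmin ⟨⟨d, Nat.lt_succ_iff.mpr hd⟩, J⟩ hJ
  have p0 : (0 : ℚ) < d0 := by exact_mod_cast hx.1
  have p1 : (0 : ℚ) < d := by exact_mod_cast hJ.1
  simp only [F] at h2
  rw [Prod.Lex.toLex_le_toLex] at h2
  simp only at h2
  rw [div_lt_div_iff₀ p0 p1, div_eq_div_iff p0.ne' p1.ne'] at h2
  rcases h2 with h2 | ⟨h2, h3⟩
  · have h2' : ee p (fun l k => b l (K0 l k)) * d < ee p (fun l k => b l (J l k)) * d0 := by exact_mod_cast h2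
    exact ⟨h2'.le, fun h => absurd h h2'.ne⟩
  · have h2' : ee p (fun l k => b l (K0 l k)) * d = ee p (fun l k => b l (J l k)) * d0 := by exact_mod_cast h2
    exact ⟨h2'.le, fun _ => by omega⟩

lemma intersecting_perm {d : ℕ} (σ : Equiv.Perm (Fin s)) {J : Fin s → Fin d → Fin r} (h : Intersecting J) : 
    Intersecting (fun l => J (σ⁻¹ l)) := by
  intro F
  obtain ⟨V, h1, h2⟩ := h (fun l => F (σ l))
  refine ⟨V, h1, fun l k => ?_⟩
  have h3 := h2 (σ⁻¹ l) k
  have e : σ (σ⁻¹ l) = l := Equiv.apply_symm_apply σ l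
  have e2 : F (σ (σ⁻¹ l)) = F l := congrArg F e
  exact e2 ▸ h3

theorem stepD (hb : ∀ l, Monotone (b l)) (hbp : ∀ l k, b l k ≤ p) (σ : Equiv.Perm (Fin s))
    (hbσ : ∀ l, b (σ⁻¹ l) = b l) (hn : ¬ Good p b) : 
    ∃ (d : ℕ) (J : Fin s → Fin d → Fin r), d ≤ r ∧ 1 ≤ d ∧ (∀ l, StrictMono (J l)) ∧ (fun l => J (σ⁻¹ l)) = J ∧ 
      Intersecting J ∧ edim J = 0 ∧ ee p (fun l k => b l (J l k)) < 0 := by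
  classical
  obtain ⟨d1, J1, hd1, hJ1, hneg⟩ : ∃ (d : ℕ) (J : Fin s → Fin d → Fin r), d ≤ r ∧ Adm d J ∧ 
      ee p (fun l k => b l (J l k)) < 0 := by
    by_contra hc
    push Not at hc
    apply hn
    apply good_of_ineq s p r b hb hbp
    intro d J hJm hJ
    rcases Nat.eq_zero_or_pos d with rfl | hd
    · simp [ee]
    · have hdr : d ≤ r := by
        by_cases hs : Nonempty (Fin s)
        · obtain ⟨l⟩ := hs
          simpa using Fintype.card_le_of_injective _ (hJm l).injective
        · have := not_nonempty_iff.mp hs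
          obtain ⟨V, hV, _⟩ := hJ (fun l => isEmptyElim l)
          rw [← hV]
          exact (Submodule.finrank_le V).trans (by simp)
      exact hc d J hdr ⟨hd, hJm, hJ⟩
  obtain ⟨d0, K0, hd0, hK0, hopt⟩ := exists_opt (p := p) b J1 hd1 hJ1
  obtain ⟨e0, he0⟩ : ∃ e0, e0 = ee p (fun l k => b l (K0 l k)) := ⟨_, rfl⟩
  rw [← he0] at hopt
  have hd0pos : (0 : ℤ) < d0 := by exact_mod_cast hK0.1
  have he0neg : e0 < 0 := by
    have h1 := (hopt d1 J1 hd1 hJ1).1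
    have h2 : (0 : ℤ) < d1 := by exact_mod_cast hJ1.1
    by_contra hc
    push Not at hc
    nlinarith [mul_nonneg hc h2.le, mul_neg_of_neg_of_pos hneg hd0pos]
  -- generic flags
  let O : Set (Fin s → Matrix (Fin r) (Fin r) ℂ) := {u | (∀ (d : ℕ) (J : Fin s → Fin d → Fin r) V, 
    (∀ l, StrictMono (J l)) → Om J u V → Intersecting J) ∧ ∀ l, IsUnit (u l).det}
  have hO : Gen O := (gen_pos s r).inter 
    (gen_unit (fun u : Fin s → Matrix (Fin r) (Fin r) ℂ => u) ent_coord (fun _ => 1) (by simp))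
  have hH : ∀ u ∈ O, ∀ V : Submodule ℂ (Fin r → ℂ), e0 * finrank ℂ V ≤ EE p b u V * d0 ∧ 
      (e0 * finrank ℂ V = EE p b u V * d0 → finrank ℂ V ≤ d0) := by
    intro u hu V
    obtain ⟨d, hd⟩ : ∃ d, finrank ℂ V = d := ⟨_, rfl⟩
    choose J w hJm hw using fun l => exists_pos (u l) (hu.2 l) V hd
    rw [EE_pos b hb hbp u hd hw hJm, hd]
    rcases Nat.eq_zero_or_pos d with rfl | hdpos
    · simp [ee]
    · have hdr : d ≤ r := by
        rw [← hd]
        exact (Submodule.finrank_le V).trans (by simp)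
      exact hopt d J hdr ⟨hdpos, hJm, hu.1 d J V hJm (IsPos.om hw hJm hd)⟩
  have huniq : ∀ u ∈ O, ∀ V V' : Submodule ℂ (Fin r → ℂ), finrank ℂ V = d0 → finrank ℂ V' = d0 → EE p b u V ≤ e0 → EE p b u V' ≤ e0 → 
      V = V' := by
    intro u hu V V' hV hV' hE hE'
    have h1 := EE_submod (p := p) b u V V'
    have h2 := hH u hu (V ⊔ V')
    have h3 := (hH u hu (V ⊓ V')).1
    have h4 : (finrank ℂ ↥(V ⊔ V') : ℤ) + finrank ℂ ↥(V ⊓ V') = d0 + d0 := by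
      have := Submodule.finrank_sup_add_finrank_inf_eq V V'
      rw [hV, hV'] at this
      exact_mod_cast this
    have h5 : e0 * finrank ℂ ↥(V ⊔ V') + e0 * finrank ℂ ↥(V ⊓ V') = e0 * d0 + e0 * d0 := by
      rw [← mul_add, h4, mul_add]
    have h6 : (EE p b u (V ⊔ V') + EE p b u (V ⊓ V')) * d0 ≤ (e0 + e0) * d0 := 
      mul_le_mul_of_nonneg_right (by linarith) hd0pos.le
    have h7 := h2.2 (by linarith [h2.1])
    have h8 : V = V ⊔ V' := Submodule.eq_of_le_of_finrank_le le_sup_left (by omega)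
    have h9 : V' = V ⊔ V' := Submodule.eq_of_le_of_finrank_le le_sup_right (by omega)
    exact h8.trans h9.symm
  obtain ⟨u, hu⟩ := hO.nonempty
  obtain ⟨W, hW⟩ := (intersecting_iff K0).mp hK0.2.2 u hu.2
  choose J w hJm hw using fun l => exists_pos (u l) (hu.2 l) W hW.1
  have hWE : EE p b u W ≤ e0 := by rw [he0]; exact EE_le b hb hbp u hu.2 hW
  have hJI : Intersecting J := hu.1 d0 J W hJm (IsPos.om hw hJm hW.1)
  have hJe : ee p (fun l k => b l (J l k)) ≤ e0 := by
    rw [← EE_pos b hb hbp u hW.1 hw hJm]; exact hWE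
  have hstab : (fun l => J (σ⁻¹ l)) = J := by
    obtain ⟨V', hV'⟩ := (intersecting_iff _).mp (intersecting_perm σ hJI) u hu.2
    have h1 := EE_le b hb hbp u hu.2 hV'
    have h2 : ee p (fun l k => b l (J (σ⁻¹ l) k)) = ee p (fun l k => b l (J l k)) := by
      unfold ee
      congr 1
      rw [← Equiv.sum_comp σ⁻¹ (fun l => ∑ k, ((p : ℤ) - (b l (J l k) : ℕ)))]
      simp only [hbσ]
    rw [h2] at h1
    have h3 : W = V' := huniq u hu W V' hW.1 hV'.1 hWE (h1.trans hJe)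
    subst h3
    have h4 : ∀ l k, J l k ≤ J (σ⁻¹ l) k := fun l k => (hw l).le_of_om (K := J (σ⁻¹ l)) (hJm l) hW.1 k (hV'.2 l k)
    funext l k
    have h5 : ∑ l, (((J l k : Fin r)) : ℕ) = ∑ l, (((J (σ⁻¹ l) k : Fin r)) : ℕ) := (Equiv.sum_comp σ⁻¹ (fun l => (J l k : ℕ))).symm
    rw [Finset.sum_eq_sum_iff_of_le (fun l _ => Fin.le_def.mp (h4 l k))] at h5
    exact (Fin.ext (h5 l (Finset.mem_univ _))).symm
  refine ⟨d0, J, hd0, hK0.1, hJm, hstab, hJI, ?_, lt_of_le_of_lt hJe he0neg⟩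
  by_contra he
  obtain ⟨u', ⟨V, V', hne, hV, hV'⟩, hu'⟩ := ((gen_two' J hd0 hJm hJI he).inter hO).nonempty
  exact hne (huniq u' hu' V V' hV.1 hV'.1 ((EE_le b hb hbp u' hu'.2 hV).trans hJe) 
    ((EE_le b hb hbp u' hu'.2 hV').trans hJe))

end
end Horn

end

/-- **Main theorem (σ-stable refinement of Belkale's theorem).** For a `σ`-stable
`𝐈 ∈ Subsets(r,n,s)^σ` the following are equivalent: (1) `𝐈` is intersecting;
(2) `edim 𝐈 ≥ 0` and `𝐈` satisfies the Horn inequalities for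
`Intersecting(d,r,s)^σ` for all `d ∈ [r-1]`; (3) the same with
`Intersecting⁰(d,r,s)^σ`. -/
theorem main_theorem (s r n : ℕ) (hs : 2 ≤ s) (hr : 1 ≤ r) (hrn : r ≤ n)
    (σ : Equiv.Perm (Fin s))
    (I : Fin s → Fin r → Fin n) (hI : ∀ l, StrictMono (I l))
    (hIσ : (fun l => I (σ⁻¹ l)) = I) :
    (Intersecting I ↔
      (0 ≤ edim I ∧ ∀ (d : ℕ), 1 ≤ d → d < r →
        ∀ J : Fin s → Fin d → Fin r, (∀ l, StrictMono (J l)) →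
          (fun l => J (σ⁻¹ l)) = J → Intersecting J →
          edim J ≤ edim (fun l k => I l (J l k)))) ∧
    (Intersecting I ↔
      (0 ≤ edim I ∧ ∀ (d : ℕ), 1 ≤ d → d < r →
        ∀ J : Fin s → Fin d → Fin r, (∀ l, StrictMono (J l)) →
          (fun l => J (σ⁻¹ l)) = J → Intersecting J → edim J = 0 →
          edim J ≤ edim (fun l k => I l (J l k)))) := by
  obtain ⟨p, rfl⟩ := Nat.exists_eq_add_of_le hrn
  have hb : ∀ l, Monotone (Horn.bK I l) := fun l => Horn.sub_mono (hI l)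
  have hbp : ∀ l k, Horn.bK I l k ≤ p := fun l k => Horn.sub_le (hI l) k
  have h12 : Intersecting I → (0 ≤ edim I ∧ ∀ (d : ℕ), 1 ≤ d → d < r →
        ∀ J : Fin s → Fin d → Fin r, (∀ l, StrictMono (J l)) →
          (fun l => J (σ⁻¹ l)) = J → Intersecting J →
          edim J ≤ edim (fun l k => I l (J l k))) := by
    intro h
    have hg := (Horn.intersecting_iff_good I hI).mp h
    refine ⟨?_, fun d hd hdr J hJm _ hJ => ?_⟩
    · rw [Horn.edim_eq I hI]
      exact Horn.ee_nonneg hbp hg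
    · rw [Horn.edim_comp I hI J]
      have := Horn.ee_nonneg (fun l k => hbp l (J l k)) (Horn.Good.comp hb hg hJ)
      change 0 ≤ Horn.ee p (fun l k => Horn.bK I l (J l k)) at this
      linarith
  have h31 : (0 ≤ edim I ∧ ∀ (d : ℕ), 1 ≤ d → d < r →
        ∀ J : Fin s → Fin d → Fin r, (∀ l, StrictMono (J l)) →
          (fun l => J (σ⁻¹ l)) = J → Intersecting J → edim J = 0 →
          edim J ≤ edim (fun l k => I l (J l k))) → Intersecting I := by
    rintro ⟨h0, h3⟩
    rw [Horn.intersecting_iff_good I hI]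
    by_contra hn
    have hbσ : ∀ l, Horn.bK I (σ⁻¹ l) = Horn.bK I l := by
      intro l
      have h := congrFun hIσ l
      funext k
      simp only [Horn.bK, h]
    obtain ⟨d, J, hdr, hd, hJm, hJσ, hJ, hJ0, hneg⟩ := Horn.stepD (Horn.bK I) hb hbp σ hbσ hn
    rcases hdr.lt_or_eq with hlt | rfl
    · have := h3 d hd hlt J hJm hJσ hJ hJ0
      rw [Horn.edim_comp I hI J] at this
      linarith
    · have e : ∀ l k, J l k = k := by
        intro l k
        have hsurj : Function.Surjective (J l) := Finite.surjective_of_injective (hJm l).injective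
        have := Subsingleton.elim ((hJm l).orderIsoOfSurjective _ hsurj) (OrderIso.refl _)
        exact congrArg (fun f : Fin d ≃o Fin d => f k) this
      simp only [e] at hneg
      rw [Horn.edim_eq I hI] at h0
      exact absurd h0 (not_le.mpr hneg)
  exact ⟨⟨h12, fun h => h31 ⟨h.1, fun d hd hdr J a b c _ => h.2 d hd hdr J a b c⟩⟩,
    ⟨fun h => ⟨(h12 h).1, fun d hd hdr J a b c _ => (h12 h).2 d hd hdr J a b c⟩, h31⟩⟩
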